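/- Fix d ≥ 2, let x be the unique root in (0,1) of (d+1)(1−x) + (1+dx)·log x = 0, set c_d* = −log x / (1−x)^d, and let p = c/n with 0 < c < c_d* constant. Then w.h.p. the kernel of the d-th boundary map of Y_d(n,p) over ℝ is spanned by the boundaries of (d+1)-simplices (i.e., by the d-cycles supported on (d+2)-element vertex sets all of whose (d+1)-element subsets are faces of Y), and consequently P[H_d(Y_d(n,p), ℝ) = 0] → exp(−c^{d+2}/(d+2)!) as n → ∞. -/

import Mathlib

open MeasureTheory Filter Finset Matrix

noncomputable section

/-- Bernoulli measure on `Bool` with success probability `p` (clamped to `[0,1]`). -/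
def bernoulliBool (p : ℝ) : Measure Bool :=
  ENNReal.ofReal (max 0 (min p 1)) • Measure.dirac true +
    ENNReal.ofReal (1 - max 0 (min p 1)) • Measure.dirac false

instance (p : ℝ) : IsFiniteMeasure (bernoulliBool p) := by
  constructor
  simp only [bernoulliBool, Measure.add_apply, Measure.smul_apply, smul_eq_mul,
    measure_univ, mul_one]
  exact ENNReal.add_lt_top.mpr ⟨ENNReal.ofReal_lt_top, ENNReal.ofReal_lt_top⟩

/-- Index type for potential `d`-dimensional faces on vertex set `Fin n`:
the `(d+1)`-element subsets. -/
abbrev FaceIdx (n d : ℕ) : Type := {s : Finset (Fin n) // s.card = d + 1}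

/-- The distribution of the random `d`-complex `Y_d(n,p)`: each potential `d`-face
gets an independent Bernoulli(`p`) coin. (For `d = 1` this is the Erdős–Rényi model
`G(n,p)`.) -/
def YMeasure (n d : ℕ) (p : ℝ) : Measure (FaceIdx n d → Bool) :=
  Measure.pi fun _ => bernoulliBool p

/-- The random `d`-complex: all faces of dimension `≤ d - 1` (i.e. all subsets of
cardinality `≤ d`, including `∅`, so that degree-0 homology below is reduced
homology), together with the chosen `d`-faces. -/
def Ycomplex (n d : ℕ) (ω : FaceIdx n d → Bool) : Finset (Finset (Fin n)) :=
  Finset.univ.filter fun s => s.card ≤ d ∨ ∃ h : s.card = d + 1, ω ⟨s, h⟩ = true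

/-- The Erdős–Rényi random graph associated to a configuration of edge coins. -/
def graphOf (n : ℕ) (ω : FaceIdx n 1 → Bool) : SimpleGraph (Fin n) where
  Adj i j := i ≠ j ∧ ∃ e : FaceIdx n 1, ω e = true ∧ i ∈ e.1 ∧ j ∈ e.1
  symm := ⟨fun i j ⟨hne, e, he, hi, hj⟩ => ⟨hne.symm, e, he, hj, hi⟩⟩
  loopless := ⟨fun i ⟨hne, _⟩ => hne rfl⟩

instance (n : ℕ) (ω : FaceIdx n 1 → Bool) : DecidableRel (graphOf n ω).Adj :=
  fun i j =>
    inferInstanceAs (Decidable (i ≠ j ∧ ∃ e : FaceIdx n 1, ω e = true ∧ i ∈ e.1 ∧ j ∈ e.1))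

/-- The clique complex of the graph determined by the edge coins `ω`:
faces are vertex sets of complete subgraphs (including `∅` and singletons). -/
def cliqueComplex (n : ℕ) (ω : FaceIdx n 1 → Bool) : Finset (Finset (Fin n)) :=
  Finset.univ.filter fun s => ∀ i ∈ s, ∀ j ∈ s, i ≠ j → (graphOf n ω).Adj i j

/-- The group of simplicial `G`-chains of a complex `K`, in cardinality `c`
(i.e. dimension `c - 1`): functions on the faces of `K` of cardinality `c`. -/
abbrev Chains {V : Type} [Fintype V] [DecidableEq V]
    (K : Finset (Finset V)) (c : ℕ) (G : Type) : Type :=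
  {s : Finset V // s ∈ K ∧ s.card = c} → G

/-- The simplicial boundary map, from chains of cardinality `c+1` to chains of
cardinality `c`, with the usual alternating signs coming from the linear order
on the vertices. -/
def chainBoundary {V : Type} [Fintype V] [DecidableEq V] [LinearOrder V]
    (K : Finset (Finset V)) (c : ℕ) {G : Type} [AddCommGroup G]
    (f : Chains K (c + 1) G) : Chains K c G :=
  fun τ => ∑ v : V,
    if h : v ∉ τ.1 ∧ insert v τ.1 ∈ K then
      ((-1 : ℤ) ^ (τ.1.filter (fun u => u < v)).card) •
        f ⟨insert v τ.1, h.2, by rw [Finset.card_insert_of_notMem h.1, τ.2.2]⟩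
    else 0

/-- Vanishing of the simplicial homology of `K` with coefficients in `G` in
degree `i` (faces of cardinality `i+1`): every cycle is a boundary.
If `∅ ∈ K` this is reduced homology (the boundary map to cardinality-0 chains
is the augmentation); in degrees `i ≥ 1` reduced and unreduced homology agree. -/
def HomologyZero {V : Type} [Fintype V] [DecidableEq V] [LinearOrder V]
    (K : Finset (Finset V)) (i : ℕ) (G : Type) [AddCommGroup G] : Prop :=
  ∀ f : Chains K (i + 1) G, chainBoundary K i f = 0 →
    ∃ g : Chains K (i + 2) G, chainBoundary K (i + 1) g = f

/-- Vanishing of top-dimensional homology `H_d(K,G)`, i.e. the kernel of the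
`d`-th boundary map is zero. -/
def TopHomologyZero {V : Type} [Fintype V] [DecidableEq V] [LinearOrder V]
    (K : Finset (Finset V)) (d : ℕ) (G : Type) [AddCommGroup G] : Prop :=
  ∀ f : Chains K (d + 1) G, chainBoundary K d f = 0 → f = 0

/-- The boundary map on real coefficients, as a linear map. -/
def chainBoundaryLin {V : Type} [Fintype V] [DecidableEq V] [LinearOrder V]
    (K : Finset (Finset V)) (c : ℕ) : Chains K (c + 1) ℝ →ₗ[ℝ] Chains K c ℝ where
  toFun := chainBoundary K c
  map_add' f g := by
    funext τ
    simp only [chainBoundary, Pi.add_apply]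
    rw [← Finset.sum_add_distrib]
    refine Finset.sum_congr rfl fun v _ => ?_
    split
    · simp [smul_add]
    · simp
  map_smul' r f := by
    funext τ
    simp only [chainBoundary, Pi.smul_apply, RingHom.id_apply]
    rw [Finset.smul_sum]
    refine Finset.sum_congr rfl fun v _ => ?_
    split
    · exact smul_comm _ _ _
    · simp

/-- The `k`-th Betti number of `K`: the dimension of the `k`-th real simplicial
homology, i.e. of (kernel of `∂_k`) / (image of `∂_{k+1}`). -/
def bettiNumber {V : Type} [Fintype V] [DecidableEq V] [LinearOrder V]
    (K : Finset (Finset V)) (k : ℕ) : ℕ :=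
  Module.finrank ℝ
    (↥(LinearMap.ker (chainBoundaryLin K k)) ⧸
      (LinearMap.range (chainBoundaryLin K (k + 1))).comap
        (LinearMap.ker (chainBoundaryLin K k)).subtype)

/-- The link of a face `σ` in the complex `K`. -/
def linkSet {V : Type} [Fintype V] [DecidableEq V]
    (K : Finset (Finset V)) (σ : Finset V) : Finset (Finset V) :=
  Finset.univ.filter fun τ => τ ∩ σ = ∅ ∧ τ ∪ σ ∈ K

/-- The graph underlying the link of a face `σ`: its vertices are the vertices
of the link, joined when they span an edge of the link. -/
def linkGraph {V : Type} [Fintype V] [DecidableEq V]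
    (K : Finset (Finset V)) (σ : Finset V) :
    SimpleGraph {v : V // {v} ∈ linkSet K σ} where
  Adj a b := a ≠ b ∧ ({a.1, b.1} : Finset V) ∈ linkSet K σ
  symm := ⟨fun a b ⟨hab, h⟩ => ⟨hab.symm, by rwa [Finset.pair_comm]⟩⟩
  loopless := ⟨fun a ⟨hab, _⟩ => hab rfl⟩

instance {V : Type} [Fintype V] [DecidableEq V] (K : Finset (Finset V)) (σ : Finset V) :
    DecidableRel (linkGraph K σ).Adj :=
  fun a b => inferInstanceAs (Decidable (a ≠ b ∧ ({a.1, b.1} : Finset V) ∈ linkSet K σ))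

/-- The normalized Laplacian `I - D^{-1/2} A D^{-1/2}` of a finite graph. -/
def normalizedLaplacian {W : Type} [Fintype W] [DecidableEq W]
    (H : SimpleGraph W) [DecidableRel H.Adj] : Matrix W W ℝ :=
  Matrix.of fun a b =>
    (if a = b then (1 : ℝ) else 0) -
      (if H.Adj a b then 1 / Real.sqrt ((H.degree a : ℝ) * (H.degree b : ℝ)) else 0)

/-- An elementary `d`-collapse step: remove a free `(d-1)`-face `σ` together with
the unique `d`-face `τ` containing it. -/
def CollapseStep {V : Type} [DecidableEq V] (d : ℕ) (K K' : Finset (Finset V)) : Prop :=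
  ∃ σ τ : Finset V, σ ∈ K ∧ τ ∈ K ∧ τ.card = d + 1 ∧ σ ⊆ τ ∧ σ.card = d ∧
    (∀ ρ ∈ K, σ ⊆ ρ → ρ.card = d + 1 → ρ = τ) ∧ K' = K \ {σ, τ}

/-- `K` is `d`-collapsible if some finite sequence of elementary collapses reduces it
to a complex of dimension at most `d-1`. -/
def IsDCollapsible {V : Type} [DecidableEq V] (d : ℕ) (K : Finset (Finset V)) : Prop :=
  ∃ K' : Finset (Finset V),
    Relation.ReflTransGen (CollapseStep d) K K' ∧ ∀ s ∈ K', s.card ≤ d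

/-- The geometric realization of a complex on vertex set `Fin n`, inside `ℝ^n`:
the union over the faces of the convex hulls of the corresponding standard
basis vectors. -/
def geomReal (n : ℕ) (K : Finset (Finset (Fin n))) : Set (Fin n → ℝ) :=
  ⋃ σ ∈ K, convexHull ℝ ((fun i => (Pi.single i 1 : Fin n → ℝ)) '' ↑σ)

/-- The boundary of the simplex on the vertex set `τ`, as a chain of cardinality
`c` (to be used with `τ.card = c + 1`): the alternating sum of the `c`-element
subsets of `τ`. -/
def simplexBoundaryChain {V : Type} [Fintype V] [DecidableEq V] [LinearOrder V]
    (K : Finset (Finset V)) (c : ℕ) (τ : Finset V) : Chains K c ℝ :=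
  fun σ => ∑ v ∈ τ,
    if σ.1 = τ.erase v then ((-1 : ℝ) ^ (τ.filter (fun u => u < v)).card) else 0

/-- Index type for the multiparameter model: all potential faces of dimension `≥ 1`. -/
abbrev MultiIdx (n : ℕ) : Type := {s : Finset (Fin n) // 2 ≤ s.card}

/-- The distribution of the multiparameter random complex `X(n; p₁, p₂, …)`:
a potential face of cardinality `i+1` gets an independent Bernoulli(`p i`) coin. -/
def multiMeasure (n : ℕ) (p : ℕ → ℝ) : Measure (MultiIdx n → Bool) :=
  Measure.pi fun t => bernoulliBool (p (t.1.card - 1))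

/-- The multiparameter random complex: a set `s` is a face iff every subset of `s`
of dimension `≥ 1` has its coin turned on (this is exactly the
inductive-by-dimension construction: a face is present iff its coin is on and all
of its boundary faces are present). -/
def multiComplex (n : ℕ) (ω : MultiIdx n → Bool) : Finset (Finset (Fin n)) :=
  Finset.univ.filter fun s => ∀ t : MultiIdx n, t.1 ⊆ s → ω t = true

/-- The Vietoris–Rips complex of the points `pts` at scale `r`. -/
def VRcomplex (n d : ℕ) (pts : Fin n → EuclideanSpace ℝ (Fin d)) (r : ℝ) :
    Finset (Finset (Fin n)) :=
  Finset.univ.filter fun s => ∀ i ∈ s, ∀ j ∈ s, dist (pts i) (pts j) ≤ r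

end

noncomputable section
namespace LP

section Ex
variable {α : Type*} [DecidableEq α]

def Ex (U : Finset α) (p : ℝ) (g : Finset α → ℝ) : ℝ :=
  ∑ S ∈ U.powerset, p ^ #S * (1 - p) ^ #(U \ S) * g S

lemma Ex_empty (p : ℝ) (g : Finset α → ℝ) : Ex ∅ p g = g ∅ := by simp [Ex]

lemma Ex_insert {U : Finset α} {a : α} (ha : a ∉ U) (p : ℝ) (g : Finset α → ℝ) :
    Ex (insert a U) p g = (1 - p) * Ex U p g + p * Ex U p (fun S => g (insert a S)) := by
  unfold Ex
  rw [sum_powerset_insert ha, mul_sum, mul_sum]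
  congr 1
  · refine sum_congr rfl fun S hS => ?_
    have hS := Finset.mem_powerset.1 hS
    rw [insert_sdiff_of_notMem _ (fun h => ha (hS h)), card_insert_of_notMem (by simp [ha])]
    ring
  · refine sum_congr rfl fun S hS => ?_
    have hS := Finset.mem_powerset.1 hS
    rw [insert_sdiff_insert, card_insert_of_notMem (fun h => ha (hS h)),
      sdiff_insert_of_notMem ha]
    ring

lemma Ex_add (U : Finset α) (p : ℝ) (g h : Finset α → ℝ) :
    Ex U p (fun S => g S + h S) = Ex U p g + Ex U p h := by
  simp only [Ex, mul_add, sum_add_distrib]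

lemma Ex_mul (U : Finset α) (p : ℝ) (a : ℝ) (g : Finset α → ℝ) :
    Ex U p (fun S => a * g S) = a * Ex U p g := by
  simp only [Ex, mul_sum]; exact sum_congr rfl fun _ _ => by ring

lemma Ex_sub (U : Finset α) (p : ℝ) (g h : Finset α → ℝ) :
    Ex U p (fun S => g S - h S) = Ex U p g - Ex U p h := by
  simp only [Ex, mul_sub, sum_sub_distrib]

lemma Ex_sum {ι : Type*} (s : Finset ι) (U : Finset α) (p : ℝ) (g : ι → Finset α → ℝ) :
    Ex U p (fun S => ∑ i ∈ s, g i S) = ∑ i ∈ s, Ex U p (g i) := by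
  simp only [Ex, mul_sum]; exact sum_comm

lemma Ex_congr {U : Finset α} (p : ℝ) {g h : Finset α → ℝ} (H : ∀ S ⊆ U, g S = h S) :
    Ex U p g = Ex U p h :=
  sum_congr rfl fun S hS => by rw [H S (Finset.mem_powerset.1 hS)]

lemma Ex_mono {U : Finset α} {p : ℝ} (h0 : 0 ≤ p) (h1 : p ≤ 1) {g h : Finset α → ℝ}
    (H : ∀ S ⊆ U, g S ≤ h S) : Ex U p g ≤ Ex U p h :=
  sum_le_sum fun S hS => by
    have : 0 ≤ 1 - p := by linarith
    exact mul_le_mul_of_nonneg_left (H S (Finset.mem_powerset.1 hS)) (by positivity)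

lemma Ex_const (U : Finset α) (p a : ℝ) : Ex U p (fun _ => a) = a := by
  induction U using Finset.induction_on with
  | empty => simp [Ex_empty]
  | insert b U hb ih => rw [Ex_insert hb, ih]; ring

lemma Ex_nonneg {U : Finset α} {p : ℝ} (h0 : 0 ≤ p) (h1 : p ≤ 1) {g : Finset α → ℝ}
    (H : ∀ S ⊆ U, 0 ≤ g S) : 0 ≤ Ex U p g := by
  have := Ex_mono h0 h1 H; rwa [Ex_const] at this

lemma Ex_le {U : Finset α} {p a : ℝ} (h0 : 0 ≤ p) (h1 : p ≤ 1) {g : Finset α → ℝ}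
    (H : ∀ S ⊆ U, g S ≤ a) : Ex U p g ≤ a := by
  have := Ex_mono h0 h1 H; rwa [Ex_const] at this

lemma Ex_union {U V : Finset α} (h : Disjoint U V) (p : ℝ) (g : Finset α → ℝ) :
    Ex (U ∪ V) p g = Ex U p (fun A => Ex V p (fun B => g (A ∪ B))) := by
  induction U using Finset.induction_on generalizing g with
  | empty => simp [Ex_empty]
  | insert a U ha ih =>
    rw [disjoint_insert_left] at h
    rw [insert_union, Ex_insert (by simp [ha, h.1]), Ex_insert ha, ih h.2, ih h.2]
    simp only [insert_union]

lemma Ex_sdiff {U V : Finset α} (h : V ⊆ U) (p : ℝ) (g : Finset α → ℝ) :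
    Ex U p g = Ex V p (fun A => Ex (U \ V) p (fun B => g (A ∪ B))) := by
  rw [← Ex_union disjoint_sdiff, union_sdiff_of_subset h]

lemma Ex_superset {U T : Finset α} (h : T ⊆ U) (p : ℝ) :
    Ex U p (fun S => if T ⊆ S then 1 else 0) = p ^ #T := by
  induction U using Finset.induction_on generalizing T with
  | empty => simp [Finset.subset_empty.1 h, Ex_empty]
  | insert a U ha ih =>
    rw [Ex_insert ha]
    by_cases haT : a ∈ T
    · have e1 : Ex U p (fun S => if T ⊆ S then (1 : ℝ) else 0) = 0 := by
        rw [Ex_congr (h := fun _ => 0), Ex_const]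
        intro S hS
        rw [if_neg]; intro h'; exact ha (hS (h' haT))
      have e2 := ih (T := T.erase a) (by rwa [← subset_insert_iff])
      rw [e1]
      simp only [← subset_insert_iff] at e2
      rw [e2, card_erase_of_mem haT, mul_zero, zero_add, ← pow_succ',
        Nat.sub_add_cancel (Finset.card_pos.2 ⟨a, haT⟩)]
    · have hT : T ⊆ U := (subset_insert_iff_of_notMem haT).1 h
      simp only [subset_insert_iff_of_notMem haT]
      rw [ih hT]; ring

lemma Ex_sprinkle (U : Finset α) (p q : ℝ) (g : Finset α → ℝ) :
    Ex U p (fun S => Ex U q (fun R => g (S ∪ R))) = Ex U (p + q - p * q) g := by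
  induction U using Finset.induction_on generalizing g with
  | empty => simp [Ex_empty]
  | insert a U ha ih =>
    rw [Ex_insert ha, Ex_insert ha, ← ih, ← ih]
    simp only [Ex_insert ha, insert_union, union_insert, insert_idem, Ex_add, Ex_mul]
    ring

lemma Ex_markov {U : Finset α} {p a : ℝ} (h0 : 0 ≤ p) (h1 : p ≤ 1) (ha : 0 < a)
    {g : Finset α → ℝ} (H : ∀ S ⊆ U, 0 ≤ g S) (P : Finset α → Prop) [DecidablePred P]
    (hP : ∀ S ⊆ U, P S → a ≤ g S) :
    Ex U p (fun S => if P S then 1 else 0) ≤ Ex U p g / a := by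
  rw [le_div_iff₀ ha, mul_comm, ← Ex_mul]
  refine Ex_mono h0 h1 fun S hS => ?_
  split_ifs with h
  · simpa using hP S hS h
  · simpa using H S hS

lemma Ex_drop {U V : Finset α} (h : V ⊆ U) {p : ℝ} (h0 : 0 ≤ p) (h1 : p ≤ 1) {g : Finset α → ℝ}
    (H : ∀ S ⊆ U, 0 ≤ g S) : (1 - p) ^ #(U \ V) * Ex V p g ≤ Ex U p g := by
  rw [Ex_sdiff h, ← Ex_mul]
  refine Ex_mono h0 h1 fun A hA => ?_
  have h2 : (0:ℝ) ≤ 1 - p := by linarith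
  have := single_le_sum (f := fun B => p ^ #B * (1 - p) ^ #((U \ V) \ B) * g (A ∪ B))
    (s := (U \ V).powerset) (fun B hB => by
      have hB := Finset.mem_powerset.1 hB
      have := H (A ∪ B) (union_subset (hA.trans h) (hB.trans sdiff_subset))
      positivity) (empty_mem_powerset _)
  simpa [Ex] using this

lemma Ex_perm {U : Finset α} (e : Equiv.Perm α) (hU : ∀ a, a ∈ U ↔ e a ∈ U) (p : ℝ)
    (g : Finset α → ℝ) : Ex U p (fun S => g (S.map e.toEmbedding)) = Ex U p g := by
  have hm : U.map e.toEmbedding = U := by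
    ext a; simp only [mem_map_equiv]; rw [hU]; simp
  refine sum_bij (fun S _ => S.map e.toEmbedding) ?_ ?_ ?_ ?_
  · intro S hS
    rw [mem_powerset] at hS ⊢
    intro a ha
    rw [mem_map_equiv] at ha
    have := (hU _).1 (hS ha); simpa using this
  · intro S _ S' _ h; exact Finset.map_injective _ h
  · intro S hS
    rw [mem_powerset] at hS
    refine ⟨S.map e.symm.toEmbedding, ?_, ?_⟩
    · rw [mem_powerset]; intro a ha
      rw [mem_map_equiv] at ha
      exact (hU _).2 (hS (by simpa using ha))
    · ext a; simp
  · intro S hS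
    have : #(U \ S.map e.toEmbedding) = #(U \ S) := by
      conv_lhs => rw [← hm, ← Finset.map_sdiff]
      rw [card_map]
    rw [card_map, this]
end Ex

abbrev UU (n d : ℕ) : Finset (Finset (Fin n)) := powersetCard (d + 1) univ

def faces {n d : ℕ} (ω : FaceIdx n d → Bool) : Finset (Finset (Fin n)) :=
  Finset.univ.filter fun s => ∃ h : s.card = d + 1, ω ⟨s, h⟩ = true

lemma faces_sub {n d : ℕ} (ω : FaceIdx n d → Bool) : faces ω ⊆ UU n d := by
  intro s hs; simp only [faces, mem_filter, mem_univ, true_and] at hs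
  simp [mem_powersetCard, hs.1]

lemma bern_single {p : ℝ} (h0 : 0 ≤ p) (h1 : p ≤ 1) (b : Bool) :
    bernoulliBool p {b} = ENNReal.ofReal (if b then p else 1 - p) := by
  have : max 0 (min p 1) = p := by rw [min_eq_left h1, max_eq_right h0]
  cases b <;> simp [bernoulliBool, this]

lemma YMeasure_eq {n d : ℕ} {p : ℝ} (h0 : 0 ≤ p) (h1 : p ≤ 1) (P : Finset (Finset (Fin n)) → Prop)
    [DecidablePred P] : YMeasure n d p {ω | P (faces ω)} =
      ENNReal.ofReal (Ex (UU n d) p (fun S => if P S then 1 else 0)) := by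
  classical
  have h2 : (0:ℝ) ≤ 1 - p := by linarith
  have hs : ∀ ω : FaceIdx n d → Bool, YMeasure n d p {ω} =
      ENNReal.ofReal (p ^ #(faces ω) * (1 - p) ^ #(UU n d \ faces ω)) := by
    intro ω
    have hU : UU n d = Finset.univ.filter (fun s : Finset (Fin n) => s.card = d + 1) := by
      ext s; simp [mem_powersetCard]
    have e1 : #(faces ω) = #(Finset.univ.filter fun i : FaceIdx n d => ω i = true) := by
      rw [← card_map (Function.Embedding.subtype _)]
      congr 1; ext s; simp [faces]
    have e2 : #(UU n d \ faces ω) = #(Finset.univ.filter fun i : FaceIdx n d => ¬ ω i = true) := by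
      rw [← card_map (Function.Embedding.subtype _) (s := Finset.univ.filter fun i : FaceIdx n d => ¬ ω i = true)]
      congr 1; ext s; simp only [hU, faces, Finset.mem_sdiff, mem_filter, mem_univ, true_and,
        Finset.mem_map, Function.Embedding.coe_subtype, not_exists]
      constructor
      · rintro ⟨h, h'⟩; exact ⟨⟨s, h⟩, h' h, rfl⟩
      · rintro ⟨⟨s, h⟩, h', rfl⟩; exact ⟨h, fun _ => h'⟩
    rw [YMeasure, Measure.pi_singleton]
    simp_rw [bern_single h0 h1]
    rw [← ENNReal.ofReal_prod_of_nonneg (fun i _ => by split_ifs <;> assumption)]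
    rw [prod_ite]
    simp only [prod_const]; rw [e1, e2]
  have h3 : YMeasure n d p {ω | P (faces ω)} =
      ∑ ω ∈ Finset.univ.filter (fun ω : FaceIdx n d → Bool => P (faces ω)), YMeasure n d p {ω} := by
    rw [sum_measure_singleton]; congr 1; ext; simp
  rw [h3]; simp_rw [hs]
  rw [← ENNReal.ofReal_sum_of_nonneg (fun i _ => by positivity)]
  congr 1
  rw [Ex]; simp only [mul_ite, mul_one, mul_zero]; rw [← sum_filter]
  refine sum_bij (fun ω _ => faces ω) ?_ ?_ ?_ ?_
  · intro ω hω; simp only [mem_filter, mem_univ, true_and] at hω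
    simp only [mem_filter, mem_powerset]; exact ⟨faces_sub ω, hω⟩
  · intro ω _ ω' _ h
    funext ⟨s, hs⟩
    have := congrArg (fun F => s ∈ F) h
    simp only [faces, mem_filter, mem_univ, true_and, hs, exists_true_left] at this
    cases h1 : ω ⟨s, hs⟩ <;> cases h2 : ω' ⟨s, hs⟩ <;> simp_all
  · intro S hS
    simp only [mem_filter, mem_powerset] at hS
    have : faces (fun i : FaceIdx n d => decide (i.1 ∈ S)) = S := by
      ext s; simp only [faces, mem_filter, mem_univ, true_and, decide_eq_true_eq]
      constructor
      · exact fun h => h.2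
      · intro h; have := hS.1 h; simp [mem_powersetCard] at this; exact ⟨this, h⟩
    refine ⟨_, ?_, this⟩
    simp only [mem_filter, mem_univ, true_and]; rw [this]; exact hS.2
  · intro ω _; rfl

end LP
end

noncomputable section
namespace LP

section Pois
variable {α ι : Type*} [DecidableEq α] [DecidableEq ι]

def noP (U : Finset α) (p : ℝ) (T : ι → Finset α) (F : Finset ι) : ℝ :=
  Ex U p (fun S => if ∀ i ∈ F, ¬ T i ⊆ S then 1 else 0)

lemma noP_mono {U : Finset α} {p : ℝ} (h0 : 0 ≤ p) (h1 : p ≤ 1) {T : ι → Finset α}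
    {F F' : Finset ι} (h : F' ⊆ F) : noP U p T F ≤ noP U p T F' := by
  refine Ex_mono h0 h1 fun S _ => ?_
  by_cases h' : ∀ i ∈ F, ¬ T i ⊆ S
  · rw [if_pos h', if_pos (fun i hi => h' i (h hi))]
  · rw [if_neg h']; split_ifs <;> norm_num

lemma noP_le_add {U : Finset α} {p : ℝ} (h0 : 0 ≤ p) (h1 : p ≤ 1) {T : ι → Finset α}
    {F F' : Finset ι} (hT : ∀ i ∈ F, T i ⊆ U) :
    noP U p T F' ≤ noP U p T F + ∑ j ∈ F \ F', p ^ #(T j) := by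
  have : ∑ j ∈ F \ F', p ^ #(T j) =
      Ex U p (fun S => ∑ j ∈ F \ F', if T j ⊆ S then (1:ℝ) else 0) := by
    rw [Ex_sum]
    exact sum_congr rfl fun j hj => (Ex_superset (hT j (Finset.mem_sdiff.1 hj).1) p).symm
  rw [this, noP, noP, ← Ex_add]
  refine Ex_mono h0 h1 fun S _ => ?_
  have hn : ∀ j ∈ F \ F', (0:ℝ) ≤ if T j ⊆ S then 1 else 0 := fun j _ => by split_ifs <;> norm_num
  have hs := sum_nonneg hn
  by_cases h : ∀ i ∈ F, ¬ T i ⊆ S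
  · rw [if_pos h]; split_ifs <;> linarith
  · rw [if_neg h]
    split_ifs with h'
    · push Not at h
      obtain ⟨i, hi, hiS⟩ := h
      have := single_le_sum hn (Finset.mem_sdiff.2 ⟨hi, fun h2 => h' i h2 hiS⟩)
      rw [if_pos hiS] at this; linarith
    · linarith

lemma noP_step {U : Finset α} {p : ℝ} (h0 : 0 ≤ p) (h1 : p ≤ 1) {T : ι → Finset α}
    {F : Finset ι} {i : ι} (hT : ∀ j ∈ insert i F, T j ⊆ U) :
    |noP U p T (insert i F) - (1 - p ^ #(T i)) * noP U p T F| ≤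
      ∑ j ∈ F with ¬ Disjoint (T i) (T j), (p ^ #(T i) * p ^ #(T j) + p ^ #(T i ∪ T j)) := by
  set F' := F.filter (fun j => Disjoint (T i) (T j)) with hF'
  have hFF : F.filter (fun j => ¬ Disjoint (T i) (T j)) = F \ F' := by
    ext j; simp [hF']; tauto
  rw [hFF]
  have hTi := hT i (mem_insert_self _ _)
  have hTF : ∀ j ∈ F, T j ⊆ U := fun j hj => hT j (mem_insert_of_mem hj)
  have hind : Ex U p (fun S => if T i ⊆ S ∧ ∀ j ∈ F', ¬ T j ⊆ S then (1:ℝ) else 0) =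
      p ^ #(T i) * noP U p T F' := by
    rw [noP, Ex_sdiff hTi, Ex_sdiff (U := U) hTi]
    have key : ∀ A ⊆ T i, ∀ B, (∀ j ∈ F', ¬ T j ⊆ A ∪ B) ↔ (∀ j ∈ F', ¬ T j ⊆ B) := by
      intro A hA B
      refine forall₂_congr fun j hj => not_congr ⟨fun h => ?_, fun h => h.trans subset_union_right⟩
      have hd : Disjoint (T i) (T j) := (Finset.mem_filter.1 hj).2
      intro x hx
      rcases Finset.mem_union.1 (h hx) with h2 | h2
      · exact absurd hx (Finset.disjoint_left.1 hd (hA h2))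
      · exact h2
    have e1 : ∀ A ⊆ T i, Ex (U \ T i) p (fun B => if T i ⊆ A ∪ B ∧ ∀ j ∈ F', ¬ T j ⊆ A ∪ B then (1:ℝ) else 0) =
        (if T i ⊆ A then 1 else 0) * Ex (U \ T i) p (fun B => if ∀ j ∈ F', ¬ T j ⊆ B then (1:ℝ) else 0) := by
      intro A hA
      rw [← Ex_mul]
      refine Ex_congr _ fun B hB => ?_
      have : T i ⊆ A ∪ B ↔ T i ⊆ A := by
        refine ⟨fun h x hx => ?_, fun h => h.trans subset_union_left⟩
        rcases Finset.mem_union.1 (h hx) with h2 | h2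
        · exact h2
        · exact absurd hx (Finset.mem_sdiff.1 (hB h2)).2
      simp only [key A hA B, this]
      by_cases h3 : T i ⊆ A <;> simp [h3]
    have e2 : ∀ A ⊆ T i, Ex (U \ T i) p (fun B => if ∀ j ∈ F', ¬ T j ⊆ A ∪ B then (1:ℝ) else 0) =
        Ex (U \ T i) p (fun B => if ∀ j ∈ F', ¬ T j ⊆ B then (1:ℝ) else 0) := by
      intro A hA
      refine Ex_congr _ fun B hB => ?_
      simp only [key A hA B]
    rw [Ex_congr p e1, Ex_congr p e2, Ex_const]
    rw [← Ex_superset (subset_refl (T i)) p, mul_comm, ← Ex_mul]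
    exact Ex_congr _ fun A _ => mul_comm _ _
  have hrec : noP U p T (insert i F) = noP U p T F -
      Ex U p (fun S => if T i ⊆ S ∧ ∀ j ∈ F, ¬ T j ⊆ S then (1:ℝ) else 0) := by
    rw [noP, noP, ← Ex_sub]
    refine Ex_congr _ fun S _ => ?_
    simp only [forall_mem_insert]
    by_cases h1 : T i ⊆ S <;> by_cases h2 : ∀ j ∈ F, ¬ T j ⊆ S <;> simp [h1, h2]
  have hup : Ex U p (fun S => if T i ⊆ S ∧ ∀ j ∈ F, ¬ T j ⊆ S then (1:ℝ) else 0) ≤ p ^ #(T i) * noP U p T F' := by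
    rw [← hind]
    refine Ex_mono h0 h1 fun S _ => ?_
    by_cases h : T i ⊆ S ∧ ∀ j ∈ F, ¬ T j ⊆ S
    · rw [if_pos h, if_pos ⟨h.1, fun j hj => h.2 j (Finset.mem_filter.1 hj).1⟩]
    · rw [if_neg h]; split_ifs <;> norm_num
  have hlow : p ^ #(T i) * noP U p T F' ≤ Ex U p (fun S => if T i ⊆ S ∧ ∀ j ∈ F, ¬ T j ⊆ S then (1:ℝ) else 0)
      + ∑ j ∈ F \ F', p ^ #(T i ∪ T j) := by
    have : ∑ j ∈ F \ F', p ^ #(T i ∪ T j) =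
        Ex U p (fun S => ∑ j ∈ F \ F', if T i ∪ T j ⊆ S then (1:ℝ) else 0) := by
      rw [Ex_sum]
      exact sum_congr rfl fun j hj =>
        (Ex_superset (union_subset hTi (hTF j (Finset.mem_sdiff.1 hj).1)) p).symm
    rw [this, ← hind, ← Ex_add]
    refine Ex_mono h0 h1 fun S _ => ?_
    have hn : ∀ j ∈ F \ F', (0:ℝ) ≤ if T i ∪ T j ⊆ S then 1 else 0 := fun j _ => by split_ifs <;> norm_num
    have hs := sum_nonneg hn
    by_cases h : T i ⊆ S ∧ ∀ i ∈ F, ¬ T i ⊆ S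
    · rw [if_pos h]; split_ifs <;> linarith
    · rw [if_neg h]
      split_ifs with h'
      · have h2 : ∃ j ∈ F, T j ⊆ S := by
          by_contra h3; push Not at h3; exact h ⟨h'.1, h3⟩
        obtain ⟨j, hj, hjS⟩ := h2
        have := single_le_sum hn (Finset.mem_sdiff.2 ⟨hj, fun h2 => h'.2 j h2 hjS⟩)
        rw [if_pos (union_subset h'.1 hjS)] at this; linarith
      · linarith
  have hm := noP_mono h0 h1 (U := U) (T := T) (filter_subset (fun j => Disjoint (T i) (T j)) F)
  rw [← hF'] at hm
  have ha := noP_le_add h0 h1 (F' := F') hTF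
  have hq : (0:ℝ) ≤ p ^ #(T i) := by positivity
  rw [hrec, sum_add_distrib, ← mul_sum, abs_le]
  have hs1 : 0 ≤ ∑ j ∈ F \ F', p ^ #(T i ∪ T j) := sum_nonneg fun _ _ => by positivity
  have hs2 : 0 ≤ ∑ j ∈ F \ F', p ^ #(T j) := sum_nonneg fun _ _ => by positivity
  constructor <;> nlinarith [mul_le_mul_of_nonneg_left hm hq, mul_le_mul_of_nonneg_left ha hq, mul_nonneg hq hs2]

lemma noP_approx {U : Finset α} {p : ℝ} (h0 : 0 ≤ p) (h1 : p ≤ 1) {T : ι → Finset α} {m : ℕ} {e : ℝ}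
    (G F : Finset ι) (hFG : F ⊆ G) (hT : ∀ j ∈ G, T j ⊆ U ∧ #(T j) = m)
    (he : ∀ i ∈ G, ∑ j ∈ (G.erase i).filter (fun j => ¬ Disjoint (T i) (T j)),
        (p ^ #(T i) * p ^ #(T j) + p ^ #(T i ∪ T j)) ≤ e) :
    |noP U p T F - (1 - p ^ m) ^ #F| ≤ #F * e := by
  induction F using Finset.induction_on with
  | empty => simp [noP, Ex_const]
  | insert i F hi ih =>
    have hi' := hFG (mem_insert_self _ _)
    have hF := (subset_insert i F).trans hFG
    have h3 := noP_step h0 h1 (U := U) (T := T) (i := i) (F := F) (fun j hj => (hT j (hFG hj)).1)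
    have h4 : _ ≤ e := h3.trans ((sum_le_sum_of_subset_of_nonneg (fun j hj => by
      simp only [mem_filter, mem_erase] at hj ⊢
      exact ⟨⟨fun h => hi (h ▸ hj.1), hF hj.1⟩, hj.2⟩) (fun _ _ _ => by positivity)).trans (he i hi'))
    rw [(hT i hi').2] at h4
    have ih := ih hF
    have hq : (0:ℝ) ≤ p ^ m := by positivity
    have hq1 : p ^ m ≤ 1 := pow_le_one₀ h0 h1
    rw [card_insert_of_notMem hi, pow_succ]
    push_cast
    rw [abs_le] at *
    constructor <;> nlinarith [mul_le_mul_of_nonneg_left ih.1 (sub_nonneg.2 hq1), mul_le_mul_of_nonneg_left ih.2 (sub_nonneg.2 hq1),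
      mul_nonneg hq (by linarith [ih.1, ih.2] : (0:ℝ) ≤ #F * e)]
end Pois

def hasSimp {n : ℕ} (d : ℕ) (S : Finset (Finset (Fin n))) : Prop :=
  ∃ τ : Finset (Fin n), #τ = d + 2 ∧ powersetCard (d + 1) τ ⊆ S

lemma simp_pair {n d : ℕ} {τ τ' : Finset (Fin n)} (h : #τ = d + 2) (h' : #τ' = d + 2) (hne : τ' ≠ τ)
    (hd : ¬ Disjoint (powersetCard (d+1) τ) (powersetCard (d+1) τ')) :
    (∃ v ∈ τ, ∃ w, τ' = insert w (τ.erase v)) ∧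
    #(powersetCard (d+1) τ ∪ powersetCard (d+1) τ') = 2 * d + 3 := by
  rw [not_disjoint_iff] at hd
  obtain ⟨σ, h1, h2⟩ := hd
  rw [mem_powersetCard] at h1 h2
  have hint : τ ∩ τ' = σ := by
    symm; apply eq_of_subset_of_card_le (subset_inter h1.1 h2.1)
    rw [h1.2]
    by_contra hc
    push Not at hc
    have e1 : τ ∩ τ' = τ := eq_of_subset_of_card_le inter_subset_left (by omega)
    have e2 : τ ∩ τ' = τ' := eq_of_subset_of_card_le inter_subset_right (by omega)
    exact hne (e2 ▸ e1)
  constructor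
  · obtain ⟨v, hv, rfl⟩ := (exists_eq_insert_iff (s := σ) (t := τ)).2 ⟨h1.1, by omega⟩
    obtain ⟨w, hw, rfl⟩ := (exists_eq_insert_iff (s := σ) (t := τ')).2 ⟨h2.1, by omega⟩
    exact ⟨v, by simp, w, by rw [erase_insert hv]⟩
  · have := card_union_add_card_inter (powersetCard (d+1) τ) (powersetCard (d+1) τ')
    have e3 : powersetCard (d+1) τ ∩ powersetCard (d+1) τ' = powersetCard (d+1) σ := by
      ext s; simp only [mem_inter, mem_powersetCard, ← hint, subset_inter_iff]; tauto
    rw [e3, card_powersetCard, card_powersetCard, card_powersetCard, h, h', h1.2,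
      Nat.choose_self, show d + 2 = (d + 1) + 1 from rfl, Nat.choose_succ_self_right] at this
    omega

lemma poisson_bound {n d : ℕ} {p : ℝ} (h0 : 0 ≤ p) (h1 : p ≤ 1) :
    |Ex (UU n d) p (fun S => by classical exact if ¬ hasSimp d S then 1 else 0) - (1 - p ^ (d+2)) ^ (n.choose (d+2))|
      ≤ n.choose (d+2) * ((d + 2) * n * (2 * p ^ (2 * d + 3))) := by
  have := noP_approx (U := UU n d) h0 h1 (T := fun τ => powersetCard (d+1) τ) (m := d + 2)
    (e := (d + 2) * n * (2 * p ^ (2 * d + 3))) (powersetCard (d+2) (univ : Finset (Fin n))) _ (subset_refl _)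
    (fun τ hτ => by
      rw [mem_powersetCard] at hτ
      refine ⟨powersetCard_mono hτ.1, ?_⟩
      rw [card_powersetCard, hτ.2, show d + 2 = (d + 1) + 1 from rfl, Nat.choose_succ_self_right])
    (fun τ hτ => by
      rw [mem_powersetCard] at hτ
      have hsub : ((powersetCard (d+2) (univ : Finset (Fin n))).erase τ).filter
          (fun τ' => ¬ Disjoint (powersetCard (d+1) τ) (powersetCard (d+1) τ')) ⊆
          (τ ×ˢ (univ : Finset (Fin n))).image (fun vw => insert vw.2 (τ.erase vw.1)) := by
        intro τ' h
        simp only [mem_filter, mem_erase, mem_powersetCard] at h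
        obtain ⟨v, hv, w, hw⟩ := (simp_pair hτ.2 h.1.2.2 h.1.1 h.2).1
        simp only [mem_image, mem_product, mem_univ, and_true]
        exact ⟨(v, w), hv, hw.symm⟩
      have hc := (card_le_card hsub).trans card_image_le
      rw [card_product, hτ.2, card_univ, Fintype.card_fin] at hc
      calc _ ≤ ∑ τ' ∈ (((powersetCard (d+2) (univ : Finset (Fin n))).erase τ).filter
          (fun τ' => ¬ Disjoint (powersetCard (d+1) τ) (powersetCard (d+1) τ'))), (2 * p ^ (2 * d + 3)) := by
            refine sum_le_sum fun τ' h => ?_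
            simp only [mem_filter, mem_erase, mem_powersetCard] at h
            rw [(simp_pair hτ.2 h.1.2.2 h.1.1 h.2).2]
            simp only [card_powersetCard, h.1.2.2, hτ.2]
            rw [show d + 2 = (d + 1) + 1 from rfl, Nat.choose_succ_self_right, ← pow_add]
            have : p ^ (d + 1 + 1 + (d + 1 + 1)) ≤ p ^ (2 * d + 3) := pow_le_pow_of_le_one h0 h1 (by omega)
            linarith
        _ ≤ _ := by
          rw [sum_const, nsmul_eq_mul]
          refine mul_le_mul_of_nonneg_right ?_ (by positivity)
          exact_mod_cast hc)
  rw [card_powersetCard, card_univ, Fintype.card_fin] at this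
  convert this using 4
  unfold noP
  congr 1; funext S
  have : ¬ hasSimp d S ↔ ∀ i ∈ powersetCard (d+2) (univ : Finset (Fin n)), ¬ powersetCard (d+1) i ⊆ S := by
    unfold hasSimp; push Not; simp [mem_powersetCard]
  simp only [this]; congr

lemma tendsto_choose_mul (k : ℕ) (c : ℝ) :
    Tendsto (fun n : ℕ => (n.choose k : ℝ) * (c / n) ^ k) atTop (nhds (c ^ k / k.factorial)) := by
  refine ProbabilityTheory.tendsto_choose_mul_pow_atTop k ?_
  refine tendsto_const_nhds.congr' ?_
  filter_upwards [eventually_gt_atTop 0] with n hn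
  field_simp

lemma poisson_limit {d : ℕ} (hd : 1 ≤ d) {c : ℝ} (hc : 0 < c) :
    Tendsto (fun n : ℕ => Ex (UU n d) (c / n) (fun S => by classical exact if ¬ hasSimp d S then 1 else 0))
      atTop (nhds (Real.exp (-(c ^ (d + 2)) / (Nat.factorial (d + 2))))) := by
  have hp0 : Tendsto (fun n : ℕ => c / (n:ℝ)) atTop (nhds 0) := tendsto_const_div_atTop_nhds_zero_nat c
  have hN := tendsto_choose_mul (d + 2) c
  have hev : ∀ᶠ n : ℕ in atTop, c / (n:ℝ) < 1 / 2 := hp0.eventually_lt_const (by norm_num)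
  have hmain : Tendsto (fun n : ℕ => (1 - (c / (n:ℝ)) ^ (d+2)) ^ (n.choose (d+2))) atTop
      (nhds (Real.exp (-(c ^ (d + 2)) / (Nat.factorial (d + 2))))) := by
    have hq0 : Tendsto (fun n : ℕ => (c / (n:ℝ)) ^ (d+2)) atTop (nhds 0) := by
      simpa using hp0.pow (d+2)
    have hU : Tendsto (fun n : ℕ => Real.exp (-((n.choose (d+2) : ℝ) * (c / n) ^ (d+2)))) atTop
      (nhds (Real.exp (-(c ^ (d + 2)) / (Nat.factorial (d + 2))))) := by
      rw [neg_div]; exact (Real.continuous_exp.tendsto _).comp hN.neg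
    have hL : Tendsto (fun n : ℕ => Real.exp (-((n.choose (d+2) : ℝ) * (c / n) ^ (d+2) / (1 - (c / (n:ℝ)) ^ (d+2))))) atTop
      (nhds (Real.exp (-(c ^ (d + 2)) / (Nat.factorial (d + 2))))) := by
      rw [neg_div]
      refine (Real.continuous_exp.tendsto _).comp (Tendsto.neg ?_)
      have := hN.div (tendsto_const_nhds (x := (1:ℝ)).sub hq0) (by norm_num)
      rw [sub_zero, div_one] at this; exact this
    refine tendsto_of_tendsto_of_tendsto_of_le_of_le' hL hU ?_ ?_
    · filter_upwards [hev] with n hn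
      have h0 : 0 ≤ c / (n:ℝ) := by positivity
      have hq : (c / (n:ℝ)) ^ (d+2) < 1 := pow_lt_one₀ h0 (by linarith) (by omega)
      set q := (c / (n:ℝ)) ^ (d+2)
      have hpos : 0 < 1 - q := by linarith
      have : Real.exp (-(q / (1 - q))) ≤ 1 - q := by
        rw [← Real.le_log_iff_exp_le hpos]
        have := Real.one_sub_inv_le_log_of_pos hpos
        have e : 1 - (1 - q)⁻¹ = -(q / (1 - q)) := by field_simp; ring
        linarith
      calc _ = Real.exp (-(q / (1 - q))) ^ (n.choose (d+2)) := by
            rw [← Real.exp_nat_mul]; congr 1; ring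
        _ ≤ _ := pow_le_pow_left₀ (Real.exp_pos _).le this _
    · filter_upwards [hev] with n hn
      have h0 : 0 ≤ c / (n:ℝ) := by positivity
      have hq : (c / (n:ℝ)) ^ (d+2) < 1 := pow_lt_one₀ h0 (by linarith) (by omega)
      calc _ ≤ Real.exp (-((c / (n:ℝ)) ^ (d+2))) ^ (n.choose (d+2)) :=
            pow_le_pow_left₀ (by linarith) (Real.one_sub_le_exp_neg _) _
        _ = _ := by rw [← Real.exp_nat_mul]; congr 1; ring
  have herr : Tendsto (fun n : ℕ => (n.choose (d+2) : ℝ) * ((d + 2) * n * (2 * (c / (n:ℝ)) ^ (2 * d + 3)))) atTop (nhds 0) := by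
    have := ((hN.mul (tendsto_const_nhds (x := ((d:ℝ) + 2) * 2 * c))).mul (hp0.pow d))
    rw [zero_pow (by omega), mul_zero] at this
    refine this.congr' ?_
    filter_upwards [eventually_gt_atTop 0] with n hn
    have : (n:ℝ) * (c / n) = c := by field_simp
    calc _ = (n.choose (d+2) : ℝ) * (c / n) ^ (d+2) * (((d:ℝ) + 2) * 2 * ((n:ℝ) * (c / n))) * (c / n) ^ d := by rw [this]
      _ = _ := by ring
  have : Tendsto (fun n : ℕ => Ex (UU n d) (c / n) (fun S => by classical exact if ¬ hasSimp d S then 1 else 0)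
      - (1 - (c / (n:ℝ)) ^ (d+2)) ^ (n.choose (d+2))) atTop (nhds 0) := by
    refine squeeze_zero_norm' ?_ herr
    filter_upwards [hev] with n hn
    exact poisson_bound (by positivity) (by linarith)
  simpa using this.add hmain

end LP
end

noncomputable section
namespace LP

variable {n : ℕ}

abbrev EE (n : ℕ) := EuclideanSpace ℝ (Finset (Fin n))

def ee (κ : Finset (Fin n)) : EE n := EuclideanSpace.single κ 1

def sg (κ : Finset (Fin n)) (v : Fin n) : ℝ := (-1) ^ #(κ.filter (· < v))

def bd (σ : Finset (Fin n)) : EE n := ∑ v ∈ σ, sg σ v • ee (σ.erase v)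

def Bs (S : Finset (Finset (Fin n))) : Submodule ℝ (EE n) := Submodule.span ℝ (bd '' (S : Set (Finset (Fin n))))

def IsCore (S : Finset (Finset (Fin n))) : Prop :=
  ∀ σ ∈ S, ∀ v ∈ σ, ∃ σ' ∈ S, σ' ≠ σ ∧ σ.erase v ⊆ σ'

open Classical in
def cyc (S : Finset (Finset (Fin n))) : Finset (Finset (Fin n)) := S.filter fun σ => bd σ ∈ Bs (S.erase σ)

lemma sg_ne (κ : Finset (Fin n)) (v : Fin n) : sg κ v ≠ 0 := by unfold sg; positivity

lemma sg_insert_self {κ : Finset (Fin n)} {v : Fin n} : sg (insert v κ) v = sg κ v := by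
  unfold sg; rw [filter_insert, if_neg (lt_irrefl _)]

def ext0 {K : Finset (Finset (Fin n))} {c : ℕ} (f : Chains K c ℝ) (σ : Finset (Fin n)) : ℝ :=
  if h : σ ∈ K ∧ σ.card = c then f ⟨σ, h⟩ else 0

lemma bdry_apply {K : Finset (Finset (Fin n))} {c : ℕ} (f : Chains K (c + 1) ℝ) (τ) :
    chainBoundary K c f τ = ∑ v ∈ τ.1ᶜ, sg τ.1 v * ext0 f (insert v τ.1) := by
  unfold chainBoundary
  rw [← sum_subset (subset_univ (τ.1ᶜ))]
  · refine sum_congr rfl fun v hv => ?_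
    rw [mem_compl] at hv
    by_cases h : insert v τ.1 ∈ K
    · rw [dif_pos ⟨hv, h⟩, ext0, dif_pos ⟨h, by rw [card_insert_of_notMem hv, τ.2.2]⟩]
      simp [sg]
    · rw [dif_neg (fun h' => h h'.2), ext0, dif_neg (fun h' => h h'.1), mul_zero]
  · intro v _ hv
    rw [dif_neg]; simp at hv; tauto

lemma ee_apply (κ κ' : Finset (Fin n)) : (ee κ : EE n) κ' = if κ' = κ then 1 else 0 := by
  simp [ee]

lemma bd_apply (σ κ : Finset (Fin n)) :
    bd σ κ = ∑ v ∈ σ, if κ = σ.erase v then sg σ v else 0 := by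
  simp [bd, ee_apply]

lemma bd_apply_erase {σ : Finset (Fin n)} {v : Fin n} (hv : v ∈ σ) : bd σ (σ.erase v) = sg σ v := by
  rw [bd_apply, sum_eq_single v]
  · simp
  · intro w hw hne
    rw [if_neg]; intro h
    have : v ∈ σ.erase w := Finset.mem_erase.2 ⟨hne.symm, hv⟩
    rw [← h] at this; simp at this
  · exact fun h => absurd hv h

lemma bd_apply_ne {σ κ : Finset (Fin n)} (h : ¬ ∃ v ∈ σ, κ = σ.erase v) : bd σ κ = 0 := by
  rw [bd_apply]; refine sum_eq_zero fun v hv => ?_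
  rw [if_neg fun h' => h ⟨v, hv, h'⟩]

lemma mem_Y {d : ℕ} {ω : FaceIdx n d → Bool} {σ : Finset (Fin n)} :
    σ ∈ Ycomplex n d ω ∧ #σ = d + 1 ↔ σ ∈ faces ω := by
  simp only [Ycomplex, faces, mem_filter, mem_univ, true_and]
  constructor
  · rintro ⟨h | h, h'⟩
    · omega
    · exact h
  · intro h; exact ⟨Or.inr h, h.1⟩

lemma ext0_ne {d : ℕ} {ω : FaceIdx n d → Bool} {f : Chains (Ycomplex n d ω) (d+1) ℝ}
    {σ : Finset (Fin n)} (h : ext0 f σ ≠ 0) : σ ∈ faces ω := by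
  by_contra h'; rw [← mem_Y] at h'; exact h (by rw [ext0, dif_neg h'])

lemma rel_of_ker {d : ℕ} {ω : FaceIdx n d → Bool} {f : Chains (Ycomplex n d ω) (d+1) ℝ}
    (hf : chainBoundary (Ycomplex n d ω) d f = 0) (κ : Finset (Fin n)) (hκ : #κ = d) :
    ∑ v ∈ κᶜ, sg κ v * ext0 f (insert v κ) = 0 := by
  have : κ ∈ Ycomplex n d ω := by simp [Ycomplex, hκ]
  rw [← bdry_apply f ⟨κ, this, hκ⟩, hf]; rfl

lemma supp_core {d : ℕ} {ω : FaceIdx n d → Bool} {f : Chains (Ycomplex n d ω) (d+1) ℝ}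
    (hf : chainBoundary (Ycomplex n d ω) d f = 0) :
    IsCore ((faces ω).filter fun σ => ext0 f σ ≠ 0) := by
  intro σ hσ v hv
  rw [mem_filter] at hσ
  have hc := (mem_Y.2 hσ.1).2
  have h1 := rel_of_ker hf (σ.erase v) (by rw [card_erase_of_mem hv, hc]; rfl)
  by_contra hcon
  push Not at hcon
  rw [sum_eq_single v] at h1
  · rw [insert_erase hv] at h1
    exact (mul_ne_zero (sg_ne _ _) hσ.2) h1
  · intro w hw hne
    by_contra h0
    have h2 := right_ne_zero_of_mul h0
    refine hcon (insert w (σ.erase v)) (Finset.mem_filter.2 ⟨ext0_ne h2, h2⟩) ?_ (subset_insert _ _)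
    intro h
    have hw' : w ∈ σ := by rw [← h]; simp
    rw [mem_compl, mem_erase] at hw; tauto
  · intro h; simp at h

lemma supp_cyc {d : ℕ} {ω : FaceIdx n d → Bool} {f : Chains (Ycomplex n d ω) (d+1) ℝ}
    (hf : chainBoundary (Ycomplex n d ω) d f = 0) :
    ((faces ω).filter fun σ => ext0 f σ ≠ 0) ⊆ cyc (faces ω) := by
  have hsum : ∑ σ ∈ faces ω, ext0 f σ • bd σ = 0 := by
    have hU : ∑ σ ∈ faces ω, ext0 f σ • bd σ = ∑ σ : Finset (Fin n), ext0 f σ • bd σ := by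
      refine sum_subset (subset_univ _) fun σ _ h => ?_
      have : ext0 f σ = 0 := by by_contra h'; exact h (ext0_ne h')
      rw [this, zero_smul]
    rw [hU]
    ext κ
    rw [WithLp.ofLp_sum, Finset.sum_apply]
    simp only [PiLp.smul_apply, PiLp.zero_apply, smul_eq_mul]
    by_cases hκ : #κ = d
    · rw [← rel_of_ker hf κ hκ]
      symm
      have hinj : Set.InjOn (fun v => insert v κ) (κᶜ : Finset (Fin n)) := by
        intro v hv w hw h
        simp only [coe_compl, Set.mem_compl_iff, SetLike.mem_coe] at hv hw
        have : v ∈ insert w κ := by simp only at h; rw [← h]; simp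
        rw [mem_insert] at this; tauto
      rw [← sum_subset (subset_univ ((κᶜ).image fun v => insert v κ)), sum_image hinj]
      · refine sum_congr rfl fun v hv => ?_
        rw [mem_compl] at hv
        have := bd_apply_erase (mem_insert_self v κ)
        rw [erase_insert hv] at this
        rw [this, sg_insert_self, mul_comm]
      · intro σ _ h
        rw [bd_apply_ne, mul_zero]
        rintro ⟨v, hv, rfl⟩
        refine h (Finset.mem_image.2 ⟨v, by simp, insert_erase hv⟩)
    · refine sum_eq_zero fun σ _ => ?_
      by_cases h : ext0 f σ = 0
      · rw [h, zero_mul]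
      · rw [bd_apply_ne, mul_zero]
        rintro ⟨v, hv, rfl⟩
        rw [card_erase_of_mem hv, (mem_Y.2 (ext0_ne h)).2] at hκ; exact hκ rfl
  intro σ hσ
  rw [mem_filter] at hσ
  simp only [cyc, mem_filter]
  refine ⟨hσ.1, ?_⟩
  rw [← add_sum_erase _ _ hσ.1] at hsum
  have h3 : bd σ = -(ext0 f σ)⁻¹ • ∑ τ ∈ (faces ω).erase σ, ext0 f τ • bd τ := by
    rw [neg_smul, ← smul_neg, ← eq_neg_of_add_eq_zero_left hsum, smul_smul, inv_mul_cancel₀ hσ.2, one_smul]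
  rw [h3]
  refine Submodule.smul_mem _ _ (Submodule.sum_mem _ fun τ hτ => Submodule.smul_mem _ _ ?_)
  exact Submodule.subset_span ⟨τ, hτ, rfl⟩

lemma sbc_ext {d : ℕ} {ω : FaceIdx n d → Bool} {τ : Finset (Fin n)} (hτ : #τ = d + 2)
    (h : powersetCard (d+1) τ ⊆ faces ω) (σ : Finset (Fin n)) :
    ext0 (simplexBoundaryChain (Ycomplex n d ω) (d + 1) τ) σ = bd τ σ := by
  rw [bd_apply, ext0]
  split_ifs with h'
  · simp only [simplexBoundaryChain, sg]
  · symm; refine sum_eq_zero fun v hv => ?_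
    rw [if_neg]; rintro rfl
    exact h' (mem_Y.2 (h (Finset.mem_powersetCard.2 ⟨erase_subset _ _, by
      rw [card_erase_of_mem hv, hτ]; rfl⟩)))

lemma sbc_ker {d : ℕ} {ω : FaceIdx n d → Bool} {τ : Finset (Fin n)} (hτ : #τ = d + 2)
    (h : powersetCard (d+1) τ ⊆ faces ω) :
    chainBoundary (Ycomplex n d ω) d (simplexBoundaryChain (Ycomplex n d ω) (d + 1) τ) = 0 := by
  funext ⟨κ, hκK, hκ⟩
  rw [bdry_apply]
  simp only [sbc_ext hτ h, Pi.zero_apply]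
  by_cases hs : κ ⊆ τ
  · have hc : #(τ \ κ) = 2 := by rw [card_sdiff_of_subset hs]; omega
    obtain ⟨x, y, hxy, hxyτ⟩ := Finset.card_eq_two.1 hc
    have hx : x ∈ τ ∧ x ∉ κ := by rw [← Finset.mem_sdiff, hxyτ]; simp
    have hy : y ∈ τ ∧ y ∉ κ := by rw [← Finset.mem_sdiff, hxyτ]; simp
    have hτe : τ = insert x (insert y κ) := by
      rw [← sdiff_union_of_subset hs, hxyτ]; ext; simp
    have hyx : y ∉ insert x κ := by simp [hy.2, Ne.symm hxy]
    have hxy' : x ∉ insert y κ := by simp [hx.2, hxy]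
    have e1 : insert x κ = τ.erase y := by rw [hτe, insert_comm, erase_insert hyx]
    have e2 : insert y κ = τ.erase x := by rw [hτe, erase_insert hxy']
    rw [← sum_subset (s₁ := {x, y}), sum_pair hxy, e1, e2, bd_apply_erase hx.1, bd_apply_erase hy.1]
    · have f1 : sg τ y = sg (insert x κ) y := by rw [hτe, insert_comm, sg_insert_self]
      have f2 : sg τ x = sg (insert y κ) x := by rw [hτe, sg_insert_self]
      rw [f1, f2]
      unfold sg
      rw [filter_insert, filter_insert]
      rcases lt_or_gt_of_ne hxy with hl | hl
      · rw [if_pos hl, if_neg (not_lt.2 hl.le), card_insert_of_notMem (by simp [hx.2])]; ring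
      · rw [if_pos hl, if_neg (not_lt.2 hl.le), card_insert_of_notMem (by simp [hy.2])]; ring
    · intro v; simp only [mem_insert, mem_singleton, mem_compl]; rintro (rfl | rfl); exacts [hx.2, hy.2]
    · intro v hv hv2
      rw [bd_apply_ne, mul_zero]
      rintro ⟨w, hw, h3⟩
      have : v ∈ τ \ κ := Finset.mem_sdiff.2 ⟨erase_subset w τ (h3 ▸ mem_insert_self _ _), Finset.mem_compl.1 hv⟩
      rw [hxyτ] at this; exact hv2 this
  · refine sum_eq_zero fun v _ => ?_
    rw [bd_apply_ne, mul_zero]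
    rintro ⟨w, hw, h3⟩
    exact hs ((subset_insert v κ).trans (h3 ▸ erase_subset w τ))

def spanProp {d : ℕ} (ω : FaceIdx n d → Bool) : Prop :=
  ∀ f : Chains (Ycomplex n d ω) (d + 1) ℝ,
          chainBoundary (Ycomplex n d ω) d f = 0 →
          f ∈ Submodule.span ℝ
            {g : Chains (Ycomplex n d ω) (d + 1) ℝ | ∃ τ : Finset (Fin n),
              τ.card = d + 2 ∧ (∀ σ ⊆ τ, σ.card = d + 1 → σ ∈ Ycomplex n d ω) ∧
              g = simplexBoundaryChain (Ycomplex n d ω) (d + 1) τ}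

lemma all_faces_iff {d : ℕ} {ω : FaceIdx n d → Bool} {τ : Finset (Fin n)} :
    (∀ σ ⊆ τ, σ.card = d + 1 → σ ∈ Ycomplex n d ω) ↔ powersetCard (d+1) τ ⊆ faces ω := by
  constructor
  · intro h σ hσ
    rw [mem_powersetCard] at hσ; exact mem_Y.1 ⟨h σ hσ.1 hσ.2, hσ.2⟩
  · intro h σ h1 h2; exact (mem_Y.2 (h (Finset.mem_powersetCard.2 ⟨h1, h2⟩))).1

def goodS (d : ℕ) (S : Finset (Finset (Fin n))) : Prop :=
  ∀ C ⊆ cyc S, C.Nonempty → IsCore C → hasSimp d C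

lemma span_of_good {d : ℕ} {ω : FaceIdx n d → Bool} (hg : goodS d (faces ω)) : spanProp ω := by
  intro f hf
  induction hm : #((faces ω).filter fun σ => ext0 f σ ≠ 0) using Nat.strong_induction_on generalizing f with
  | _ m ih =>
  by_cases hne : ((faces ω).filter fun σ => ext0 f σ ≠ 0).Nonempty
  · obtain ⟨τ, hτ, hsub⟩ := hg _ (supp_cyc hf) hne (supp_core hf)
    have hsub' : powersetCard (d+1) τ ⊆ faces ω := hsub.trans (filter_subset _ _)
    set g := simplexBoundaryChain (Ycomplex n d ω) (d + 1) τ with hgdef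
    have hgk := sbc_ker hτ hsub'
    obtain ⟨v, hv⟩ : τ.Nonempty := Finset.card_pos.1 (by omega)
    have hσ0 : τ.erase v ∈ powersetCard (d+1) τ := Finset.mem_powersetCard.2
      ⟨erase_subset _ _, by rw [card_erase_of_mem hv, hτ]; rfl⟩
    have hg0 : ext0 g (τ.erase v) = sg τ v := by rw [sbc_ext hτ hsub', bd_apply_erase hv]
    set a := ext0 f (τ.erase v) / sg τ v with ha
    have hgm : g ∈ {g : Chains (Ycomplex n d ω) (d + 1) ℝ | ∃ τ : Finset (Fin n),
              τ.card = d + 2 ∧ (∀ σ ⊆ τ, σ.card = d + 1 → σ ∈ Ycomplex n d ω) ∧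
              g = simplexBoundaryChain (Ycomplex n d ω) (d + 1) τ} := ⟨τ, hτ, all_faces_iff.2 hsub', rfl⟩
    have hext : ∀ σ, ext0 (f - a • g) σ = ext0 f σ - a * ext0 g σ := by
      intro σ; unfold ext0; split_ifs <;> simp
    have hk : chainBoundary (Ycomplex n d ω) d (f - a • g) = 0 := by
      have h1 := (chainBoundaryLin (Ycomplex n d ω) d).map_sub f (a • g)
      rw [(chainBoundaryLin (Ycomplex n d ω) d).map_smul] at h1
      change chainBoundary _ _ _ = chainBoundary _ _ _ - a • chainBoundary _ _ _ at h1
      rw [h1, hf, hgk]; simp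
    have hlt : #((faces ω).filter fun σ => ext0 (f - a • g) σ ≠ 0) < m := by
      rw [← hm]
      refine card_lt_card ?_
      rw [ssubset_iff_of_subset]
      · refine ⟨τ.erase v, hsub hσ0, ?_⟩
        rw [mem_filter, hext, hg0, ha, div_mul_cancel₀ _ (sg_ne _ _)]; simp
      · intro σ hσ
        rw [mem_filter] at hσ ⊢
        refine ⟨hσ.1, fun h0 => hσ.2 ?_⟩
        rw [hext, h0, sbc_ext hτ hsub', bd_apply_ne, mul_zero, sub_zero]
        rintro ⟨w, hw, rfl⟩
        exact (Finset.mem_filter.1 (hsub (Finset.mem_powersetCard.2 ⟨erase_subset w τ, by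
          rw [card_erase_of_mem hw, hτ]; rfl⟩))).2 h0
    have h2 := ih _ hlt (f - a • g) hk rfl
    have h3 := Submodule.add_mem _ h2 (Submodule.smul_mem _ a (Submodule.subset_span hgm))
    rwa [sub_add_cancel] at h3
  · have : f = 0 := by
      funext ⟨σ, hσ⟩
      by_contra h
      refine hne ⟨σ, Finset.mem_filter.2 ⟨mem_Y.1 hσ, ?_⟩⟩
      rw [ext0, dif_pos hσ]; exact h
    rw [this]; exact Submodule.zero_mem _

lemma thz_of {d : ℕ} {ω : FaceIdx n d → Bool} (h : spanProp ω) (h' : ¬ hasSimp d (faces ω)) :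
    TopHomologyZero (Ycomplex n d ω) d ℝ := by
  intro f hf
  have := h f hf
  rw [show {g : Chains (Ycomplex n d ω) (d + 1) ℝ | ∃ τ : Finset (Fin n),
              τ.card = d + 2 ∧ (∀ σ ⊆ τ, σ.card = d + 1 → σ ∈ Ycomplex n d ω) ∧
              g = simplexBoundaryChain (Ycomplex n d ω) (d + 1) τ} = ∅ from ?_, Submodule.span_empty] at this
  · exact this
  · rw [Set.eq_empty_iff_forall_notMem]
    rintro g ⟨τ, h1, h2, _⟩
    exact h' ⟨τ, h1, all_faces_iff.1 h2⟩

lemma not_thz {d : ℕ} {ω : FaceIdx n d → Bool} (h' : hasSimp d (faces ω)) :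
    ¬ TopHomologyZero (Ycomplex n d ω) d ℝ := by
  obtain ⟨τ, hτ, hs⟩ := h'
  intro h
  have h1 := h _ (sbc_ker hτ hs)
  obtain ⟨v, hv⟩ : τ.Nonempty := Finset.card_pos.1 (by omega)
  have h2 := sbc_ext hτ hs (τ.erase v)
  rw [bd_apply_erase hv, h1] at h2
  refine sg_ne τ v (h2.symm.trans ?_)
  unfold ext0; split_ifs <;> rfl

end LP
end

noncomputable section
namespace LP
variable {n : ℕ}

def beta (S : Finset (Finset (Fin n))) : ℝ := #S - Module.finrank ℝ (Bs S)

lemma Bs_mono {S S' : Finset (Finset (Fin n))} (h : S ⊆ S') : Bs S ≤ Bs S' :=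
  Submodule.span_mono (Set.image_mono (by exact_mod_cast h))

lemma finrank_Bs_le (S : Finset (Finset (Fin n))) : Module.finrank ℝ (Bs S) ≤ #S := by
  classical
  have := finrank_span_finset_le_card (R := ℝ) (S.image (bd (n := n)))
  rw [coe_image] at this
  exact this.trans card_image_le

lemma beta_nonneg (S : Finset (Finset (Fin n))) : 0 ≤ beta S := by
  have := finrank_Bs_le S
  unfold beta; rw [sub_nonneg]; exact_mod_cast this

open Classical in
lemma beta_union (S R : Finset (Finset (Fin n))) :
    (#((R \ S).filter fun σ => bd σ ∈ Bs S) : ℝ) ≤ beta (S ∪ R) := by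
  set D := (R \ S).filter fun σ => bd σ ∈ Bs S with hD
  have hDs : D ⊆ S ∪ R := fun σ hσ => mem_union_right _ (Finset.mem_sdiff.1 (Finset.mem_filter.1 hσ).1).1
  have hS : S ⊆ (S ∪ R) \ D := by
    intro σ hσ
    refine Finset.mem_sdiff.2 ⟨mem_union_left _ hσ, fun h => ?_⟩
    exact (Finset.mem_sdiff.1 (Finset.mem_filter.1 h).1).2 hσ
  have hle : Bs (S ∪ R) ≤ Bs ((S ∪ R) \ D) := by
    refine Submodule.span_le.2 ?_
    rintro _ ⟨σ, hσ, rfl⟩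
    by_cases h : σ ∈ D
    · exact Bs_mono hS (Finset.mem_filter.1 h).2
    · exact Submodule.subset_span ⟨σ, by exact_mod_cast Finset.mem_sdiff.2 ⟨hσ, h⟩, rfl⟩
  have h1 := (Submodule.finrank_mono hle).trans (finrank_Bs_le _)
  rw [card_sdiff_of_subset hDs] at h1
  have h2 := card_le_card hDs
  have h3 : Module.finrank ℝ (Bs (S ∪ R)) + #D ≤ #(S ∪ R) := by omega
  have h4 : (Module.finrank ℝ (Bs (S ∪ R)) : ℝ) + #D ≤ #(S ∪ R) := by exact_mod_cast h3
  unfold beta; linarith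

lemma cyc_bound {U : Finset (Finset (Fin n))} {p q : ℝ} (hp : 0 ≤ p) (hpq : p < q) (hq : q ≤ 1) :
    (q - p) * Ex U p (fun S => (#(cyc S) : ℝ)) ≤ p * Ex U q beta := by
  classical
  have hp1 : 0 < 1 - p := by linarith
  set r := (q - p) / (1 - p) with hr
  have hr0 : 0 ≤ r := div_nonneg (by linarith) hp1.le
  have hr1 : r ≤ 1 := by rw [hr, div_le_one hp1]; linarith
  have hrm : r * (1 - p) = q - p := div_mul_cancel₀ _ hp1.ne'
  have hpr : p + r - p * r = q := by linarith
  set A : Finset (Fin n) → ℝ := fun σ => Ex (U.erase σ) p (fun S => if bd σ ∈ Bs S then (1:ℝ) else 0) with hA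
  have h1 : Ex U p (fun S => (#(cyc S) : ℝ)) = p * ∑ σ ∈ U, A σ := by
    have : ∀ S ⊆ U, (#(cyc S) : ℝ) = ∑ σ ∈ U, if σ ∈ S ∧ bd σ ∈ Bs (S.erase σ) then (1:ℝ) else 0 := by
      intro S hS
      rw [sum_boole]; congr 2; ext σ
      simp only [cyc, mem_filter]; exact ⟨fun h => ⟨hS h.1, h⟩, fun h => h.2⟩
    rw [Ex_congr p this, Ex_sum, mul_sum]
    refine sum_congr rfl fun σ hσ => ?_
    conv_lhs => rw [← insert_erase hσ, Ex_insert (notMem_erase σ U)]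
    rw [Ex_congr (U := U.erase σ) (h := fun _ => 0), Ex_const, mul_zero, zero_add, hA]
    · congr 1
      refine Ex_congr p fun S hS => ?_
      rw [erase_insert (fun h => notMem_erase σ U (hS h))]; simp
    · intro S hS; rw [if_neg]; rintro ⟨h, _⟩; exact notMem_erase σ U (hS h)
  have h2 : (r * (1 - p)) * ∑ σ ∈ U, A σ ≤ Ex U q beta := by
    rw [← hpr, ← Ex_sprinkle]
    have : (r * (1 - p)) * ∑ σ ∈ U, A σ =
        Ex U p (fun S => Ex U r (fun R => (#((R \ S).filter fun σ => bd σ ∈ Bs S) : ℝ))) := by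
      have e1 : ∀ S, Ex U r (fun R => (#((R \ S).filter fun σ => bd σ ∈ Bs S) : ℝ)) =
          ∑ σ ∈ U, r * (if σ ∉ S ∧ bd σ ∈ Bs S then (1:ℝ) else 0) := by
        intro S
        have : ∀ R ⊆ U, (#((R \ S).filter fun σ => bd σ ∈ Bs S) : ℝ) =
            ∑ σ ∈ U, (if σ ∉ S ∧ bd σ ∈ Bs S then (1:ℝ) else 0) * (if {σ} ⊆ R then (1:ℝ) else 0) := by
          intro R hR
          simp only [singleton_subset_iff, mul_ite, mul_one, mul_zero, ← ite_and]
          rw [sum_boole]; congr 2; ext σ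
          simp only [mem_filter, Finset.mem_sdiff]
          exact ⟨fun h => ⟨hR h.1.1, h.1.1, h.1.2, h.2⟩, fun h => ⟨⟨h.2.1, h.2.2.1⟩, h.2.2.2⟩⟩
        rw [Ex_congr r this, Ex_sum]
        refine sum_congr rfl fun σ hσ => ?_
        rw [Ex_mul, Ex_superset (Finset.singleton_subset_iff.2 hσ)]; simp [mul_comm]
      simp only [e1]
      rw [Ex_sum, mul_sum]
      refine sum_congr rfl fun σ hσ => ?_
      rw [Ex_mul]
      conv_rhs => rw [← insert_erase hσ, Ex_insert (notMem_erase σ U)]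
      simp only [mem_insert_self, not_true_eq_false, false_and, if_false, Ex_const]
      rw [mul_zero, add_zero, mul_assoc, hA]; congr 2
      refine Ex_congr p fun S hS => ?_
      have : σ ∉ S := fun h => notMem_erase σ U (hS h)
      simp [this]
    rw [this]
    exact Ex_mono hp (by linarith) fun S _ => Ex_mono hr0 hr1 fun R _ => beta_union S R
  rw [h1, ← hrm]
  nlinarith [mul_le_mul_of_nonneg_left h2 hp]

end LP
end

noncomputable section
namespace LP
variable {n : ℕ}

def PP (S : Finset (Finset (Fin n))) : EE n →L[ℝ] EE n := (Bs S)ᗮ.starProjection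

def QQ (S : Finset (Finset (Fin n))) (κ κ' : Finset (Fin n)) : ℝ := inner ℝ (ee κ) (PP S (ee κ'))

lemma PP_inner (S : Finset (Finset (Fin n))) (x y : EE n) : inner ℝ (PP S x) (PP S y) = inner ℝ x (PP S y) := by
  unfold PP
  rw [Submodule.inner_starProjection_left_eq_right, Submodule.starProjection_eq_self_iff.2 (Submodule.starProjection_apply_mem _ _)]

lemma QQ_self (S : Finset (Finset (Fin n))) (κ) : QQ S κ κ = ‖PP S (ee κ)‖ ^ 2 := by
  rw [QQ, ← PP_inner, real_inner_self_eq_norm_sq]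

lemma QQ_nonneg (S : Finset (Finset (Fin n))) (κ) : 0 ≤ QQ S κ κ := by rw [QQ_self]; positivity

lemma PP_Bs {S : Finset (Finset (Fin n))} {b : EE n} (hb : b ∈ Bs S) : PP S b = 0 := by
  unfold PP
  rw [Submodule.starProjection_apply_eq_zero_iff]
  exact (Bs S).le_orthogonal_orthogonal hb

lemma PP_norm_le (S : Finset (Finset (Fin n))) (x : EE n) : ‖PP S x‖ ≤ ‖x‖ :=
  Submodule.norm_starProjection_apply_le _ _

lemma ee_norm (κ : Finset (Fin n)) : ‖(ee κ : EE n)‖ = 1 := by simp [ee]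

lemma QQ_le_one (S : Finset (Finset (Fin n))) (κ) : QQ S κ κ ≤ 1 := by
  rw [QQ_self]; have := PP_norm_le S (ee κ); rw [ee_norm] at this
  exact pow_le_one₀ (norm_nonneg _) this

lemma QQ_le {S S' : Finset (Finset (Fin n))} (h : S ⊆ S') {κ} {b : EE n} (hb : b ∈ Bs S') :
    QQ S' κ κ ≤ ‖PP S (ee κ - b)‖ ^ 2 := by
  have h1 : PP S' (PP S (ee κ - b)) = PP S' (ee κ) := by
    have h2 : ee κ - b - PP S (ee κ - b) ∈ Bs S' := by
      refine Bs_mono h ?_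
      rw [PP, Submodule.starProjection_orthogonal]
      simpa using Submodule.starProjection_apply_mem (Bs S) (ee κ - b)
    have h3 := PP_Bs h2
    rw [map_sub, map_sub, PP_Bs hb, sub_zero, sub_eq_zero] at h3
    exact h3.symm
  rw [QQ_self, ← h1]
  exact pow_le_pow_left₀ (norm_nonneg _) (PP_norm_le _ _) 2

lemma QQ_mono {S S' : Finset (Finset (Fin n))} (h : S ⊆ S') (κ) : QQ S' κ κ ≤ QQ S κ κ := by
  have := QQ_le h (κ := κ) (b := 0) (Submodule.zero_mem _)
  rwa [sub_zero, ← QQ_self] at this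

lemma inner_ee (κ : Finset (Fin n)) (x : EE n) : inner ℝ (ee κ) x = x κ := by
  simp [ee, EuclideanSpace.inner_single_left]

lemma QQ_sum_sq (S : Finset (Finset (Fin n))) (κ : Finset (Fin n)) : ∑ κ', QQ S κ' κ ^ 2 ≤ 1 := by
  have h := PP_norm_le S (ee κ)
  rw [ee_norm] at h
  have h2 := pow_le_one₀ (n := 2) (norm_nonneg _) h
  rw [EuclideanSpace.norm_sq_eq] at h2
  simpa [QQ, inner_ee] using h2

lemma trace_Bs {d : ℕ} {S : Finset (Finset (Fin n))} (hS : S ⊆ UU n d) :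
    (Module.finrank ℝ (Bs S) : ℝ) = n.choose d - ∑ κ ∈ powersetCard d (univ : Finset (Fin n)), QQ S κ κ := by
  have h1 : LinearMap.trace ℝ (EE n) ((Bs S).starProjection : EE n →ₗ[ℝ] EE n) = Module.finrank ℝ (Bs S) := by
    refine LinearMap.IsProj.trace (p := Bs S) ⟨fun x => Submodule.starProjection_apply_mem _ _, fun x hx => ?_⟩
    exact Submodule.starProjection_eq_self_iff.2 hx
  rw [← h1, LinearMap.trace_eq_sum_inner _ (EuclideanSpace.basisFun (Finset (Fin n)) ℝ)]
  have h2 : ∀ κ : Finset (Fin n), inner ℝ ((EuclideanSpace.basisFun (Finset (Fin n)) ℝ) κ)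
      (((Bs S).starProjection : EE n →ₗ[ℝ] EE n) ((EuclideanSpace.basisFun (Finset (Fin n)) ℝ) κ)) =
      1 - QQ S κ κ := by
    intro κ
    have e : (EuclideanSpace.basisFun (Finset (Fin n)) ℝ) κ = ee κ := by simp [ee]
    rw [e, QQ, PP, Submodule.starProjection_orthogonal]
    have : inner ℝ (ee κ : EE n) (ee κ) = 1 := by rw [real_inner_self_eq_norm_sq, ee_norm]; norm_num
    simp [inner_sub_right, ee_norm]
  rw [sum_congr rfl fun κ _ => h2 κ, ← sum_subset (subset_univ (powersetCard d (univ : Finset (Fin n))))]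
  · rw [sum_sub_distrib]; simp
  · intro κ _ hκ
    rw [sub_eq_zero, QQ_self]
    have : PP S (ee κ) = ee κ := by
      unfold PP
      rw [Submodule.starProjection_eq_self_iff, Submodule.mem_orthogonal']
      intro u hu
      induction hu using Submodule.span_induction with
      | mem x hx =>
        obtain ⟨σ, hσ, rfl⟩ := hx
        rw [inner_ee, bd_apply_ne]
        rintro ⟨v, hv, rfl⟩
        have := (Finset.mem_powersetCard.1 (hS hσ)).2
        exact hκ (Finset.mem_powersetCard.2 ⟨subset_univ _, by rw [card_erase_of_mem hv, this]; rfl⟩)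
      | zero => simp
      | add x y _ _ hx hy => rw [inner_add_right, hx, hy, add_zero]
      | smul a x _ hx => rw [inner_smul_right, hx, mul_zero]
    rw [this, ee_norm]; norm_num

section sym
variable (π : Equiv.Perm (Fin n))

def inv2 (A : Finset (Fin n)) : ℕ := #((A ×ˢ A).filter fun ab => ab.1 < ab.2 ∧ π ab.2 < π ab.1)

def fmap : Equiv.Perm (Finset (Fin n)) := Equiv.finsetCongr π

lemma fmap_apply (A : Finset (Fin n)) : fmap π A = A.map π.toEmbedding := rfl

def sW : EE n ≃ₗᵢ[ℝ] EE n :=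
  (LinearIsometryEquiv.piLpCongrRight 2 (fun κ : Finset (Fin n) =>
    if Even (inv2 π κ) then LinearIsometryEquiv.refl ℝ ℝ else LinearIsometryEquiv.neg ℝ)).trans
  (LinearIsometryEquiv.piLpCongrLeft 2 ℝ ℝ (fmap π))

lemma sW_ee (κ : Finset (Fin n)) : sW π (ee κ) = (-1 : ℝ) ^ inv2 π κ • ee (fmap π κ) := by
  have h : (LinearIsometryEquiv.piLpCongrRight 2 (fun κ : Finset (Fin n) =>
    if Even (inv2 π κ) then LinearIsometryEquiv.refl ℝ ℝ else LinearIsometryEquiv.neg ℝ)) (ee κ) =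
      EuclideanSpace.single κ ((-1 : ℝ) ^ inv2 π κ) := by
    ext κ'
    simp only [LinearIsometryEquiv.piLpCongrRight_apply, ee, EuclideanSpace.single_apply]
    by_cases hk : κ' = κ
    · subst hk
      by_cases he : Even (inv2 π κ')
      · simp [he, he.neg_one_pow]
      · simp [he, (Nat.not_even_iff_odd.1 he).neg_one_pow]
    · split_ifs <;> simp [hk]
  rw [sW, LinearIsometryEquiv.trans_apply, h, EuclideanSpace.piLpCongrLeft_single]
  ext κ'; simp [ee, EuclideanSpace.single_apply]

lemma inv2_erase {σ : Finset (Fin n)} {v : Fin n} (hv : v ∈ σ) :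
    inv2 π σ = inv2 π (σ.erase v) + (#(σ.filter fun a => a < v ∧ π v < π a) + #(σ.filter fun b => v < b ∧ π b < π v)) := by
  unfold inv2
  rw [← card_map (⟨fun a => (a, v), fun _ _ h => (Prod.mk.inj h).1⟩ : Fin n ↪ Fin n × Fin n) (s := σ.filter fun a => a < v ∧ π v < π a),
    ← card_map (⟨fun a => (v, a), fun _ _ h => (Prod.mk.inj h).2⟩ : Fin n ↪ Fin n × Fin n) (s := σ.filter fun b => v < b ∧ π b < π v),
    ← card_union_of_disjoint, ← card_union_of_disjoint]
  · congr 1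
    ext ⟨a, b⟩
    simp only [mem_filter, mem_product, mem_union, mem_erase, Finset.mem_map,
      Function.Embedding.coeFn_mk, Prod.mk.injEq]
    constructor
    · rintro ⟨⟨ha, hb⟩, h1, h2⟩
      by_cases h3 : a = v
      · subst h3; right; right; exact ⟨b, ⟨hb, h1, h2⟩, rfl⟩
      · by_cases h4 : b = v
        · subst h4; right; left; exact ⟨a, ⟨ha, h1, h2⟩, rfl⟩
        · left; exact ⟨⟨⟨h3, ha⟩, h4, hb⟩, h1, h2⟩
    · rintro (⟨⟨⟨_, ha⟩, _, hb⟩, h1, h2⟩ | ⟨x, ⟨hx, h1, h2⟩, rfl, rfl⟩ | ⟨x, ⟨hx, h1, h2⟩, rfl, rfl⟩)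
      · exact ⟨⟨ha, hb⟩, h1, h2⟩
      · exact ⟨⟨hx, hv⟩, h1, h2⟩
      · exact ⟨⟨hv, hx⟩, h1, h2⟩
  · rw [disjoint_left]; rintro ⟨a, b⟩
    simp only [mem_filter, mem_product, mem_union, mem_erase, Finset.mem_map,
      Function.Embedding.coeFn_mk, Prod.mk.injEq]
    rintro ⟨⟨⟨h1, _⟩, h2, _⟩, _⟩ (⟨x, _, _, rfl⟩ | ⟨x, _, rfl, _⟩)
    · exact h2 rfl
    · exact h1 rfl
  · rw [disjoint_left]; rintro ⟨a, b⟩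
    simp only [mem_filter, Finset.mem_map, Function.Embedding.coeFn_mk, Prod.mk.injEq]
    rintro ⟨x, ⟨_, h1, _⟩, rfl, rfl⟩ ⟨y, ⟨_, h2, _⟩, rfl, rfl⟩
    exact lt_irrefl _ h1

lemma sg_fmap {σ : Finset (Fin n)} {v : Fin n} (hv : v ∈ σ) :
    sg σ v * (-1) ^ inv2 π (σ.erase v) = (-1) ^ inv2 π σ * sg (fmap π σ) (π v) := by
  have h1 : #(σ.filter (· < v)) = #(σ.filter fun a => a < v ∧ π a < π v) + #(σ.filter fun a => a < v ∧ π v < π a) := by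
    rw [← card_union_of_disjoint, ← filter_or]
    · congr 1; refine filter_congr fun a _ => ?_
      constructor
      · intro h; rcases lt_or_gt_of_ne (fun e => h.ne (π.injective e) : π a ≠ π v) with h2 | h2 <;> tauto
      · tauto
    · rw [disjoint_filter]; rintro a _ ⟨_, h2⟩ ⟨_, h3⟩; exact lt_asymm h2 h3
  have h2 : #((fmap π σ).filter (· < π v)) = #(σ.filter fun a => a < v ∧ π a < π v) + #(σ.filter fun b => v < b ∧ π b < π v) := by
    rw [fmap_apply, filter_map, card_map, ← card_union_of_disjoint, ← filter_or]
    · congr 1; refine filter_congr fun a _ => ?_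
      simp only [Function.comp, Equiv.coe_toEmbedding]
      constructor
      · intro h; rcases lt_or_gt_of_ne (fun e => h.ne (congrArg π e) : a ≠ v) with h2 | h2 <;> tauto
      · tauto
    · rw [disjoint_filter]; rintro a _ ⟨h2, _⟩ ⟨h3, _⟩; exact lt_asymm h2 h3
  unfold sg
  rw [h1, h2, inv2_erase π hv]
  simp only [pow_add]
  have hsq : ∀ k : ℕ, ((-1:ℝ) ^ k) * (-1) ^ k = 1 := fun k => by rw [← mul_pow]; norm_num
  have := hsq (#(σ.filter fun b => v < b ∧ π b < π v))
  calc _ = (-1:ℝ) ^ #(σ.filter fun a => a < v ∧ π a < π v) * (-1) ^ #(σ.filter fun a => a < v ∧ π v < π a) *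
        (-1) ^ inv2 π (σ.erase v) * ((-1) ^ #(σ.filter fun b => v < b ∧ π b < π v) * (-1) ^ #(σ.filter fun b => v < b ∧ π b < π v)) := by rw [this, mul_one]
    _ = _ := by ring

lemma sW_bd (σ : Finset (Fin n)) : sW π (bd σ) = (-1 : ℝ) ^ inv2 π σ • bd (fmap π σ) := by
  unfold bd
  rw [map_sum, smul_sum]
  conv_rhs => rw [fmap_apply, sum_map]
  refine sum_congr rfl fun v hv => ?_
  rw [map_smul, sW_ee, smul_smul, smul_smul, sg_fmap π hv]
  congr 2
  simp only [fmap_apply, Equiv.coe_toEmbedding]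
  rw [map_erase]; rfl

lemma Bs_fmap (S : Finset (Finset (Fin n))) :
    Bs (S.map (fmap π).toEmbedding) = (Bs S).map (sW π).toLinearEquiv.toLinearMap := by
  have hs : ∀ k : ℕ, ((-1:ℝ) ^ k) * (-1) ^ k = 1 := fun k => by rw [← mul_pow]; norm_num
  rw [Bs, Bs, Submodule.map_span]
  refine le_antisymm (Submodule.span_le.2 ?_) (Submodule.span_le.2 ?_)
  · rintro _ ⟨_, hσ, rfl⟩
    obtain ⟨σ, hσ', rfl⟩ := Finset.mem_map.1 hσ
    have e : bd ((fmap π) σ) = (-1 : ℝ) ^ inv2 π σ • sW π (bd σ) := by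
      rw [sW_bd, smul_smul, hs, one_smul]
    rw [Equiv.coe_toEmbedding, e]
    exact Submodule.smul_mem _ _ (Submodule.subset_span ⟨_, ⟨σ, hσ', rfl⟩, rfl⟩)
  · rintro _ ⟨_, ⟨σ, hσ, rfl⟩, rfl⟩
    change sW π (bd σ) ∈ _
    rw [sW_bd]
    exact Submodule.smul_mem _ _ (Submodule.subset_span ⟨_, by
      simp only [mem_coe, mem_map_equiv, Equiv.symm_apply_apply]; exact hσ, rfl⟩)

lemma QQ_fmap (S : Finset (Finset (Fin n))) (κ κ' : Finset (Fin n)) :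
    QQ (S.map (fmap π).toEmbedding) (fmap π κ) (fmap π κ') ^ 2 = QQ S κ κ' ^ 2 := by
  have hP : ∀ x, PP (S.map (fmap π).toEmbedding) (sW π x) = sW π (PP S x) := by
    intro x
    unfold PP
    simp only [Submodule.starProjection_orthogonal, ContinuousLinearMap.sub_apply, ContinuousLinearMap.id_apply, map_sub]
    congr 1
    have := Submodule.starProjection_map_apply (sW π) (Bs S) (sW π x)
    rw [LinearIsometryEquiv.symm_apply_apply] at this
    rw [← this]; congr 1
    simp only [Bs_fmap]
  have h := LinearIsometryEquiv.inner_map_map (sW π) (ee κ) (PP S (ee κ'))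
  rw [← hP, sW_ee, sW_ee, map_smul, inner_smul_left, inner_smul_right] at h
  unfold QQ
  rw [← h]
  simp [mul_pow, ← pow_mul, mul_comm _ 2]

end sym

lemma QQ_exp {d : ℕ} {p : ℝ} (h0 : 0 ≤ p) (h1 : p ≤ 1) {κ κ' : Finset (Fin n)} (hκ : #κ = d) (hκ' : #κ' = d)
    (hne : κ' ≠ κ) : ((n:ℝ) - 2 * d) * Ex (UU n d) p (fun S => QQ S κ' κ ^ 2) ≤ 1 := by
  obtain ⟨u, hu, huκ⟩ : ∃ u ∈ κ', u ∉ κ := by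
    by_contra h; push Not at h
    exact hne (eq_of_subset_of_card_le h (by omega))
  set W := (κ ∪ κ')ᶜ with hW
  have hWc : (n:ℝ) - 2 * d ≤ #W := by
    have := card_compl_add_card (κ ∪ κ')
    have h2 := card_union_le κ κ'
    rw [Fintype.card_fin, ← hW] at this
    have : n ≤ #W + 2 * d := by omega
    have : (n:ℝ) ≤ #W + 2 * d := by exact_mod_cast this
    linarith
  have hE0 : 0 ≤ Ex (UU n d) p (fun S => QQ S κ' κ ^ 2) := Ex_nonneg h0 h1 fun _ _ => by positivity
  have key : ∀ w ∈ W, Ex (UU n d) p (fun S => QQ S (fmap (Equiv.swap u w) κ') κ ^ 2) = Ex (UU n d) p (fun S => QQ S κ' κ ^ 2) := by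
    intro w hw
    rw [hW, mem_compl, mem_union, not_or] at hw
    have hfix : fmap (Equiv.swap u w) κ = κ := by
      rw [fmap_apply]; ext a
      rw [mem_map_equiv, Equiv.symm_swap]
      by_cases ha : a = u
      · subst ha; simp [hw.1, huκ]
      · by_cases ha' : a = w
        · subst ha'; simp [hw.1, huκ]
        · rw [Equiv.swap_apply_of_ne_of_ne ha ha']
    rw [← Ex_perm (fmap (Equiv.swap u w)) (fun a => by simp [mem_powersetCard, fmap_apply])]
    refine Ex_congr p fun S _ => ?_
    conv_lhs => rw [← hfix]
    rw [hfix]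
    conv_lhs => rw [← hfix]
    rw [QQ_fmap]
  calc _ ≤ #W * Ex (UU n d) p (fun S => QQ S κ' κ ^ 2) := mul_le_mul_of_nonneg_right hWc hE0
    _ = ∑ w ∈ W, Ex (UU n d) p (fun S => QQ S (fmap (Equiv.swap u w) κ') κ ^ 2) := by
      rw [sum_congr rfl key, sum_const, nsmul_eq_mul]
    _ = Ex (UU n d) p (fun S => ∑ w ∈ W, QQ S (fmap (Equiv.swap u w) κ') κ ^ 2) := by rw [Ex_sum]
    _ ≤ 1 := by
      refine Ex_le h0 h1 fun S _ => ?_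
      have hinj : Set.InjOn (fun w => fmap (Equiv.swap u w) κ') W := by
        intro w hw w' hw' h
        simp only [hW, coe_compl, coe_union, Set.mem_compl_iff, Set.mem_union, SetLike.mem_coe, not_or] at hw hw'
        simp only [fmap_apply] at h
        have : w ∈ κ'.map (Equiv.swap u w').toEmbedding := by
          rw [← h, mem_map_equiv]; simpa using hu
        rw [mem_map_equiv, Equiv.symm_swap] at this
        by_contra hww
        have hwu : w ≠ u := fun e => hw.2 (e ▸ hu)
        rw [Equiv.swap_apply_of_ne_of_ne hwu hww] at this
        exact hw.2 this
      rw [← sum_image (f := fun x => QQ S x κ ^ 2) hinj]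
      exact (sum_le_sum_of_subset_of_nonneg (subset_univ _) fun _ _ _ => by positivity).trans (QQ_sum_sq S κ)

lemma QQ_exp_abs {d : ℕ} {p : ℝ} (h0 : 0 ≤ p) (h1 : p < 1) {κ κ' : Finset (Fin n)} (hκ : #κ = d) (hκ' : #κ' = d)
    (hne : κ' ≠ κ) {V : Finset (Finset (Fin n))} (hV : V ⊆ UU n d) (hn : 2 * d < n) {ε : ℝ} (hε : 0 < ε)  :
    Ex V p (fun S => |QQ S κ' κ|) ≤ ε + ((1 - p) ^ #(UU n d \ V))⁻¹ / ((n - 2 * d) * ε) := by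
  have hpos : (0:ℝ) < n - 2 * d := by rw [sub_pos]; exact_mod_cast hn
  have h2 : 0 < 1 - p := by linarith
  have hE := QQ_exp h0 h1.le hκ hκ' hne
  have hd := Ex_drop hV h0 h1.le (g := fun S => QQ S κ' κ ^ 2) fun _ _ => by positivity
  have hle : Ex V p (fun S => |QQ S κ' κ|) ≤ Ex V p (fun S => ε + ε⁻¹ * QQ S κ' κ ^ 2) := by
    refine Ex_mono h0 h1.le fun S _ => ?_
    rw [← sq_abs]
    rcases le_total (|QQ S κ' κ|) ε with h | h
    · have : 0 ≤ ε⁻¹ * |QQ S κ' κ| ^ 2 := by positivity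
      linarith
    · have : |QQ S κ' κ| ≤ ε⁻¹ * |QQ S κ' κ| ^ 2 := by
        rw [inv_mul_eq_div, le_div_iff₀ hε]; nlinarith [abs_nonneg (QQ S κ' κ)]
      linarith
  rw [Ex_add, Ex_const, Ex_mul] at hle
  refine hle.trans (add_le_add_right ?_ _)
  rw [div_eq_mul_inv, mul_inv]
  have h3 : Ex V p (fun S => QQ S κ' κ ^ 2) ≤ ((1 - p) ^ #(UU n d \ V))⁻¹ * ((n:ℝ) - 2 * d)⁻¹ := by
    rw [← mul_inv, ← one_div, le_div_iff₀ (by positivity)]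
    nlinarith [mul_le_mul_of_nonneg_left hd hpos.le]
  calc _ ≤ ε⁻¹ * (((1 - p) ^ #(UU n d \ V))⁻¹ * ((n:ℝ) - 2 * d)⁻¹) := mul_le_mul_of_nonneg_left h3 (by positivity)
    _ = _ := by ring

end LP
end

noncomputable section
namespace LP

def FF {ι : Type*} [Fintype ι] (s : ι → ℝ) : ℝ := by
  classical exact if ∀ i, 0 < s i then (1 + ∑ i, (s i)⁻¹)⁻¹ else 0

section FF
variable {ι : Type*} [Fintype ι]

lemma FF_nonneg (s : ι → ℝ) : 0 ≤ FF s := by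
  unfold FF; split_ifs with h
  · have : 0 ≤ ∑ i, (s i)⁻¹ := sum_nonneg fun i _ => (inv_pos.2 (h i)).le
    positivity
  · exact le_rfl

lemma FF_le_one (s : ι → ℝ) : FF s ≤ 1 := by
  unfold FF; split_ifs with h
  · have : 0 ≤ ∑ i, (s i)⁻¹ := sum_nonneg fun i _ => (inv_pos.2 (h i)).le
    exact inv_le_one_of_one_le₀ (by linarith)
  · exact zero_le_one

lemma FF_attain (s : ι → ℝ) (hs : ∀ i, 0 ≤ s i) :
    ∃ a : ι → ℝ, (∀ i, 0 ≤ a i) ∧ ∑ i, a i ≤ 1 ∧ (1 - ∑ i, a i) ^ 2 + ∑ i, a i ^ 2 * s i = FF s := by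
  classical
  by_cases h : ∀ i, 0 < s i
  · have hY : 0 ≤ ∑ i, (s i)⁻¹ := sum_nonneg fun i _ => (inv_pos.2 (h i)).le
    have hF : FF s = (1 + ∑ i, (s i)⁻¹)⁻¹ := by simp only [FF, if_pos h]
    have hF0 := FF_nonneg s
    have h1 : FF s * (1 + ∑ i, (s i)⁻¹) = 1 := by rw [hF]; exact inv_mul_cancel₀ (by positivity)
    have h2 : ∑ i, FF s * (s i)⁻¹ = FF s * ∑ i, (s i)⁻¹ := by rw [mul_sum]
    have h3 : ∑ i, (FF s * (s i)⁻¹) ^ 2 * s i = FF s ^ 2 * ∑ i, (s i)⁻¹ := by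
      rw [mul_sum]; refine sum_congr rfl fun i _ => ?_
      have := (h i).ne'
      field_simp
    refine ⟨fun i => FF s * (s i)⁻¹, fun i => mul_nonneg hF0 (inv_pos.2 (h i)).le, ?_, ?_⟩
    · rw [h2]; nlinarith
    · rw [h3, h2]
      have : FF s * ∑ i, (s i)⁻¹ = 1 - FF s := by linarith
      rw [this, pow_two (FF s), mul_assoc, this]; ring
  · have h' := h
    push Not at h
    obtain ⟨i, hi⟩ := h
    have hi0 : s i = 0 := le_antisymm hi (hs i)
    refine ⟨Pi.single i 1, fun j => ?_, ?_, ?_⟩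
    · by_cases hj : j = i
      · subst hj; simp
      · simp [hj]
    · simp
    · have : ∀ j, (Pi.single i (1:ℝ) : ι → ℝ) j ^ 2 * s j = 0 := by
        intro j; by_cases hj : j = i
        · subst hj; simp [hi0]
        · simp [hj]
      simp [this, FF, h']

lemma FF_le (y : ι → ℝ) (hy : ∀ i, 0 ≤ y i) (a : ι → ℝ) :
    FF y ≤ (1 - ∑ i, a i) ^ 2 + ∑ i, a i ^ 2 * y i := by
  classical
  have hX : 0 ≤ ∑ i, a i ^ 2 * y i := sum_nonneg fun i _ => mul_nonneg (sq_nonneg _) (hy i)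
  by_cases h : ∀ i, 0 < y i
  · have hY : 0 ≤ ∑ i, (y i)⁻¹ := sum_nonneg fun i _ => (inv_pos.2 (h i)).le
    simp only [FF, if_pos h]
    have hcs : (∑ i, a i) ^ 2 ≤ (∑ i, a i ^ 2 * y i) * ∑ i, (y i)⁻¹ := by
      refine sum_sq_le_sum_mul_sum_of_sq_le_mul _ (fun i _ => mul_nonneg (sq_nonneg _) (hy i)) (fun i _ => (inv_pos.2 (h i)).le) fun i _ => ?_
      rw [mul_assoc, mul_inv_cancel₀ (h i).ne', mul_one]
    set X := ∑ i, a i ^ 2 * y i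
    set Y := ∑ i, (y i)⁻¹
    set s := ∑ i, a i
    rw [inv_le_iff_one_le_mul₀ (by positivity)]
    have h1 : 2 * ((1 - s) * s) ≤ (1 - s) ^ 2 * Y + X := by
      refine le_of_abs_le (abs_le_of_sq_le_sq' ?_ (by positivity) |> abs_le.2)
      nlinarith [sq_nonneg ((1 - s) ^ 2 * Y - X), mul_le_mul_of_nonneg_left hcs (sq_nonneg (1 - s))]
    nlinarith
  · simp only [FF, if_neg h]; positivity

lemma FF_lip (x y : ι → ℝ) (hx : ∀ i, 0 ≤ x i) (hy : ∀ i, 0 ≤ y i) :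
    FF y ≤ FF x + ∑ i, max (y i - x i) 0 := by
  obtain ⟨a, h0, h1, h2⟩ := FF_attain x hx
  rw [← h2]
  refine (FF_le y hy a).trans ?_
  rw [add_assoc, ← sum_add_distrib]
  refine add_le_add_right (sum_le_sum fun i _ => ?_) _
  have ha : a i ≤ 1 := (single_le_sum (fun j _ => h0 j) (mem_univ i)).trans h1
  have ha2 : a i ^ 2 ≤ 1 := pow_le_one₀ (h0 i) ha
  have : a i ^ 2 * (y i - x i) ≤ max (y i - x i) 0 := by
    calc _ ≤ a i ^ 2 * max (y i - x i) 0 := mul_le_mul_of_nonneg_left (le_max_left _ _) (sq_nonneg _)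
      _ ≤ 1 * max (y i - x i) 0 := mul_le_mul_of_nonneg_right ha2 (le_max_right _ _)
      _ = _ := one_mul _
  linarith
end FF

variable {n : ℕ}

lemma PP_quad {J : Type*} [Fintype J] [DecidableEq J] (S : Finset (Finset (Fin n))) (κ : J → Finset (Fin n)) (c : J → ℝ)
    (hc : ∀ j, |c j| ≤ 1) : ‖PP S (∑ j, c j • ee (κ j))‖ ^ 2 ≤
      ∑ j, c j ^ 2 * QQ S (κ j) (κ j) + ∑ j, ∑ j' ∈ univ.erase j, |QQ S (κ j) (κ j')| := by
  rw [← real_inner_self_eq_norm_sq, PP_inner, map_sum, sum_inner, ← sum_add_distrib]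
  refine sum_le_sum fun j _ => ?_
  rw [inner_sum, ← add_sum_erase _ _ (mem_univ j)]
  refine add_le_add (le_of_eq ?_) (sum_le_sum fun j' _ => ?_)
  · rw [map_smul, inner_smul_left, inner_smul_right, QQ]; simp; ring
  · rw [map_smul, inner_smul_left, inner_smul_right, ← QQ]
    refine (le_abs_self _).trans ?_
    rw [abs_mul, abs_mul, ← mul_assoc]
    refine mul_le_of_le_one_left (abs_nonneg _) ?_
    exact mul_le_one₀ (by simpa using hc j) (abs_nonneg _) (hc j')

def ch {k d : ℕ} (τ : Finset (Fin n)) (e : Fin d → Fin n) (v : Fin k → Fin n) (x : Fin k × Fin d) : Finset (Fin n) :=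
  (insert (v x.1) τ).erase (e x.2)

def chO {k d : ℕ} (τ : Finset (Fin n)) (e : Fin d → Fin n) (v : Fin k → Fin n) (x : Option (Fin k × Fin d)) : Finset (Fin n) :=
  x.elim τ (ch τ e v)

lemma cavity {k d : ℕ} {τ : Finset (Fin n)} {e : Fin d → Fin n} (he : Function.Injective e) (heτ : univ.image e = τ)
    {v : Fin k → Fin n} (hv : ∀ i, v i ∉ τ) {S S'' : Finset (Finset (Fin n))} (hS : S'' ⊆ S)
    (hvS : ∀ i, insert (v i) τ ∈ S) :
    QQ S τ τ ≤ FF (fun i : Fin k => ∑ j : Fin d, QQ S'' (ch τ e v (i, j)) (ch τ e v (i, j))) +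
      ∑ x, ∑ x' ∈ univ.erase x, |QQ S'' (chO τ e v x) (chO τ e v x')| := by
  obtain ⟨a, h0, h1, h2⟩ := FF_attain (fun i : Fin k => ∑ j : Fin d, QQ S'' (ch τ e v (i, j)) (ch τ e v (i, j)))
    (fun i => sum_nonneg fun j _ => QQ_nonneg _ _)
  have hsg : ∀ (κ : Finset (Fin n)) (w : Fin n), sg κ w * sg κ w = 1 := fun κ w => by
    unfold sg; rw [← mul_pow]; norm_num
  have habs : ∀ (κ : Finset (Fin n)) (w : Fin n), |sg κ w| = 1 := fun κ w => by
    unfold sg; rw [abs_pow]; norm_num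
  have ha : ∀ i, a i ≤ 1 := fun i => (single_le_sum (fun j _ => h0 j) (mem_univ i)).trans h1
  let b : EE n := ∑ i, (a i * sg (insert (v i) τ) (v i)) • bd (insert (v i) τ)
  have hb : b ∈ Bs S := Submodule.sum_mem _ fun i _ => Submodule.smul_mem _ _
    (Submodule.subset_span ⟨_, hvS i, rfl⟩)
  let c : Option (Fin k × Fin d) → ℝ := fun x => x.elim (1 - ∑ i, a i)
    fun y => -(a y.1 * sg (insert (v y.1) τ) (v y.1) * sg (insert (v y.1) τ) (e y.2))
  have hx : ee τ - b = ∑ x, c x • ee (chO τ e v x) := by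
    rw [Fintype.sum_option, Fintype.sum_prod_type]
    simp only [c, chO, Option.elim, b]
    have hbd : ∀ i, bd (insert (v i) τ) = sg (insert (v i) τ) (v i) • ee τ +
        ∑ j, sg (insert (v i) τ) (e j) • ee (ch τ e v (i, j)) := by
      intro i
      unfold bd
      rw [sum_insert (hv i), erase_insert (hv i)]
      congr 1
      conv_lhs => rw [← heτ, sum_image (fun _ _ _ _ h => he h)]
      rw [heτ]; rfl
    simp only [hbd, smul_add, smul_sum, smul_smul, mul_assoc, hsg, mul_one, sum_add_distrib, sub_smul, one_smul,
      sum_smul, neg_smul, sum_neg_distrib]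
    abel
  refine (QQ_le hS hb).trans ?_
  rw [hx]
  refine (PP_quad S'' _ c ?_).trans ?_
  · rintro (_ | ⟨i, j⟩)
    · simp only [c, Option.elim]
      rw [abs_of_nonneg (by linarith)]
      linarith [sum_nonneg fun i (_ : i ∈ univ) => h0 i]
    · simp only [c, Option.elim]
      rw [abs_neg, abs_mul, abs_mul, habs, habs, abs_of_nonneg (h0 i)]
      linarith [ha i]
  · refine add_le_add_left ?_ _
    rw [← h2, Fintype.sum_option, Fintype.sum_prod_type]
    simp only [c, chO, Option.elim]
    refine add_le_add (mul_le_of_le_one_right (sq_nonneg _) (QQ_le_one _ _)) (le_of_eq ?_)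
    refine sum_congr rfl fun i _ => ?_
    rw [mul_sum]
    refine sum_congr rfl fun j _ => ?_
    have e1 := hsg (insert (v i) τ) (v i)
    have e2 := hsg (insert (v i) τ) (e j)
    rw [neg_sq, mul_pow, mul_pow, pow_two (sg _ _), pow_two (sg _ _), e1, e2, mul_one, mul_one]

end LP
end

noncomputable section
namespace LP

def Vr (n d : ℕ) (R : Finset (Finset (Fin n))) : Finset (Finset (Fin n)) :=
  (UU n d).filter fun σ => ∀ ρ ∈ R, ¬ ρ ⊆ σ

lemma Vr_sub (n d : ℕ) (R : Finset (Finset (Fin n))) : Vr n d R ⊆ UU n d := filter_subset _ _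

lemma card_Vr {n d : ℕ} {R : Finset (Finset (Fin n))} (hR : ∀ ρ ∈ R, #ρ = d) : #(UU n d \ Vr n d R) ≤ #R * n := by
  have : UU n d \ Vr n d R ⊆ R.biUnion fun ρ => univ.image fun v => insert v ρ := by
    intro σ hσ
    rw [Finset.mem_sdiff, Vr, mem_filter, not_and] at hσ
    have h := hσ.2 hσ.1
    push Not at h
    obtain ⟨ρ, hρ, hs⟩ := h
    have h1 : #(σ \ ρ) = 1 := by
      rw [card_sdiff_of_subset hs, hR ρ hρ, (Finset.mem_powersetCard.1 hσ.1).2]; omega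
    obtain ⟨v, hv⟩ := Finset.card_eq_one.1 h1
    rw [mem_biUnion]
    refine ⟨ρ, hρ, Finset.mem_image.2 ⟨v, mem_univ _, ?_⟩⟩
    rw [← sdiff_union_of_subset hs, hv]; rfl
  refine (card_le_card this).trans (card_biUnion_le_card_mul _ _ _ fun ρ _ => ?_)
  exact Finset.card_image_le.trans (by simp)

lemma pow_lower {c : ℝ} (hc : 0 < c) {n m K : ℕ} (hn : 2 * c ≤ n) (hm : m ≤ K * n) :
    Real.exp (-(2 * c * K)) ≤ (1 - c / n) ^ m := by
  have hn0 : (0:ℝ) < n := by linarith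
  have hx : c / n ≤ 1 / 2 := by rw [div_le_iff₀ hn0]; linarith
  have hx0 : 0 ≤ c / n := by positivity
  have h1 : Real.exp (-(2 * (c / n))) ≤ 1 - c / n := by
    rw [Real.exp_neg, inv_le_iff_one_le_mul₀ (Real.exp_pos _)]
    nlinarith [Real.add_one_le_exp (2 * (c / n)), mul_nonneg hx0 (sub_nonneg.2 hx)]
  refine le_trans ?_ (pow_le_pow_left₀ (Real.exp_pos _).le h1 m)
  rw [← Real.exp_nat_mul]
  apply Real.exp_le_exp.2
  have : (m:ℝ) ≤ K * n := by exact_mod_cast hm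
  have h2 : (m:ℝ) * (c / n) ≤ K * c := by
    rw [← mul_div_assoc, div_le_iff₀ hn0]; nlinarith
  nlinarith

lemma off_small (d : ℕ) {c : ℝ} (hc : 0 < c) (K : ℕ) {η : ℝ} (hη : 0 < η) :
    ∀ᶠ n : ℕ in atTop, ∀ R : Finset (Finset (Fin n)), #R ≤ K → (∀ ρ ∈ R, #ρ = d) →
      ∀ κ κ' : Finset (Fin n), #κ = d → #κ' = d → κ ≠ κ' → Ex (Vr n d R) (c / n) (fun S => |QQ S κ κ'|) ≤ η := by
  obtain ⟨N, hN⟩ := exists_nat_gt (2 * c + 2 * d + 1 + Real.exp (2 * c * K) / (η / 2) ^ 2)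
  filter_upwards [eventually_ge_atTop N] with n hn R hR hRd κ κ' hκ hκ' hne
  have hn' : (N:ℝ) ≤ n := by exact_mod_cast hn
  have hp : 0 ≤ Real.exp (2 * c * K) / (η / 2) ^ 2 := by positivity
  have hd0 : (0:ℝ) ≤ d := Nat.cast_nonneg d
  have hn0 : (0:ℝ) < n := by linarith
  have h1 : c / n < 1 := by rw [div_lt_one hn0]; linarith
  have h2 : 2 * d < n := by exact_mod_cast (by push_cast; linarith : ((2 * d : ℕ):ℝ) < n)
  refine (QQ_exp_abs (by positivity) h1 hκ' hκ hne (Vr_sub n d R) h2 (half_pos hη)).trans ?_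
  have h3 := pow_lower hc (by linarith) ((card_Vr hRd).trans (Nat.mul_le_mul_right n hR))
  have h4 : ((1 - c / n) ^ #(UU n d \ Vr n d R))⁻¹ ≤ Real.exp (2 * c * K) := by
    rw [Real.exp_neg] at h3
    exact inv_le_of_inv_le₀ (Real.exp_pos _) h3
  have h5 : (0:ℝ) < n - 2 * d := by linarith
  have h6 : ((1 - c / n) ^ #(UU n d \ Vr n d R))⁻¹ / ((n - 2 * d) * (η / 2)) ≤ η / 2 := by
    rw [div_le_iff₀ (by positivity)]
    refine h4.trans ?_
    have : Real.exp (2 * c * K) / (η / 2) ^ 2 ≤ n - 2 * d := by linarith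
    rw [div_le_iff₀ (by positivity)] at this
    nlinarith
  linarith

def Adm {B : Type} [Fintype B] (L : ℝ) (Φ : (B → ℝ) → ℝ) : Prop :=
  Measurable Φ ∧ (∀ y, 0 ≤ Φ y) ∧ (∀ y, Φ y ≤ 1) ∧
    ∀ x y, (∀ b, 0 ≤ x b) → (∀ b, 0 ≤ y b) → Φ y ≤ Φ x + L * ∑ b, max (y b - x b) 0

def Conf {B : Type} (n d K : ℕ) (τ : B → Finset (Fin n)) (R : Finset (Finset (Fin n))) : Prop :=
  Function.Injective τ ∧ (∀ b, #(τ b) = d) ∧ #R ≤ K ∧ (∀ ρ ∈ R, #ρ = d) ∧ ∀ b, τ b ∉ R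

def II {B : Type} [Fintype B] (ν : B → Measure ℝ) (Φ : (B → ℝ) → ℝ) : ENNReal :=
  ∫⁻ y, ENNReal.ofReal (Φ y) ∂(Measure.pi ν)

def Good (d : ℕ) (c : ℝ) {B : Type} [Fintype B] (ν : B → Measure ℝ) : Prop :=
  ∀ (Φ : (B → ℝ) → ℝ) (L : ℝ), 0 ≤ L → Adm L Φ → ∀ (K : ℕ) (ε : ℝ), 0 < ε → ∀ᶠ n : ℕ in atTop,
    ∀ (τ : B → Finset (Fin n)) (R : Finset (Finset (Fin n))), Conf n d K τ R →
      Ex (Vr n d R) (c / n) (fun S => Φ fun b => QQ S (τ b) (τ b)) ≤ (II ν Φ).toReal + ε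

def sumF {k d : ℕ} (y : Fin k × Fin d → ℝ) : ℝ := FF fun i => ∑ j, y (i, j)

def PhiK {B : Type} (d k : ℕ) (Φ : (Option B → ℝ) → ℝ) (y : B ⊕ (Fin k × Fin d) → ℝ) : ℝ :=
  Φ fun b => b.elim (sumF fun x => y (Sum.inr x)) (fun b => y (Sum.inl b))

lemma measurable_FF {ι : Type*} [Fintype ι] : Measurable (FF : (ι → ℝ) → ℝ) := by
  unfold FF
  refine Measurable.ite ?_ (by fun_prop) measurable_const
  rw [Set.setOf_forall]
  exact MeasurableSet.iInter fun i => measurableSet_lt measurable_const (measurable_pi_apply i)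

lemma measurable_sumF {k d : ℕ} : Measurable (sumF : (Fin k × Fin d → ℝ) → ℝ) :=
  measurable_FF.comp (by fun_prop)

lemma sumF_lip {k d : ℕ} (x y : Fin k × Fin d → ℝ) (hx : ∀ i, 0 ≤ x i) (hy : ∀ i, 0 ≤ y i) :
    sumF y ≤ sumF x + ∑ i, max (y i - x i) 0 := by
  refine (FF_lip (fun i => ∑ j, x (i, j)) _ (fun i => sum_nonneg fun j _ => hx _) (fun i => sum_nonneg fun j _ => hy _)).trans ?_
  rw [Fintype.sum_prod_type]
  refine add_le_add_right (sum_le_sum fun i _ => ?_) _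
  refine max_le ?_ (sum_nonneg fun j _ => le_max_right _ _)
  rw [← sum_sub_distrib]
  exact sum_le_sum fun j _ => le_max_left _ _

lemma Adm_PhiK {B : Type} [Fintype B] {d k : ℕ} {Φ : (Option B → ℝ) → ℝ} {L : ℝ} (hL : 0 ≤ L) (h : Adm L Φ) :
    Adm L (PhiK d k Φ) := by
  obtain ⟨h1, h2, h3, h4⟩ := h
  refine ⟨h1.comp (measurable_pi_lambda _ fun b => ?_), fun y => h2 _, fun y => h3 _, fun x y hx hy => ?_⟩
  · rcases b with _ | b
    · exact measurable_sumF.comp (by fun_prop)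
    · exact measurable_pi_apply _
  · refine (h4 (fun b => b.elim (sumF fun x' => x (Sum.inr x')) (fun b => x (Sum.inl b))) _ ?_ ?_).trans ?_
    · rintro (_ | b)
      · exact FF_nonneg _
      · exact hx _
    · rintro (_ | b)
      · exact FF_nonneg _
      · exact hy _
    · refine add_le_add_right (mul_le_mul_of_nonneg_left ?_ hL) _
      rw [Fintype.sum_option, Fintype.sum_sum_type, add_comm]
      refine add_le_add_right (max_le ?_ (sum_nonneg fun j _ => le_max_right _ _)) _
      have := sumF_lip (fun x' => x (Sum.inr x')) (fun x' => y (Sum.inr x')) (fun _ => hx _) (fun _ => hy _)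
      simp only [Option.elim]
      linarith

lemma step_k (d : ℕ) {c : ℝ} (hc : 0 < c) {B : Type} [Fintype B] (k : ℕ) {ν : B ⊕ (Fin k × Fin d) → Measure ℝ}
    (hG : Good d c ν) {Φ : (Option B → ℝ) → ℝ} {L : ℝ} (hL : 0 ≤ L) (hΦ : Adm L Φ) (K : ℕ) {ε : ℝ} (hε : 0 < ε) :
    ∀ᶠ n : ℕ in atTop, ∀ (τ : Option B → Finset (Fin n)) (R : Finset (Finset (Fin n))), Conf n d K τ R →
      ∀ v : Fin k → Fin n, Function.Injective v → (∀ i b, v i ∉ τ b) → (∀ i, ∀ ρ ∈ R, v i ∉ ρ) →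
      Ex (Vr n d (insert (τ none) R)) (c / n)
        (fun S => Φ fun b => QQ (S ∪ univ.image fun i => insert (v i) (τ none)) (τ b) (τ b)) ≤
      (II ν (PhiK d k Φ)).toReal + ε := by
  classical
  set M : ℝ := (Fintype.card (Option (Fin k × Fin d)) : ℝ) ^ 2
  have hη : 0 < ε / 2 / ((L + 1) * (M + 1)) := by positivity
  filter_upwards [hG (PhiK d k Φ) L hL (Adm_PhiK hL hΦ) (K + 1) (ε / 2) (half_pos hε), off_small d hc (K + 1) hη,
    eventually_ge_atTop ⌈c⌉₊, eventually_gt_atTop 0] with n hn1 hn2 hn3 hn4 τ R hcf v hvi hvτ hvR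
  obtain ⟨hinj, hcard, hRK, hRd, hτR⟩ := hcf
  have hn0 : (0:ℝ) < n := by exact_mod_cast hn4
  have hp0 : 0 ≤ c / n := by positivity
  have hp1 : c / n ≤ 1 := by rw [div_le_one hn0]; exact Nat.ceil_le.1 hn3
  set τ0 := τ none with hτ0
  let e : Fin d → Fin n := fun j => (τ0.orderEmbOfFin (hcard none)) j
  have he : Function.Injective e := (τ0.orderEmbOfFin (hcard none)).injective
  have heτ : univ.image e = τ0 := by
    apply coe_injective; rw [coe_image, coe_univ, Set.image_univ]
    exact range_orderEmbOfFin _ _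
  have hej : ∀ j, e j ∈ τ0 := fun j => by rw [← heτ]; exact mem_image_of_mem _ (mem_univ j)
  have hvc : ∀ i j, v i ∈ ch τ0 e v (i, j) := fun i j => by
    rw [ch, mem_erase]; exact ⟨fun h => hvτ i none (h ▸ hej j), mem_insert_self _ _⟩
  have hcc : ∀ x, #(ch τ0 e v x) = d := fun x => by
    rw [ch, card_erase_of_mem (mem_insert_of_mem (hej _)), card_insert_of_notMem (hvτ _ _), hcard]; rfl
  have hchinj : Function.Injective (ch τ0 e v) := by
    rintro ⟨i, j⟩ ⟨i', j'⟩ h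
    have hi : i = i' := by
      have := hvc i j
      rw [h, ch, mem_erase, mem_insert] at this
      exact hvi (this.2.resolve_right (hvτ i none))
    subst hi
    have hj : e j ∉ ch τ0 e v (i, j) := by simp [ch]
    rw [h, ch, mem_erase, not_and_or, not_not] at hj
    rcases hj with hj | hj
    · rw [he hj]
    · exact absurd (mem_insert_of_mem (hej j)) hj
  have hR' : #(insert τ0 R) ≤ K + 1 := (card_insert_le _ _).trans (by omega)
  have hRd' : ∀ ρ ∈ insert τ0 R, #ρ = d := by
    intro ρ hρ; rcases Finset.mem_insert.1 hρ with rfl | hρ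
    · exact hcard none
    · exact hRd ρ hρ
  let τ' : B ⊕ (Fin k × Fin d) → Finset (Fin n) := Sum.elim (fun b => τ (some b)) (ch τ0 e v)
  have hconf : Conf n d (K + 1) τ' (insert τ0 R) := by
    refine ⟨?_, ?_, hR', hRd', ?_⟩
    · refine Function.Injective.sumElim (fun a b h => Option.some_injective _ (hinj h)) hchinj ?_
      rintro b ⟨i, j⟩ h
      exact hvτ i (some b) (h ▸ hvc i j)
    · rintro (b | x)
      · exact hcard _
      · exact hcc x
    · rintro (b | ⟨i, j⟩) h
      · rcases Finset.mem_insert.1 h with h | h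
        · exact absurd (hinj h) (by simp)
        · exact hτR _ h
      · rcases Finset.mem_insert.1 h with h | h
        · exact hvτ i none (by rw [← hτ0, ← h]; exact hvc i j)
        · exact hvR i _ h (hvc i j)
  have h1 := hn1 τ' (insert τ0 R) hconf
  set T := univ.image fun i => insert (v i) τ0 with hT
  let Er : Finset (Finset (Fin n)) → ℝ := fun S => ∑ x, ∑ x' ∈ univ.erase x, |QQ S (chO τ0 e v x) (chO τ0 e v x')|
  have hEr : Ex (Vr n d (insert τ0 R)) (c / n) Er ≤ M * (ε / 2 / ((L + 1) * (M + 1))) := by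
    simp only [Er, Ex_sum]
    have hoc : ∀ x, #(chO τ0 e v x) = d := by
      rintro (_ | x)
      · exact hcard none
      · exact hcc x
    have hoi : Function.Injective (chO τ0 e v) := by
      have hno : ∀ x, ch τ0 e v x ≠ τ0 := fun x h => hvτ x.1 none (by rw [← hτ0, ← h]; exact hvc x.1 x.2)
      rintro (_ | x) (_ | y) h
      · rfl
      · exact absurd h.symm (hno y)
      · exact absurd h (hno x)
      · exact congrArg some (hchinj h)
    calc _ ≤ ∑ x : Option (Fin k × Fin d), ∑ x' : Option (Fin k × Fin d), ε / 2 / ((L + 1) * (M + 1)) := by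
          refine sum_le_sum fun x _ => ?_
          refine (sum_le_sum (g := fun _ => ε / 2 / ((L + 1) * (M + 1))) fun x' hx' => ?_).trans
            (sum_le_sum_of_subset_of_nonneg (subset_univ _) fun _ _ _ => hη.le)
          exact hn2 _ hR' hRd' _ _ (hoc _) (hoc _) (fun h => (Finset.mem_erase.1 hx').1 (hoi h).symm)
      _ = _ := by simp only [sum_const, card_univ, nsmul_eq_mul, M]; ring
  have hmain : Ex (Vr n d (insert τ0 R)) (c / n) (fun S => Φ fun b => QQ (S ∪ T) (τ b) (τ b)) ≤
      Ex (Vr n d (insert τ0 R)) (c / n) (fun S => PhiK d k Φ (fun b => QQ S (τ' b) (τ' b)) + L * Er S) := by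
    refine Ex_mono hp0 hp1 fun S hS => ?_
    refine (hΦ.2.2.2 (fun b => b.elim (sumF fun x => QQ S (τ' (Sum.inr x)) (τ' (Sum.inr x))) (fun b => QQ S (τ' (Sum.inl b)) (τ' (Sum.inl b)))) _ ?_ fun b => QQ_nonneg _ _).trans ?_
    · rintro (_ | b)
      · exact FF_nonneg _
      · exact QQ_nonneg _ _
    · refine add_le_add_right (mul_le_mul_of_nonneg_left ?_ hL) _
      have hEr0 : 0 ≤ Er S := sum_nonneg fun _ _ => sum_nonneg fun _ _ => abs_nonneg _
      rw [Fintype.sum_option, sum_eq_zero (s := (univ : Finset B)), add_zero]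
      · refine max_le ?_ hEr0
        have := cavity he heτ (fun i => hvτ i none) (subset_union_left (s₁ := S) (s₂ := T))
          (fun i => mem_union_right _ (mem_image_of_mem _ (mem_univ i)))
        rw [sub_le_iff_le_add']
        exact this
      · intro b _
        refine max_eq_right (sub_nonpos.2 ?_)
        exact QQ_mono subset_union_left _
  refine hmain.trans ?_
  rw [Ex_add, Ex_mul]
  have h2 : L * Ex (Vr n d (insert τ0 R)) (c / n) Er ≤ ε / 2 := by
    refine (mul_le_mul_of_nonneg_left hEr hL).trans ?_
    have hM : 0 ≤ M := by positivity
    rw [← mul_assoc, mul_div_assoc', div_le_iff₀ (by positivity)]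
    nlinarith [mul_nonneg hL hM]
  linarith
end LP
end

noncomputable section
namespace LP

lemma lint_option {B : Type} [Fintype B] (μ : Option B → Measure ℝ) [∀ b, IsProbabilityMeasure (μ b)]
    {f : (Option B → ℝ) → ENNReal} (hf : Measurable f) :
    ∫⁻ y, f y ∂(Measure.pi μ) = ∫⁻ y, ∫⁻ x, f (fun b => b.elim x y) ∂(μ none) ∂(Measure.pi fun b => μ (some b)) := by
  have hm : Measurable fun z : (B → ℝ) × ℝ => (fun b : Option B => b.elim z.2 z.1 : Option B → ℝ) := by
    refine measurable_pi_lambda _ fun b => ?_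
    rcases b with _ | b
    · exact measurable_snd
    · exact (measurable_pi_apply b).comp measurable_fst
  have : Measure.pi μ = ((Measure.pi fun b => μ (some b)).prod (μ none)).map (fun z b => b.elim z.2 z.1) := by
    refine (Measure.pi_eq fun s hs => ?_)
    rw [Measure.map_apply hm (MeasurableSet.univ_pi hs), Fintype.prod_option, ← Measure.pi_pi, mul_comm, ← Measure.prod_prod]
    congr 1; ext z
    simp only [Set.mem_preimage, Set.mem_pi, Set.mem_univ, true_implies, Set.mem_prod, Option.forall, Option.elim]
    tauto
  rw [this, lintegral_map hf hm]
  exact lintegral_prod _ (hf.comp hm).aemeasurable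

lemma lint_sum {B C : Type} [Fintype B] [Fintype C] (μ : B ⊕ C → Measure ℝ) [∀ b, IsProbabilityMeasure (μ b)]
    {f : (B ⊕ C → ℝ) → ENNReal} (hf : Measurable f) :
    ∫⁻ y, f y ∂(Measure.pi μ) = ∫⁻ y, ∫⁻ z, f (Sum.elim y z) ∂(Measure.pi fun b => μ (.inr b)) ∂(Measure.pi fun b => μ (.inl b)) := by
  have h := measurePreserving_sumPiEquivProdPi_symm μ
  rw [← h.lintegral_comp hf]
  refine (lintegral_prod _ (hf.comp h.measurable).aemeasurable).trans ?_
  refine lintegral_congr fun y => lintegral_congr fun z => ?_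
  show f _ = f _
  congr 1

lemma lint_equiv {B B' : Type} [Fintype B] [Fintype B'] (e : B' ≃ B) (μ : B → Measure ℝ) [∀ b, IsProbabilityMeasure (μ b)]
    {f : (B → ℝ) → ENNReal} (hf : Measurable f) :
    ∫⁻ y, f y ∂(Measure.pi μ) = ∫⁻ y, f (fun b => y (e.symm b)) ∂(Measure.pi fun b => μ (e b)) := by
  have h := measurePreserving_piCongrLeft μ e
  rw [← h.lintegral_comp hf]
  refine lintegral_congr fun y => ?_
  congr 1; ext b
  obtain ⟨b, rfl⟩ := e.surjective b
  rw [Equiv.symm_apply_apply, MeasurableEquiv.coe_piCongrLeft, Equiv.piCongrLeft_apply_apply]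

def pk (c : ℝ) (k : ℕ) : ℝ := Real.exp (-c) * c ^ k / k.factorial

lemma pk_nonneg {c : ℝ} (hc : 0 < c) (k : ℕ) : 0 ≤ pk c k := by unfold pk; positivity

lemma pk_sum {c : ℝ} (hc : 0 < c) : HasSum (pk c) 1 := by
  have := ProbabilityTheory.hasSum_one_poissonMeasure ⟨c, hc.le⟩
  exact this

def TT (d : ℕ) (c : ℝ) (μ : Measure ℝ) : Measure ℝ :=
  Measure.sum fun k : ℕ => ENNReal.ofReal (pk c k) • (Measure.pi fun _ : Fin k × Fin d => μ).map sumF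

lemma lint_TT (d : ℕ) (c : ℝ) (μ : Measure ℝ) {f : ℝ → ENNReal} (hf : Measurable f) :
    ∫⁻ x, f x ∂(TT d c μ) = ∑' k, ENNReal.ofReal (pk c k) * ∫⁻ y, f (sumF y) ∂(Measure.pi fun _ : Fin k × Fin d => μ) := by
  rw [TT, lintegral_sum_measure]
  refine tsum_congr fun k => ?_
  rw [lintegral_smul_measure, lintegral_map hf measurable_sumF, smul_eq_mul]

lemma TT_prob (d : ℕ) {c : ℝ} (hc : 0 < c) (μ : Measure ℝ) [IsProbabilityMeasure μ] : IsProbabilityMeasure (TT d c μ) := by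
  constructor
  have := lint_TT d c μ (f := fun _ => 1) measurable_const
  simp only [lintegral_const, measure_univ, mul_one, one_mul] at this
  rw [this, ← ENNReal.ofReal_tsum_of_nonneg (pk_nonneg hc) (pk_sum hc).summable, (pk_sum hc).tsum_eq, ENNReal.ofReal_one]

lemma II_TT {d : ℕ} {c : ℝ} (hc : 0 < c) {B : Type} [Fintype B] (ν : B → Measure ℝ) [∀ b, IsProbabilityMeasure (ν b)]
    (μ : Measure ℝ) [IsProbabilityMeasure μ] {Φ : (Option B → ℝ) → ℝ} (hΦ : Measurable Φ) :
    II (fun b : Option B => b.elim (TT d c μ) ν) Φ =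
      ∑' k, ENNReal.ofReal (pk c k) * II (Sum.elim ν fun _ : Fin k × Fin d => μ) (PhiK d k Φ) := by
  have hT := TT_prob d hc μ
  haveI : ∀ b : Option B, IsProbabilityMeasure (b.elim (TT d c μ) ν) := by
    rintro (_ | b)
    · exact hT
    · exact inferInstanceAs (IsProbabilityMeasure (ν b))
  haveI : ∀ k, ∀ b : B ⊕ (Fin k × Fin d), IsProbabilityMeasure (Sum.elim ν (fun _ : Fin k × Fin d => μ) b) := by
    rintro k (b | b)
    · exact inferInstanceAs (IsProbabilityMeasure (ν b))
    · exact inferInstanceAs (IsProbabilityMeasure μ)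
  have hm : ∀ k, Measurable fun z : (B → ℝ) × (Fin k × Fin d → ℝ) => Φ fun b => b.elim (sumF z.2) z.1 := by
    intro k
    refine hΦ.comp (measurable_pi_lambda _ fun b => ?_)
    rcases b with _ | b
    · exact measurable_sumF.comp measurable_snd
    · exact (measurable_pi_apply b).comp measurable_fst
  unfold II
  rw [lint_option _ (f := fun y => ENNReal.ofReal (Φ y)) hΦ.ennreal_ofReal]
  have h1 : ∀ y : B → ℝ, ∫⁻ x, ENNReal.ofReal (Φ fun b => b.elim x y) ∂(TT d c μ) =
      ∑' k, ENNReal.ofReal (pk c k) * ∫⁻ z, ENNReal.ofReal (Φ fun b => b.elim (sumF z) y) ∂(Measure.pi fun _ : Fin k × Fin d => μ) := by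
    intro y
    refine lint_TT d c μ (f := fun x => ENNReal.ofReal (Φ fun b => b.elim x y)) (ENNReal.measurable_ofReal.comp (hΦ.comp (measurable_pi_lambda _ fun b => ?_)))
    rcases b with _ | b
    · exact measurable_id
    · exact measurable_const
  simp only [Option.elim_none, Option.elim_some] at h1 ⊢
  simp only [h1]
  rw [lintegral_tsum]
  · refine tsum_congr fun k => ?_
    rw [lintegral_const_mul]
    · rw [lint_sum]
      · rfl
      · exact ENNReal.measurable_ofReal.comp (hΦ.comp (measurable_pi_lambda _ fun b => by
          rcases b with _ | b
          · exact measurable_sumF.comp (by fun_prop)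
          · exact measurable_pi_apply _))
    · exact (ENNReal.measurable_ofReal.comp (hm k)).lintegral_prod_right'
  · intro k
    exact ((ENNReal.measurable_ofReal.comp (hm k)).lintegral_prod_right'.const_mul _).aemeasurable

lemma II_le_one {B : Type} [Fintype B] (ν : B → Measure ℝ) [∀ b, IsProbabilityMeasure (ν b)] {Φ : (B → ℝ) → ℝ}
    (h : ∀ y, Φ y ≤ 1) : II ν Φ ≤ 1 := by
  unfold II
  calc _ ≤ ∫⁻ _, 1 ∂(Measure.pi ν) := lintegral_mono fun y => ENNReal.ofReal_le_one.2 (h y)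
    _ = 1 := by simp

section
variable {α β : Type*} [DecidableEq α] [DecidableEq β]

lemma Ex_image {f : α → β} {V : Finset α} (hf : Set.InjOn f V) (p : ℝ) (g : Finset β → ℝ) :
    Ex (V.image f) p g = Ex V p fun A => g (A.image f) := by
  induction V using Finset.induction_on generalizing g with
  | empty => simp [Ex_empty]
  | insert a V ha ih =>
    have hf' : Set.InjOn f V := hf.mono (by simp)
    rw [image_insert, Ex_insert, Ex_insert ha, ih hf', ih hf']
    · simp only [image_insert]
    · rw [mem_image]; rintro ⟨b, hb, h⟩
      exact ha (hf (by simp [hb]) (by simp) h ▸ hb)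

lemma Ex_card_eq (V : Finset α) (p : ℝ) (j : ℕ) :
    Ex V p (fun A => if #A = j then 1 else 0) = (#V).choose j * p ^ j * (1 - p) ^ (#V - j) := by
  unfold Ex
  simp only [mul_ite, mul_one, mul_zero]
  rw [← sum_filter, ← powersetCard_eq_filter, sum_congr rfl (g := fun _ => p ^ j * (1 - p) ^ (#V - j)),
    sum_const, card_powersetCard, nsmul_eq_mul, mul_assoc]
  intro A hA
  rw [mem_powersetCard] at hA
  rw [card_sdiff_of_subset hA.1, hA.2]

lemma Ex_anti {U V : Finset α} (h : V ⊆ U) {p : ℝ} (h0 : 0 ≤ p) (h1 : p ≤ 1) {g : Finset α → ℝ}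
    (H : ∀ A B, g (A ∪ B) ≤ g A) : Ex U p g ≤ Ex V p g := by
  rw [Ex_sdiff h]
  exact Ex_mono h0 h1 fun A _ => Ex_le h0 h1 fun B _ => H A B

lemma Ex_by_card {V : Finset α} {p : ℝ} (h0 : 0 ≤ p) (h1 : p ≤ 1) {g : Finset α → ℝ} (D : ℕ) (I : ℕ → ℝ)
    (hg1 : ∀ A ⊆ V, g A ≤ 1) (hg : ∀ A ⊆ V, #A < D → g A ≤ I #A) :
    Ex V p g ≤ 1 + ∑ j ∈ range D, (I j - 1) * ((#V).choose j * p ^ j * (1 - p) ^ (#V - j)) := by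
  calc Ex V p g ≤ Ex V p (fun A => 1 + ∑ j ∈ range D, (I j - 1) * (if #A = j then 1 else 0)) := by
        refine Ex_mono h0 h1 fun A hA => ?_
        simp only [mul_ite, mul_one, mul_zero, sum_ite_eq, mem_range]
        split_ifs with h
        · linarith [hg A hA h]
        · linarith [hg1 A hA]
    _ = _ := by
        rw [Ex_add, Ex_const, Ex_sum]
        simp only [Ex_mul, Ex_card_eq]
end

lemma binom_lim {c : ℝ} (C0 j : ℕ) : Tendsto (fun n : ℕ => ((n - C0).choose j : ℝ) * (c / n) ^ j * (1 - c / n) ^ (n - C0 - j))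
    atTop (nhds (pk c j)) := by
  have h1 : Tendsto (fun N : ℕ => (N:ℝ) * (c / (N + C0 : ℕ))) atTop (nhds c) := by
    have h := (tendsto_natCast_div_add_atTop (C0 : ℝ)).const_mul c
    rw [mul_one] at h
    refine h.congr fun N => ?_
    push_cast; ring
  have h2 := (ProbabilityTheory.tendsto_choose_mul_pow_of_tendsto_mul_atTop j h1).comp (tendsto_sub_atTop_nat C0)
  refine Tendsto.congr' ?_ h2
  filter_upwards [eventually_ge_atTop C0] with n hn
  simp only [Function.comp, Nat.sub_add_cancel hn]

lemma Good_step {d : ℕ} {c : ℝ} (hc : 0 < c) {B : Type} [Fintype B] (ν : B → Measure ℝ) [∀ b, IsProbabilityMeasure (ν b)]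
    (μ : Measure ℝ) [IsProbabilityMeasure μ] (hG : ∀ k, Good d c (Sum.elim ν fun _ : Fin k × Fin d => μ)) :
    Good d c (fun b : Option B => b.elim (TT d c μ) ν) := by
  classical
  intro Φ L hL hΦ K ε hε
  haveI : ∀ b : Option B, IsProbabilityMeasure (b.elim (TT d c μ) ν) := by
    rintro (_ | b)
    · exact TT_prob d hc μ
    · exact inferInstanceAs (IsProbabilityMeasure (ν b))
  haveI : ∀ k, ∀ b : B ⊕ (Fin k × Fin d), IsProbabilityMeasure (Sum.elim ν (fun _ : Fin k × Fin d => μ) b) := by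
    rintro k (b | b)
    · exact inferInstanceAs (IsProbabilityMeasure (ν b))
    · exact inferInstanceAs (IsProbabilityMeasure μ)
  set I : ℕ → ENNReal := fun k => II (Sum.elim ν fun _ : Fin k × Fin d => μ) (PhiK d k Φ) with hI
  have hI1 : ∀ k, I k ≤ 1 := fun k => II_le_one _ fun y => hΦ.2.2.1 _
  have hTI := II_TT (d := d) hc ν μ hΦ.1
  set J := II (fun b : Option B => b.elim (TT d c μ) ν) Φ
  have hJ1 : J ≤ 1 := II_le_one _ hΦ.2.2.1
  obtain ⟨D, hD⟩ : ∃ D, 1 - ∑ j ∈ range D, pk c j < ε / 4 := by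
    have := (pk_sum hc).tendsto_sum_nat.eventually (lt_mem_nhds (show (1:ℝ) - ε / 4 < 1 by linarith))
    obtain ⟨D, hD⟩ := this.exists
    exact ⟨D, by linarith⟩
  have hJ : ∑ j ∈ range D, pk c j * (I j).toReal ≤ J.toReal := by
    have h1 : ∑ j ∈ range D, ENNReal.ofReal (pk c j) * I j ≤ J := by rw [hTI]; exact ENNReal.sum_le_tsum _
    have h2 := ENNReal.toReal_mono (hJ1.trans_lt ENNReal.one_lt_top).ne h1
    rw [ENNReal.toReal_sum] at h2
    · simpa [ENNReal.toReal_mul, ENNReal.toReal_ofReal (pk_nonneg hc _)] using h2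
    · intro j _; exact ENNReal.mul_ne_top ENNReal.ofReal_ne_top ((hI1 j).trans_lt ENNReal.one_lt_top).ne
  set C0 := d * (Fintype.card (Option B) + K) with hC0
  have hlim : Tendsto (fun n : ℕ => 1 + ∑ j ∈ range D, ((I j).toReal + ε / 4 - 1) *
      (((n - C0).choose j : ℝ) * (c / n) ^ j * (1 - c / n) ^ (n - C0 - j))) atTop
      (nhds (1 + ∑ j ∈ range D, ((I j).toReal + ε / 4 - 1) * pk c j)) :=
    tendsto_const_nhds.add (tendsto_finsetSum _ fun j _ => (binom_lim C0 j).const_mul _)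
  have hval : 1 + ∑ j ∈ range D, ((I j).toReal + ε / 4 - 1) * pk c j < J.toReal + ε := by
    have h1 : ∑ j ∈ range D, ((I j).toReal + ε / 4 - 1) * pk c j =
        ∑ j ∈ range D, pk c j * (I j).toReal + (ε / 4) * ∑ j ∈ range D, pk c j - ∑ j ∈ range D, pk c j := by
      rw [mul_sum, ← sum_add_distrib, ← sum_sub_distrib]
      exact sum_congr rfl fun j _ => by ring
    have h2 : ∑ j ∈ range D, pk c j ≤ 1 := sum_le_hasSum _ (fun j _ => pk_nonneg hc j) (pk_sum hc)
    rw [h1]; nlinarith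
  have hall : ∀ᶠ n : ℕ in atTop, ∀ k ∈ range D, ∀ (τ : Option B → Finset (Fin n)) (R : Finset (Finset (Fin n))), Conf n d K τ R →
      ∀ v : Fin k → Fin n, Function.Injective v → (∀ i b, v i ∉ τ b) → (∀ i, ∀ ρ ∈ R, v i ∉ ρ) →
      Ex (Vr n d (insert (τ none) R)) (c / n)
        (fun S => Φ fun b => QQ (S ∪ univ.image fun i => insert (v i) (τ none)) (τ b) (τ b)) ≤ (I k).toReal + ε / 4 := by
    rw [Filter.eventually_all_finset]
    intro k _
    exact step_k d hc k (hG k) hL hΦ K (by positivity)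
  filter_upwards [hall, hlim.eventually (gt_mem_nhds hval), eventually_ge_atTop ⌈c⌉₊, eventually_gt_atTop 0] with n hn1 hn2 hn3 hn4 τ R hcf
  obtain ⟨hinj, hcard, hRK, hRd, hτR⟩ := id hcf
  have hn0 : (0:ℝ) < n := by exact_mod_cast hn4
  have hp0 : 0 ≤ c / n := by positivity
  have hp1 : c / n ≤ 1 := by rw [div_le_one hn0]; exact Nat.ceil_le.1 hn3
  have hΦ' : ∀ A B' : Finset (Finset (Fin n)), (Φ fun b => QQ (A ∪ B') (τ b) (τ b)) ≤ Φ fun b => QQ A (τ b) (τ b) := by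
    intro A B'
    have := hΦ.2.2.2 (fun b => QQ A (τ b) (τ b)) (fun b => QQ (A ∪ B') (τ b) (τ b)) (fun b => QQ_nonneg _ _) (fun b => QQ_nonneg _ _)
    rwa [sum_eq_zero, mul_zero, add_zero] at this
    intro b _
    exact max_eq_right (sub_nonpos.2 (QQ_mono subset_union_left _))
  set Z : Finset (Fin n) := univ.biUnion τ ∪ R.biUnion id with hZ
  have hZc : #Z ≤ C0 := by
    refine (card_union_le _ _).trans ?_
    have h1 : #(univ.biUnion τ) ≤ Fintype.card (Option B) * d :=
      card_biUnion_le_card_mul _ _ _ fun b _ => (hcard b).le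
    have h2 : #(R.biUnion id) ≤ #R * d := card_biUnion_le_card_mul _ _ _ fun ρ hρ => (hRd ρ hρ).le
    rw [hC0]
    nlinarith [Nat.mul_le_mul_right d hRK]
  obtain ⟨V, hVZ, hVc⟩ := exists_subset_card_eq (s := Zᶜ) (n := n - C0) (by
    have := card_compl_add_card Z
    rw [Fintype.card_fin] at this; omega)
  have hVτ : ∀ v ∈ V, ∀ b, v ∉ τ b := fun v hv b hb => by
    have := hVZ hv
    rw [mem_compl] at this
    exact this (mem_union_left _ (Finset.mem_biUnion.2 ⟨b, mem_univ _, hb⟩))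
  have hVR : ∀ v ∈ V, ∀ ρ ∈ R, v ∉ ρ := fun v hv ρ hρ hb => by
    have := hVZ hv
    rw [mem_compl] at this
    exact this (mem_union_right _ (Finset.mem_biUnion.2 ⟨ρ, hρ, hb⟩))
  set f : Fin n → Finset (Fin n) := fun v => insert v (τ none) with hf
  set W := Vr n d (insert (τ none) R) with hW
  have hfi : Set.InjOn f V := by
    intro v hv w hw h
    have : v ∈ f w := by rw [← h]; exact mem_insert_self _ _
    exact (Finset.mem_insert.1 this).resolve_right (hVτ v hv none)
  have hdis : Disjoint (V.image f) W := by
    rw [disjoint_left]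
    intro σ hσ hσW
    obtain ⟨v, hv, rfl⟩ := Finset.mem_image.1 hσ
    exact (Finset.mem_filter.1 hσW).2 (τ none) (mem_insert_self _ _) (subset_insert _ _)
  have hsub : V.image f ∪ W ⊆ Vr n d R := by
    refine union_subset ?_ ?_
    · intro σ hσ
      obtain ⟨v, hv, rfl⟩ := Finset.mem_image.1 hσ
      refine Finset.mem_filter.2 ⟨Finset.mem_powersetCard.2 ⟨subset_univ _, ?_⟩, fun ρ hρ hs => ?_⟩
      · rw [hf, card_insert_of_notMem (hVτ v hv none), hcard]
      · rw [subset_insert_iff_of_notMem (hVR v hv ρ hρ)] at hs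
        have := eq_of_subset_of_card_le hs (by rw [hcard, hRd ρ hρ])
        exact hτR none (this ▸ hρ)
    · intro σ hσ
      have := Finset.mem_filter.1 hσ
      exact Finset.mem_filter.2 ⟨this.1, fun ρ hρ => this.2 ρ (mem_insert_of_mem hρ)⟩
  refine (Ex_anti hsub hp0 hp1 hΦ').trans ?_
  rw [Ex_union hdis, Ex_image hfi]
  refine le_trans ?_ hn2.le
  rw [← hVc]
  refine Ex_by_card hp0 hp1 D (fun j => (I j).toReal + ε / 4) (fun A _ => Ex_le hp0 hp1 fun S _ => hΦ.2.2.1 _) fun A hA hAD => ?_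
  have hvA : ∀ i, A.orderEmbOfFin rfl i ∈ V := fun i => hA (orderEmbOfFin_mem _ _ _)
  have := hn1 (#A) (Finset.mem_range.2 hAD) τ R hcf (A.orderEmbOfFin rfl) (A.orderEmbOfFin rfl).injective
    (fun i b => hVτ _ (hvA i) b) (fun i ρ hρ => hVR _ (hvA i) ρ hρ)
  have himg : A.image f = univ.image fun i => insert (A.orderEmbOfFin rfl i) (τ none) := by
    have h1 : A = univ.image (A.orderEmbOfFin rfl) := by
      apply coe_injective; rw [coe_image, coe_univ, Set.image_univ, range_orderEmbOfFin]
    conv_lhs => rw [h1]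
    rw [image_image]; rfl
  rw [himg]
  refine le_trans (le_of_eq ?_) this
  exact Ex_congr _ fun S _ => by rw [union_comm]

lemma Good_equiv {d : ℕ} {c : ℝ} {B B' : Type} [Fintype B] [Fintype B'] (e : B' ≃ B) (ν : B → Measure ℝ) [∀ b, IsProbabilityMeasure (ν b)]
    (hG : Good d c ν) (ν' : B' → Measure ℝ) (hν : ∀ b, ν' b = ν (e b)) : Good d c ν' := by
  obtain rfl : ν' = fun b => ν (e b) := funext hν
  intro Φ L hL hΦ K ε hε
  have hm : Measurable fun (y : B → ℝ) (b : B') => y (e b) := by fun_prop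
  have hA : Adm L (fun y : B → ℝ => Φ fun b => y (e b)) := by
    refine ⟨hΦ.1.comp hm, fun y => hΦ.2.1 _, fun y => hΦ.2.2.1 _, fun x y hx hy => ?_⟩
    refine (hΦ.2.2.2 (fun b => x (e b)) _ (fun b => hx _) (fun b => hy _)).trans (le_of_eq ?_)
    rw [Equiv.sum_comp e fun b => max (y b - x b) 0]
  filter_upwards [hG _ L hL hA K ε hε] with n hn τ R hcf
  have := hn (fun b => τ (e.symm b)) R ⟨hcf.1.comp e.symm.injective, fun b => hcf.2.1 _, hcf.2.2.1, hcf.2.2.2.1, fun b => hcf.2.2.2.2 _⟩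
  simp only [Equiv.symm_apply_apply] at this
  convert this using 3
  unfold II
  rw [lint_equiv e ν (f := fun y => ENNReal.ofReal (Φ fun b => y (e b))) (hΦ.1.comp hm).ennreal_ofReal]
  simp

def mu (d : ℕ) (c : ℝ) : ℕ → Measure ℝ
  | 0 => Measure.dirac 1
  | r + 1 => TT d c (mu d c r)

lemma mu_prob (d : ℕ) {c : ℝ} (hc : 0 < c) (r : ℕ) : IsProbabilityMeasure (mu d c r) := by
  induction r with
  | zero => exact inferInstanceAs (IsProbabilityMeasure (Measure.dirac (1:ℝ)))
  | succ r ih => exact TT_prob d hc _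

lemma Good_mu (d : ℕ) {c : ℝ} (hc : 0 < c) (r : ℕ) : ∀ (B : Type) [Fintype B], Good d c (fun _ : B => mu d c r) := by
  have hpr := mu_prob d hc
  induction r with
  | zero =>
    intro B _ Φ L hL hΦ K ε hε
    filter_upwards [eventually_ge_atTop ⌈c⌉₊, eventually_gt_atTop 0] with n hn3 hn4 τ R hcf
    have hn0 : (0:ℝ) < n := by exact_mod_cast hn4
    have hp0 : 0 ≤ c / n := by positivity
    have hp1 : c / n ≤ 1 := by rw [div_le_one hn0]; exact Nat.ceil_le.1 hn3
    have h1 : II (fun _ : B => mu d c 0) Φ = ENNReal.ofReal (Φ fun _ => 1) := by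
      unfold II
      have : Measure.pi (fun _ : B => mu d c 0) = Measure.dirac (fun _ => 1) := by
        classical
        haveI := hpr 0
        refine Measure.pi_eq fun s hs => ?_
        rw [Measure.dirac_apply' _ (MeasurableSet.univ_pi hs)]
        have h2 : ∀ i, mu d c 0 (s i) = if (1:ℝ) ∈ s i then 1 else 0 := fun i => by
          show Measure.dirac (1:ℝ) (s i) = _
          rw [Measure.dirac_apply' _ (hs i), Set.indicator_apply]; rfl
        simp only [h2, Set.indicator_apply, Set.mem_pi, Set.mem_univ, true_implies, Pi.one_apply]
        rw [prod_ite_zero]; simp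
      rw [this]
      exact lintegral_dirac' _ hΦ.1.ennreal_ofReal
    rw [h1, ENNReal.toReal_ofReal (hΦ.2.1 _)]
    refine le_trans (Ex_le hp0 hp1 fun S _ => ?_) (by linarith : Φ (fun _ => 1) ≤ _)
    have := hΦ.2.2.2 (fun _ => 1) (fun b => QQ S (τ b) (τ b)) (fun b => zero_le_one) (fun b => QQ_nonneg _ _)
    rwa [sum_eq_zero, mul_zero, add_zero] at this
    intro b _
    exact max_eq_right (sub_nonpos.2 (QQ_le_one _ _))
  | succ r ih =>
    have key : ∀ (a : ℕ) (B : Type) [Fintype B], Good d c (Sum.elim (fun _ : Fin a => mu d c (r + 1)) (fun _ : B => mu d c r)) := by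
      intro a
      induction a with
      | zero =>
        intro B _
        refine Good_equiv (Equiv.emptySum (Fin 0) B) (fun _ => mu d c r) (ih B) _ ?_
        rintro (x | b)
        · exact x.elim0
        · rfl
      | succ a iha =>
        intro B _
        haveI hprx : ∀ x : Fin a ⊕ B, IsProbabilityMeasure (Sum.elim (fun _ : Fin a => mu d c (r + 1)) (fun _ : B => mu d c r) x) := by
          rintro (x | x)
          · exact hpr _
          · exact hpr _
        haveI := hpr r
        have h := Good_step hc (Sum.elim (fun _ : Fin a => mu d c (r + 1)) (fun _ : B => mu d c r)) (mu d c r) (by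
          intro k
          haveI : ∀ x : Fin a ⊕ (B ⊕ Fin k × Fin d), IsProbabilityMeasure (Sum.elim (fun _ : Fin a => mu d c (r + 1)) (fun _ : B ⊕ Fin k × Fin d => mu d c r) x) := by
            rintro (x | x)
            · exact hpr _
            · exact hpr _
          refine Good_equiv (Equiv.sumAssoc (Fin a) B (Fin k × Fin d)) _ (iha (B ⊕ (Fin k × Fin d))) _ ?_
          rintro ((x | x) | x) <;> rfl)
        haveI : ∀ b : Option (Fin a ⊕ B), IsProbabilityMeasure (b.elim (TT d c (mu d c r)) (Sum.elim (fun _ : Fin a => mu d c (r + 1)) (fun _ : B => mu d c r))) := by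
          rintro (_ | x)
          · exact hpr (r + 1)
          · exact hprx x
        let e : Fin (a + 1) ⊕ B ≃ Option (Fin a ⊕ B) :=
          ((finSuccEquiv a).sumCongr (Equiv.refl B)).trans ((((Equiv.optionEquivSumPUnit.{0,0} (Fin a)).trans (Equiv.sumComm _ _)).sumCongr (Equiv.refl B)).trans
            ((Equiv.sumAssoc _ _ _).trans ((Equiv.sumComm _ _).trans (Equiv.optionEquivSumPUnit.{0,0} _).symm)))
        refine Good_equiv e _ h _ ?_
        rintro (x | b)
        · refine Fin.cases ?_ (fun i => ?_) x
          · simp [e]; rfl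
          · simp [e]
        · simp [e]
    intro B _
    haveI : ∀ x : Fin (Fintype.card B) ⊕ Empty, IsProbabilityMeasure (Sum.elim (fun _ : Fin (Fintype.card B) => mu d c (r + 1)) (fun _ : Empty => mu d c r) x) := by
      rintro (x | x)
      · exact hpr _
      · exact hpr _
    refine Good_equiv ((Fintype.equivFin B).trans (Equiv.sumEmpty _ Empty).symm) _ (key (Fintype.card B) Empty) _ fun b => ?_
    simp
end LP
end

noncomputable section
namespace LP

def lam : Measure ℝ := volume.restrict (Set.Ioo 0 1)

instance : IsProbabilityMeasure lam := ⟨by simp [lam]⟩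

def qf (μ : Measure ℝ) (s : ℝ) : ℝ := by
  classical exact if s ∈ Set.Ioo (0:ℝ) 1 then sInf {x | s ≤ ProbabilityTheory.cdf μ x} else 0

def Sup01 (μ : Measure ℝ) : Prop := μ (Set.Icc 0 1)ᶜ = 0

lemma cdf_neg {μ : Measure ℝ} [IsProbabilityMeasure μ] (h : Sup01 μ) {x : ℝ} (hx : x < 0) : ProbabilityTheory.cdf μ x = 0 := by
  have : μ (Set.Iic x) = 0 := measure_mono_null (t := (Set.Icc 0 1)ᶜ) (fun y hy hy' => absurd hy'.1 (not_le.2 (lt_of_le_of_lt hy hx))) h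
  rw [ProbabilityTheory.cdf_eq_real, Measure.real, this]; rfl

lemma cdf_one' {μ : Measure ℝ} [IsProbabilityMeasure μ] (h : Sup01 μ) : ProbabilityTheory.cdf μ 1 = 1 := by
  have : μ (Set.Iic 1)ᶜ = 0 := measure_mono_null (t := (Set.Icc 0 1)ᶜ) (fun y hy hy' => hy hy'.2) h
  rw [ProbabilityTheory.cdf_eq_real, Measure.real, (prob_compl_eq_zero_iff measurableSet_Iic).1 this]; rfl

lemma qf_bdd {μ : Measure ℝ} [IsProbabilityMeasure μ] (h : Sup01 μ) {s : ℝ} (hs : s ∈ Set.Ioo (0:ℝ) 1) :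
    (0:ℝ) ∈ lowerBounds {x | s ≤ ProbabilityTheory.cdf μ x} := by
  intro x hx
  by_contra hlt
  have := cdf_neg h (not_le.1 hlt)
  have h2 : s ≤ ProbabilityTheory.cdf μ x := hx
  linarith [hs.1]

lemma qf_le_iff {μ : Measure ℝ} [IsProbabilityMeasure μ] (h : Sup01 μ) {s : ℝ} (hs : s ∈ Set.Ioo (0:ℝ) 1) (x : ℝ) :
    qf μ s ≤ x ↔ s ≤ ProbabilityTheory.cdf μ x := by
  have hne : (1:ℝ) ∈ {x | s ≤ ProbabilityTheory.cdf μ x} := by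
    show s ≤ _; rw [cdf_one' h]; exact hs.2.le
  simp only [qf, if_pos hs]
  constructor
  · intro hq
    have hr := (ProbabilityTheory.cdf μ).right_continuous (sInf {x | s ≤ ProbabilityTheory.cdf μ x})
    refine le_trans ?_ (ProbabilityTheory.monotone_cdf μ hq)
    have hr2 := hr.tendsto.mono_left (nhdsWithin_mono _ Set.Ioi_subset_Ici_self)
    refine ge_of_tendsto hr2 ?_
    filter_upwards [self_mem_nhdsWithin] with y hy
    obtain ⟨a, ha, hay⟩ := exists_lt_of_csInf_lt ⟨1, hne⟩ hy
    exact le_trans ha (ProbabilityTheory.monotone_cdf μ hay.le)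
  · intro hx
    exact csInf_le ⟨0, qf_bdd h hs⟩ hx

lemma qf_mem {μ : Measure ℝ} [IsProbabilityMeasure μ] (h : Sup01 μ) (s : ℝ) : qf μ s ∈ Set.Icc (0:ℝ) 1 := by
  by_cases hs : s ∈ Set.Ioo (0:ℝ) 1
  · refine ⟨?_, (qf_le_iff h hs 1).2 (by rw [cdf_one' h]; exact hs.2.le)⟩
    simp only [qf, if_pos hs]
    exact le_csInf ⟨1, by show s ≤ _; rw [cdf_one' h]; exact hs.2.le⟩ (qf_bdd h hs)
  · simp only [qf, if_neg hs]; simp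

lemma qf_meas {μ : Measure ℝ} [IsProbabilityMeasure μ] (h : Sup01 μ) : Measurable (qf μ) := by
  refine measurable_of_Iic fun x => ?_
  have : qf μ ⁻¹' Set.Iic x = (Set.Ioo 0 1 ∩ Set.Iic (ProbabilityTheory.cdf μ x)) ∪ ((Set.Ioo 0 1)ᶜ ∩ {s : ℝ | 0 ≤ x}) := by
    ext s
    by_cases hs : s ∈ Set.Ioo (0:ℝ) 1
    · simp only [Set.mem_preimage, Set.mem_Iic, qf_le_iff h hs, Set.mem_union, Set.mem_inter_iff, hs, Set.mem_compl_iff]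
      simp
    · simp only [Set.mem_preimage, Set.mem_Iic, Set.mem_union, Set.mem_inter_iff, Set.mem_compl_iff, hs]
      simp only [qf, if_neg hs]; simp
  rw [this]
  exact (measurableSet_Ioo.inter measurableSet_Iic).union (measurableSet_Ioo.compl.inter (MeasurableSet.const _))

lemma qf_map {μ : Measure ℝ} [IsProbabilityMeasure μ] (h : Sup01 μ) : lam.map (qf μ) = μ := by
  haveI : IsProbabilityMeasure (lam.map (qf μ)) := Measure.isProbabilityMeasure_map (qf_meas h).aemeasurable
  refine Measure.ext_of_Iic _ _ fun x => ?_
  rw [Measure.map_apply (qf_meas h) measurableSet_Iic, lam, Measure.restrict_apply (qf_meas h measurableSet_Iic), ← ProbabilityTheory.ofReal_cdf]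
  have h1 : qf μ ⁻¹' Set.Iic x ∩ Set.Ioo 0 1 = Set.Iic (ProbabilityTheory.cdf μ x) ∩ Set.Ioo 0 1 := by
    ext s
    by_cases hs : s ∈ Set.Ioo (0:ℝ) 1
    · simp [qf_le_iff h hs]
    · simp [hs]
  rw [h1]
  refine le_antisymm ?_ ?_
  · refine (measure_mono (t := Set.Ioc 0 (ProbabilityTheory.cdf μ x)) ?_).trans ?_
    · exact fun s hs => ⟨hs.2.1, hs.1⟩
    · rw [Real.volume_Ioc, sub_zero]
  · refine le_trans ?_ (measure_mono (s := Set.Ioo 0 (ProbabilityTheory.cdf μ x)) ?_)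
    · rw [Real.volume_Ioo, sub_zero]
    · exact fun s hs => ⟨hs.2.le, hs.1, lt_of_lt_of_le hs.2 (ProbabilityTheory.cdf_le_one _ _)⟩

def SO (μ ν : Measure ℝ) : Prop := ∀ x, μ (Set.Ioi x) ≤ ν (Set.Ioi x)

lemma qf_mono {μ ν : Measure ℝ} [IsProbabilityMeasure μ] [IsProbabilityMeasure ν] (hμ : Sup01 μ) (hν : Sup01 ν) (h : SO μ ν) (s : ℝ) :
    qf μ s ≤ qf ν s := by
  by_cases hs : s ∈ Set.Ioo (0:ℝ) 1
  · rw [qf_le_iff hμ hs]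
    refine ((qf_le_iff hν hs _).1 le_rfl).trans ?_
    rw [ProbabilityTheory.cdf_eq_real, ProbabilityTheory.cdf_eq_real]
    have := h (qf ν s)
    have e : ∀ ρ : Measure ℝ, IsProbabilityMeasure ρ → ρ.real (Set.Iic (qf ν s)) = 1 - (ρ (Set.Ioi (qf ν s))).toReal := by
      intro ρ _
      have := probReal_compl_eq_one_sub (μ := ρ) (measurableSet_Ioi (a := qf ν s))
      rwa [Set.compl_Ioi] at this
    rw [e μ inferInstance, e ν inferInstance]
    have := ENNReal.toReal_mono (measure_ne_top _ _) this
    linarith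
  · simp only [qf, if_neg hs]; exact le_rfl

lemma pi_map_lam {B : Type} [Fintype B] {u : ℝ → ℝ} (hu : Measurable u) :
    Measure.pi (fun _ : B => lam.map u) = (Measure.pi fun _ : B => lam).map fun s b => u (s b) := by
  haveI : IsProbabilityMeasure (lam.map u) := Measure.isProbabilityMeasure_map hu.aemeasurable
  exact (Measure.pi_map_pi (fun _ => hu.aemeasurable)).symm

lemma lint_TT_map (d : ℕ) (c : ℝ) {u : ℝ → ℝ} (hu : Measurable u) {f : ℝ → ENNReal} (hf : Measurable f) :
    ∫⁻ x, f x ∂(TT d c (lam.map u)) = ∑' k, ENNReal.ofReal (pk c k) *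
      ∫⁻ s, f (sumF fun b => u (s b)) ∂(Measure.pi fun _ : Fin k × Fin d => lam) := by
  rw [lint_TT d c _ hf]
  refine tsum_congr fun k => ?_
  rw [pi_map_lam hu, lintegral_map (f := fun y => f (sumF y)) (hf.comp measurable_sumF) (by fun_prop)]

lemma sumF_mono {k d : ℕ} {x y : Fin k × Fin d → ℝ} (hy : ∀ i, 0 ≤ y i) (h : ∀ i, y i ≤ x i) : sumF y ≤ sumF x := by
  refine (sumF_lip x y (fun i => (hy i).trans (h i)) hy).trans ?_
  rw [sum_eq_zero, add_zero]
  exact fun i _ => max_eq_right (sub_nonpos.2 (h i))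

lemma Sup01_TT (d : ℕ) {c : ℝ} (μ : Measure ℝ) : Sup01 (TT d c μ) := by
  unfold Sup01
  rw [← lintegral_indicator_one measurableSet_Icc.compl, lint_TT d c μ (measurable_one.indicator measurableSet_Icc.compl)]
  rw [ENNReal.tsum_eq_zero]
  intro k
  have : ∀ y : Fin k × Fin d → ℝ, (Set.Icc (0:ℝ) 1)ᶜ.indicator (1 : ℝ → ENNReal) (sumF y) = 0 := by
    intro y
    refine Set.indicator_of_notMem ?_ _
    simp only [Set.mem_compl_iff, not_not]
    exact ⟨FF_nonneg _, FF_le_one _⟩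
  simp [this]

lemma Sup01_mu (d : ℕ) (c : ℝ) (r : ℕ) : Sup01 (mu d c r) := by
  cases r with
  | zero => simp [mu, Sup01]
  | succ r => exact Sup01_TT d _

lemma SO_TT (d : ℕ) {c : ℝ} {μ ν : Measure ℝ} [IsProbabilityMeasure μ] [IsProbabilityMeasure ν] (hμ : Sup01 μ) (hν : Sup01 ν) (h : SO μ ν) :
    SO (TT d c μ) (TT d c ν) := by
  intro x
  rw [← lintegral_indicator_one measurableSet_Ioi, ← lintegral_indicator_one measurableSet_Ioi, ← qf_map hμ, ← qf_map hν,
    lint_TT_map d c (qf_meas hμ) (measurable_one.indicator measurableSet_Ioi), lint_TT_map d c (qf_meas hν) (measurable_one.indicator measurableSet_Ioi)]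
  refine ENNReal.tsum_le_tsum fun k => mul_le_mul_right (lintegral_mono fun s => ?_) _
  have := sumF_mono (fun b => (qf_mem hμ (s b)).1) (fun b : Fin k × Fin d => qf_mono hμ hν h (s b))
  simp only [Set.indicator_apply, Set.mem_Ioi]
  split_ifs with h1 h2
  · exact le_rfl
  · exact absurd (h1.trans_le this) h2
  · exact zero_le
  · exact le_rfl

lemma SO_mu (d : ℕ) {c : ℝ} (hc : 0 < c) (r : ℕ) : SO (mu d c (r + 1)) (mu d c r) := by
  have hp := mu_prob d hc
  induction r with
  | zero =>
    intro x
    rcases lt_or_ge x 1 with hx | hx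
    · have : mu d c 0 (Set.Ioi x) = 1 := by simp [mu, hx]
      rw [this]; haveI := hp 1; exact prob_le_one
    · have : mu d c 1 (Set.Ioi x) = 0 := measure_mono_null (t := (Set.Icc 0 1)ᶜ) (fun y hy hy' => absurd hy'.2 (not_le.2 (lt_of_le_of_lt hx hy))) (Sup01_mu d c 1)
      rw [this]; exact zero_le
  | succ r ih =>
    haveI := hp r; haveI := hp (r + 1)
    exact SO_TT d (Sup01_mu d c _) (Sup01_mu d c _) ih

def ur (d : ℕ) (c : ℝ) (r : ℕ) : ℝ → ℝ := qf (mu d c r)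

def ui (d : ℕ) (c : ℝ) (s : ℝ) : ℝ := ⨅ r, ur d c r s

def mui (d : ℕ) (c : ℝ) : Measure ℝ := lam.map (ui d c)


lemma ur_mem (d : ℕ) {c : ℝ} (hc : 0 < c) (r : ℕ) (s : ℝ) : ur d c r s ∈ Set.Icc (0:ℝ) 1 := by
  haveI := mu_prob d hc r
  exact qf_mem (Sup01_mu d c r) s

lemma ur_meas (d : ℕ) {c : ℝ} (hc : 0 < c) (r : ℕ) : Measurable (ur d c r) := by
  haveI := mu_prob d hc r
  exact qf_meas (Sup01_mu d c r)

lemma ur_tendsto (d : ℕ) {c : ℝ} (hc : 0 < c) (s : ℝ) : Tendsto (fun r => ur d c r s) atTop (nhds (ui d c s)) := by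
  have hp := mu_prob d hc
  refine tendsto_atTop_ciInf (antitone_nat_of_succ_le fun r => ?_) ⟨0, ?_⟩
  · haveI := hp r; haveI := hp (r + 1)
    exact qf_mono (Sup01_mu d c _) (Sup01_mu d c _) (SO_mu d hc r) s
  · rintro _ ⟨r, rfl⟩; exact (ur_mem d hc r s).1

lemma ui_mem (d : ℕ) {c : ℝ} (hc : 0 < c) (s : ℝ) : ui d c s ∈ Set.Icc (0:ℝ) 1 :=
  isClosed_Icc.mem_of_tendsto (ur_tendsto d hc s) (Eventually.of_forall fun r => ur_mem d hc r s)

lemma ui_meas (d : ℕ) {c : ℝ} (hc : 0 < c) : Measurable (ui d c) :=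
  measurable_of_tendsto_metrizable (fun r => ur_meas d hc r) (tendsto_pi_nhds.2 fun s => ur_tendsto d hc s)

lemma mu_eq (d : ℕ) {c : ℝ} (hc : 0 < c) (r : ℕ) : lam.map (ur d c r) = mu d c r := by
  haveI := mu_prob d hc r
  exact qf_map (Sup01_mu d c r)

lemma mui_prob (d : ℕ) {c : ℝ} (hc : 0 < c) : IsProbabilityMeasure (mui d c) := Measure.isProbabilityMeasure_map (ui_meas d hc).aemeasurable

lemma Sup01_mui (d : ℕ) {c : ℝ} (hc : 0 < c) : Sup01 (mui d c) := by
  unfold Sup01 mui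
  rw [Measure.map_apply (ui_meas d hc) measurableSet_Icc.compl]
  convert measure_empty (μ := lam)
  ext s; simpa using ui_mem d hc s

lemma mu_lim (d : ℕ) {c : ℝ} (hc : 0 < c) {f : ℝ → ENNReal} (hf : Continuous f) {C : ENNReal} (hC : C ≠ ⊤) (h : ∀ x, f x ≤ C) :
    Tendsto (fun r => ∫⁻ x, f x ∂(mu d c r)) atTop (nhds (∫⁻ x, f x ∂(mui d c))) := by
  have e1 : ∀ r, ∫⁻ x, f x ∂(mu d c r) = ∫⁻ s, f (ur d c r s) ∂lam := fun r => by
    rw [← mu_eq d hc r, lintegral_map hf.measurable (ur_meas d hc r)]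
  simp only [e1, mui]
  rw [lintegral_map hf.measurable (ui_meas d hc)]
  refine tendsto_lintegral_of_dominated_convergence (fun _ => C) (fun r => hf.measurable.comp (ur_meas d hc r)) (fun r => Eventually.of_forall fun s => h _) (by simpa using hC) ?_
  exact Eventually.of_forall fun s => (hf.tendsto _).comp (ur_tendsto d hc s)

lemma sumF_tendsto (d : ℕ) {c : ℝ} (hc : 0 < c) {k : ℕ} (s : Fin k × Fin d → ℝ) :
    Tendsto (fun r => sumF fun b => ur d c r (s b)) atTop (nhds (sumF fun b => ui d c (s b))) := by
  have h1 : Tendsto (fun r => ∑ b, |ur d c r (s b) - ui d c (s b)|) atTop (nhds 0) := by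
    have : Tendsto (fun r => ∑ b, |ur d c r (s b) - ui d c (s b)|) atTop (nhds (∑ b, |ui d c (s b) - ui d c (s b)|)) :=
      tendsto_finset_sum _ fun b _ => ((ur_tendsto d hc (s b)).sub_const _).abs
    simpa using this
  rw [tendsto_iff_dist_tendsto_zero]
  refine squeeze_zero (fun _ => dist_nonneg) (fun r => ?_) h1
  rw [Real.dist_eq, abs_sub_le_iff]
  have hu := fun b => (ur_mem d hc r (s b)).1
  have hi := fun b => (ui_mem d hc (s b)).1
  have a1 := sumF_lip (fun b => ui d c (s b)) (fun b => ur d c r (s b)) hi hu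
  have a2 := sumF_lip (fun b => ur d c r (s b)) (fun b => ui d c (s b)) hu hi
  constructor
  · have := sum_le_sum (s := univ) fun b _ => max_le (le_abs_self (ur d c r (s b) - ui d c (s b))) (abs_nonneg (ur d c r (s b) - ui d c (s b)))
    linarith
  · have := sum_le_sum (s := univ) fun b _ => max_le (show ui d c (s b) - ur d c r (s b) ≤ |ur d c r (s b) - ui d c (s b)| by rw [abs_sub_comm]; exact le_abs_self _) (abs_nonneg (ur d c r (s b) - ui d c (s b)))
    linarith

lemma TT_mui (d : ℕ) {c : ℝ} (hc : 0 < c) : TT d c (mui d c) = mui d c := by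
  haveI := mui_prob d hc
  haveI := TT_prob d hc (mui d c)
  refine ext_of_forall_lintegral_eq_of_IsFiniteMeasure fun f => ?_
  have hf : Continuous fun x => (f x : ENNReal) := ENNReal.continuous_coe.comp f.continuous
  obtain ⟨C, hC⟩ : ∃ C : NNReal, ∀ x, f x ≤ C := by
    obtain ⟨C, hC⟩ := f.isBounded_range.bddAbove
    exact ⟨C, fun x => hC ⟨x, rfl⟩⟩
  have hC' : ∀ x, (f x : ENNReal) ≤ C := fun x => ENNReal.coe_le_coe.2 (hC x)
  have h1 := (mu_lim d hc hf ENNReal.coe_ne_top hC').comp (tendsto_add_atTop_nat 1)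
  refine tendsto_nhds_unique ?_ h1
  have e : ∀ r, ((fun r => ∫⁻ x, f x ∂(mu d c r)) ∘ fun a => a + 1) r = ∑' k, ENNReal.ofReal (pk c k) *
      ∫⁻ s, f (sumF fun b => ur d c r (s b)) ∂(Measure.pi fun _ : Fin k × Fin d => lam) := by
    intro r
    show ∫⁻ x, f x ∂(TT d c (mu d c r)) = _
    rw [← mu_eq d hc r]
    exact lint_TT_map d c (ur_meas d hc r) hf.measurable
  rw [funext e, mui, lint_TT_map d c (ui_meas d hc) hf.measurable]
  simp only [← lintegral_count]
  have hb : ∀ k (g : (Fin k × Fin d → ℝ) → ℝ), ∫⁻ s, (f (g s) : ENNReal) ∂(Measure.pi fun _ : Fin k × Fin d => lam) ≤ C := by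
    intro k g
    calc _ ≤ ∫⁻ s, (C:ENNReal) ∂(Measure.pi fun _ : Fin k × Fin d => lam) := lintegral_mono fun s => hC' _
      _ = C := by simp
  refine tendsto_lintegral_of_dominated_convergence (fun k => ENNReal.ofReal (pk c k) * C) (fun r => measurable_of_countable _)
    (fun r => Eventually.of_forall fun k => mul_le_mul_right (hb k _) _) ?_ (Eventually.of_forall fun k => ?_)
  · rw [lintegral_count, ENNReal.tsum_mul_right, ← ENNReal.ofReal_tsum_of_nonneg (pk_nonneg hc) (pk_sum hc).summable]
    exact ENNReal.mul_ne_top ENNReal.ofReal_ne_top ENNReal.coe_ne_top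
  · refine ENNReal.Tendsto.const_mul ?_ (Or.inr ENNReal.ofReal_ne_top)
    refine tendsto_lintegral_of_dominated_convergence (fun _ => C) (fun r => hf.measurable.comp (measurable_sumF.comp ?_)) (fun r => Eventually.of_forall fun s => hC' _) (by simp) ?_
    · have := ur_meas d hc r; fun_prop
    · exact Eventually.of_forall fun s => (hf.tendsto _).comp (sumF_tendsto d hc s)

end LP
end

noncomputable section
namespace LP

lemma ae_pi_nonneg {B : Type} [Fintype B] {μ : Measure ℝ} [IsProbabilityMeasure μ] (h : Sup01 μ) :
    ∀ᵐ y ∂(Measure.pi fun _ : B => μ), ∀ b, 0 ≤ y b := by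
  have h0 : ∀ᵐ x ∂μ, 0 ≤ x := by
    refine measure_mono_null (t := (Set.Icc 0 1)ᶜ) (fun x hx hx' => hx hx'.1) h
  exact eventually_all.2 fun b => Measure.tendsto_eval_ae_ae.eventually h0

def rowE (d k : ℕ) (i : Fin (k + 1)) : Fin d ⊕ Fin k × Fin d ≃ Fin (k + 1) × Fin d where
  toFun x := Sum.elim (fun j => (i, j)) (fun z => (i.succAbove z.1, z.2)) x
  invFun z := (finSuccEquiv' i z.1).elim (Sum.inl z.2) (fun l => Sum.inr (l, z.2))
  left_inv := by rintro (j | ⟨l, j⟩) <;> simp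
  right_inv := by
    rintro ⟨l, j⟩
    rcases Fin.eq_self_or_eq_succAbove i l with h | ⟨l', rfl⟩
    · subst h; simp
    · simp

lemma lint_row {d k : ℕ} (i : Fin (k + 1)) (μ : Measure ℝ) [IsProbabilityMeasure μ] {f : (Fin (k + 1) × Fin d → ℝ) → ENNReal} (hf : Measurable f) :
    ∫⁻ y, f y ∂(Measure.pi fun _ => μ) = ∫⁻ z, ∫⁻ y, f (fun x => Sum.elim z y ((rowE d k i).symm x)) ∂(Measure.pi fun _ => μ) ∂(Measure.pi fun _ => μ) := by
  rw [lint_equiv (rowE d k i) (fun _ => μ) hf]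
  exact lint_sum (fun _ => μ) (f := fun y => f fun b => y ((rowE d k i).symm b)) (hf.comp (by fun_prop))

def hh (x σ : ℝ) : ℝ := by classical exact if 0 < σ then x / (x + σ) else 0

lemma hh_meas : Measurable fun z : ℝ × ℝ => hh z.1 z.2 := by
  unfold hh
  exact Measurable.ite (measurableSet_lt measurable_const measurable_snd) (by fun_prop) measurable_const

lemma hh_nonneg {x σ : ℝ} (hx : 0 ≤ x) : 0 ≤ hh x σ := by
  unfold hh; split_ifs with h <;> positivity

lemma FF_split {k : ℕ} (s : Fin (k + 1) → ℝ) (h : ∀ i, 0 ≤ s i) :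
    (if ∀ i, 0 < s i then (1:ℝ) else 0) = FF s + ∑ i, hh (FF fun l => s (i.succAbove l)) (s i) := by
  classical
  by_cases hp : ∀ i, 0 < s i
  · rw [if_pos hp]
    have hF : FF s = (1 + ∑ i, (s i)⁻¹)⁻¹ := by simp only [FF, if_pos hp]
    have hS : 0 ≤ ∑ i, (s i)⁻¹ := sum_nonneg fun i _ => (inv_pos.2 (hp i)).le
    have : ∀ i, hh (FF fun l => s (i.succAbove l)) (s i) = (s i)⁻¹ * (1 + ∑ i, (s i)⁻¹)⁻¹ := by
      intro i
      have hp' : ∀ l, 0 < s (i.succAbove l) := fun l => hp _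
      have hS' : 0 ≤ ∑ l, (s (i.succAbove l))⁻¹ := sum_nonneg fun l _ => (inv_pos.2 (hp' l)).le
      have hi := hp i
      simp only [hh, if_pos hi, FF, if_pos hp']
      rw [Fin.sum_univ_succAbove _ i]
      generalize ∑ l, (s (i.succAbove l))⁻¹ = A at *
      have : 0 < 1 + A := by linarith
      have h3 : 0 < 1 + ((s i)⁻¹ + A) := by have := inv_pos.2 hi; linarith
      field_simp
      ring
    rw [sum_congr rfl fun i _ => this i, ← sum_mul, hF, ← one_add_mul, mul_inv_cancel₀ (by positivity)]
  · rw [if_neg hp]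
    have hF : FF s = 0 := by simp only [FF, if_neg hp]
    rw [hF, zero_add]
    symm
    refine sum_eq_zero fun i _ => ?_
    by_cases hi : 0 < s i
    · have : ¬ ∀ l, 0 < s (i.succAbove l) := by
        intro hl; apply hp; intro j
        rcases Fin.eq_self_or_eq_succAbove i j with rfl | ⟨l, rfl⟩
        · exact hi
        · exact hl l
      simp [hh, hi, FF, this]
    · simp [hh, hi]

section
variable {d : ℕ} {c : ℝ} {μ : Measure ℝ} [IsProbabilityMeasure μ]

lemma FF_pos_iff {k : ℕ} (s : Fin k → ℝ) : 0 < FF s ↔ ∀ i, 0 < s i := by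
  classical
  unfold FF
  split_ifs with h
  · have : 0 ≤ ∑ i, (s i)⁻¹ := sum_nonneg fun i _ => (inv_pos.2 (h i)).le
    simp only [h]; simp; positivity
  · simp [h]

lemma pos_sum {B : Type} [Fintype B] (hμ : Sup01 μ) :
    ∫⁻ z, (Set.Ioi (0:ℝ)).indicator 1 (∑ j, z j) ∂(Measure.pi fun _ : B => μ) = 1 - (1 - μ (Set.Ioi 0)) ^ Fintype.card B := by
  classical
  have hm : MeasurableSet {z : B → ℝ | 0 < ∑ j, z j} := measurableSet_lt measurable_const (by fun_prop)
  have h1 : ∫⁻ z, (Set.Ioi (0:ℝ)).indicator 1 (∑ j, z j) ∂(Measure.pi fun _ : B => μ) = (Measure.pi fun _ : B => μ) {z : B → ℝ | 0 < ∑ j, z j} := by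
    rw [← lintegral_indicator_one hm]
    rfl
  have h2 : {z : B → ℝ | 0 < ∑ j, z j} =ᵐ[Measure.pi fun _ : B => μ] ((Set.univ.pi fun _ : B => (Set.Ioi (0:ℝ))ᶜ)ᶜ : Set (B → ℝ)) := by
    filter_upwards [ae_pi_nonneg (B := B) hμ] with z hz
    apply propext
    show 0 < ∑ j, z j ↔ ¬ z ∈ (Set.univ.pi fun _ : B => (Set.Ioi (0:ℝ))ᶜ)
    rw [sum_pos_iff_of_nonneg fun i _ => hz i]
    simp only [Set.mem_pi, Set.mem_univ, true_implies, Set.mem_compl_iff, Set.mem_Ioi, not_forall, not_not, mem_univ, true_and]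
  rw [h1, measure_congr h2, prob_compl_eq_one_sub (MeasurableSet.univ_pi fun _ => measurableSet_Ioi.compl), Measure.pi_pi]
  rw [prob_compl_eq_one_sub measurableSet_Ioi, prod_const, card_univ]

lemma rows_elim {k : ℕ} (i : Fin (k + 1)) (z : Fin d → ℝ) (y : Fin k × Fin d → ℝ) (l : Fin k) :
    ∑ j, Sum.elim z y ((rowE d k i).symm (i, j)) = ∑ j, z j ∧ ∑ j, Sum.elim z y ((rowE d k i).symm (i.succAbove l, j)) = ∑ j, y (l, j) := by
  constructor
  · refine sum_congr rfl fun j _ => ?_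
    rw [show (i, j) = rowE d k i (Sum.inl j) from rfl, Equiv.symm_apply_apply]; rfl
  · refine sum_congr rfl fun j _ => ?_
    rw [show (i.succAbove l, j) = rowE d k i (Sum.inr (l, j)) from rfl, Equiv.symm_apply_apply]; rfl

lemma rows_elim0 {k : ℕ} (i : Fin (k + 1)) (z : Fin d → ℝ) (y : Fin k × Fin d → ℝ) :
    ∑ j, Sum.elim z y ((rowE d k i).symm (i, j)) = ∑ j, z j := by
  refine sum_congr rfl fun j _ => ?_
  rw [show (i, j) = rowE d k i (Sum.inl j) from rfl, Equiv.symm_apply_apply]; rfl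

lemma swap_hh {C D : Type} [MeasurableSpace C] [MeasurableSpace D] (ρ : Measure C) [SFinite ρ] (ρ' : Measure D) [SFinite ρ'] {a : C → ℝ} {b : D → ℝ} (ha : Measurable a) (hb : Measurable b) :
    ∫⁻ z, ∫⁻ y, ENNReal.ofReal (hh (b y) (a z)) ∂ρ' ∂ρ = ∫⁻ y, ∫⁻ z, ENNReal.ofReal (hh (b y) (a z)) ∂ρ ∂ρ' := by
  refine lintegral_lintegral_swap (Measurable.aemeasurable ?_)
  exact ENNReal.measurable_ofReal.comp (hh_meas.comp ((hb.comp measurable_snd).prodMk (ha.comp measurable_fst)))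

lemma pos_rows (hμ : Sup01 μ) (k : ℕ) :
    ∫⁻ y, (Set.Ioi (0:ℝ)).indicator 1 (sumF y) ∂(Measure.pi fun _ : Fin k × Fin d => μ) = (1 - (1 - μ (Set.Ioi 0)) ^ d) ^ k := by
  induction k with
  | zero => simp [sumF, FF]
  | succ k ih =>
    rw [lint_row 0 μ (f := fun y => (Set.Ioi (0:ℝ)).indicator 1 (sumF y)) ((measurable_one.indicator measurableSet_Ioi).comp measurable_sumF)]
    have h1 : ∀ (z : Fin d → ℝ) (y : Fin k × Fin d → ℝ), (Set.Ioi (0:ℝ)).indicator (1 : ℝ → ENNReal) (sumF fun x => Sum.elim z y ((rowE d k 0).symm x)) =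
        (Set.Ioi (0:ℝ)).indicator 1 (∑ j, z j) * (Set.Ioi (0:ℝ)).indicator 1 (sumF y) := by
      intro z y
      have : 0 < sumF (fun x => Sum.elim z y ((rowE d k 0).symm x)) ↔ 0 < ∑ j, z j ∧ 0 < sumF y := by
        unfold sumF
        rw [FF_pos_iff, FF_pos_iff, Fin.forall_fin_succ]
        have := fun l => (rows_elim 0 z y l).2
        simp only [Fin.succAbove_zero] at this
        simp only [this]
        rw [and_congr_left_iff]
        intro _
        have : ∑ j, Sum.elim z y ((rowE d k 0).symm (0, j)) = ∑ j, z j := by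
          refine sum_congr rfl fun j _ => ?_
          rw [show ((0 : Fin (k+1)), j) = rowE d k 0 (Sum.inl j) from rfl, Equiv.symm_apply_apply]; rfl
        rw [this]
      simp only [Set.indicator_apply, Set.mem_Ioi, this, Pi.one_apply]
      by_cases a : 0 < ∑ j, z j <;> by_cases b : 0 < sumF y <;> simp [a, b]
    simp only [h1]
    have hmz : Measurable fun z : Fin d → ℝ => (Set.Ioi (0:ℝ)).indicator (1 : ℝ → ENNReal) (∑ j, z j) := (measurable_one.indicator measurableSet_Ioi).comp (by fun_prop)
    have hmy : Measurable fun y : Fin k × Fin d → ℝ => (Set.Ioi (0:ℝ)).indicator (1 : ℝ → ENNReal) (sumF y) := (measurable_one.indicator measurableSet_Ioi).comp measurable_sumF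
    simp only [lintegral_const_mul _ hmy, ih]
    rw [lintegral_mul_const _ hmz, pos_sum hμ, Fintype.card_fin, pow_succ']

lemma t_eq (hc : 0 < c) (hμ : Sup01 μ) (hT : TT d c μ = μ) :
    (μ (Set.Ioi 0)).toReal = Real.exp (-c * (1 - (μ (Set.Ioi 0)).toReal) ^ d) := by
  have h := lint_TT d c μ (f := (Set.Ioi (0:ℝ)).indicator 1) (measurable_one.indicator measurableSet_Ioi)
  rw [hT, lintegral_indicator_one measurableSet_Ioi] at h
  simp only [pos_rows hμ] at h
  have ht1 : μ (Set.Ioi 0) ≤ 1 := prob_le_one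
  obtain ⟨t, ht0, ht⟩ : ∃ t : ℝ, 0 ≤ t ∧ μ (Set.Ioi 0) = ENNReal.ofReal t :=
    ⟨_, ENNReal.toReal_nonneg, (ENNReal.ofReal_toReal (measure_ne_top _ _)).symm⟩
  rw [ht] at h ht1 ⊢
  rw [ENNReal.toReal_ofReal ht0]
  have ht1 : t ≤ 1 := by rwa [← ENNReal.ofReal_one, ENNReal.ofReal_le_ofReal_iff zero_le_one] at ht1
  have hq : (0:ℝ) ≤ 1 - (1 - t) ^ d := sub_nonneg.2 (pow_le_one₀ (by linarith) (by linarith))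
  have e : ∀ k, ENNReal.ofReal (pk c k) * (1 - (1 - ENNReal.ofReal t) ^ d) ^ k = ENNReal.ofReal (pk c k * (1 - (1 - t) ^ d) ^ k) := by
    intro k
    rw [← ENNReal.ofReal_one, ← ENNReal.ofReal_sub _ ht0, ← ENNReal.ofReal_pow (by linarith), ← ENNReal.ofReal_sub _ (by positivity), ← ENNReal.ofReal_pow hq,
      ← ENNReal.ofReal_mul (pk_nonneg hc k)]
  simp only [e] at h
  have hs : HasSum (fun k => pk c k * (1 - (1 - t) ^ d) ^ k) (Real.exp (-c) * Real.exp (c * (1 - (1 - t) ^ d))) := by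
    have := (NormedSpace.expSeries_div_hasSum_exp (𝔸 := ℝ) (c * (1 - (1 - t) ^ d))).mul_left (Real.exp (-c))
    rw [← Real.exp_eq_exp_ℝ] at this
    refine (funext fun k => ?_ : (fun k => pk c k * (1 - (1 - t) ^ d) ^ k) = _) ▸ this
    unfold pk; rw [mul_pow]; ring
  rw [← ENNReal.ofReal_tsum_of_nonneg (fun k => mul_nonneg (pk_nonneg hc k) (pow_nonneg hq k)) hs.summable, hs.tsum_eq,
    ENNReal.ofReal_eq_ofReal_iff ht0 (by positivity), ← Real.exp_add] at h
  rw [h]; congr 1; rw [← h]; ring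

lemma m_eq1 (hc : 0 < c) (hμ : Sup01 μ) (hT : TT d c μ = μ) :
    μ (Set.Ioi 0) = ∫⁻ x, ENNReal.ofReal x ∂μ + ENNReal.ofReal c * ∫⁻ x, ∫⁻ z, ENNReal.ofReal (hh x (∑ j, z j)) ∂(Measure.pi fun _ : Fin d => μ) ∂μ := by
  have h := lint_TT d c μ (f := (Set.Ioi (0:ℝ)).indicator 1) (measurable_one.indicator measurableSet_Ioi)
  rw [hT, lintegral_indicator_one measurableSet_Ioi] at h
  have hx := lint_TT d c μ (f := fun x => ENNReal.ofReal x) ENNReal.measurable_ofReal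
  rw [hT] at hx
  have hmJ : Measurable fun z : ℝ × (Fin d → ℝ) => ENNReal.ofReal (hh z.1 (∑ j, z.2 j)) :=
    ENNReal.measurable_ofReal.comp (hh_meas.comp (by fun_prop : Measurable fun z : ℝ × (Fin d → ℝ) => (z.1, ∑ j, z.2 j)))
  have hJ := lint_TT d c μ (f := fun x => ∫⁻ z, ENNReal.ofReal (hh x (∑ j, z j)) ∂(Measure.pi fun _ : Fin d => μ)) hmJ.lintegral_prod_right'
  rw [hT] at hJ
  have key : ∀ k, ∫⁻ y, (Set.Ioi (0:ℝ)).indicator 1 (sumF y) ∂(Measure.pi fun _ : Fin (k + 1) × Fin d => μ) =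
      ∫⁻ y, ENNReal.ofReal (sumF y) ∂(Measure.pi fun _ : Fin (k + 1) × Fin d => μ) +
      (k + 1 : ℕ) * ∫⁻ y, ∫⁻ z, ENNReal.ofReal (hh (sumF y) (∑ j, z j)) ∂(Measure.pi fun _ : Fin d => μ) ∂(Measure.pi fun _ : Fin k × Fin d => μ) := by
    intro k
    have hmi : ∀ i : Fin (k + 1), Measurable fun y : Fin (k + 1) × Fin d → ℝ => ENNReal.ofReal (hh (FF fun l => ∑ j, y (i.succAbove l, j)) (∑ j, y (i, j))) := by
      intro i
      refine ENNReal.measurable_ofReal.comp (hh_meas.comp (Measurable.prodMk (f := fun y : Fin (k + 1) × Fin d → ℝ => FF fun l => ∑ j, y (i.succAbove l, j)) (g := fun y => ∑ j, y (i, j)) (measurable_FF.comp (by fun_prop)) (by fun_prop)))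
    have e1 : ∫⁻ y, (Set.Ioi (0:ℝ)).indicator 1 (sumF y) ∂(Measure.pi fun _ : Fin (k + 1) × Fin d => μ) =
        ∫⁻ y, (ENNReal.ofReal (sumF y) + ∑ i : Fin (k + 1), ENNReal.ofReal (hh (FF fun l => ∑ j, y (i.succAbove l, j)) (∑ j, y (i, j)))) ∂(Measure.pi fun _ : Fin (k + 1) × Fin d => μ) := by
      refine lintegral_congr_ae ?_
      filter_upwards [ae_pi_nonneg (B := Fin (k + 1) × Fin d) hμ] with y hy
      have := FF_split (fun i => ∑ j, y (i, j)) (fun i => sum_nonneg fun j _ => hy _)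
      rw [← ENNReal.ofReal_sum_of_nonneg (fun i _ => hh_nonneg (FF_nonneg _)), sumF, ← ENNReal.ofReal_add (FF_nonneg _) (sum_nonneg fun i _ => hh_nonneg (FF_nonneg _)), ← this]
      simp only [Set.indicator_apply, Set.mem_Ioi, FF_pos_iff]
      split_ifs <;> simp
    rw [e1, lintegral_add_left (f := fun y => ENNReal.ofReal (sumF y)) (ENNReal.measurable_ofReal.comp measurable_sumF), lintegral_finsetSum _ fun i _ => hmi i]
    congr 1
    have e2 : ∀ i : Fin (k + 1), ∫⁻ y, ENNReal.ofReal (hh (FF fun l => ∑ j, y (i.succAbove l, j)) (∑ j, y (i, j))) ∂(Measure.pi fun _ : Fin (k + 1) × Fin d => μ) =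
        ∫⁻ y, ∫⁻ z, ENNReal.ofReal (hh (sumF y) (∑ j, z j)) ∂(Measure.pi fun _ : Fin d => μ) ∂(Measure.pi fun _ : Fin k × Fin d => μ) := by
      intro i
      rw [lint_row i μ (hmi i)]
      refine Eq.trans ?_ (swap_hh (Measure.pi fun _ : Fin d => μ) (Measure.pi fun _ : Fin k × Fin d => μ) (a := fun z => ∑ j, z j) (b := sumF) (by fun_prop) measurable_sumF)
      refine lintegral_congr fun z => lintegral_congr fun y => ?_
      have r1 := rows_elim0 i z y
      have r2 : (fun l => ∑ j, Sum.elim z y ((rowE d k i).symm (i.succAbove l, j))) = fun l => ∑ j, y (l, j) := funext fun l => (rows_elim i z y l).2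
      rw [r1, r2]; rfl
    rw [sum_congr rfl fun i _ => e2 i]
    simp
  rw [h, hx, hJ, tsum_eq_zero_add' (f := fun k => ENNReal.ofReal (pk c k) * ∫⁻ y, (Set.Ioi (0:ℝ)).indicator 1 (sumF y) ∂(Measure.pi fun _ : Fin k × Fin d => μ)) ENNReal.summable,
    tsum_eq_zero_add' (f := fun k => ENNReal.ofReal (pk c k) * ∫⁻ y, ENNReal.ofReal (sumF y) ∂(Measure.pi fun _ : Fin k × Fin d => μ)) ENNReal.summable, add_assoc]
  congr 1
  · simp [sumF, FF]
  · rw [← ENNReal.tsum_mul_left, ← ENNReal.tsum_add]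
    refine tsum_congr fun k => ?_
    rw [key, mul_add, ← mul_assoc, ← mul_assoc]
    congr 2
    rw [← ENNReal.ofReal_natCast, ← ENNReal.ofReal_mul (pk_nonneg hc _), ← ENNReal.ofReal_mul hc.le]
    congr 1
    unfold pk
    rw [Nat.factorial_succ]
    push_cast
    field_simp
    ring

lemma sym_eq (hμ : Sup01 μ) :
    (d + 1 : ℕ) * (∫⁻ x, ∫⁻ z, ENNReal.ofReal (hh x (∑ j, z j)) ∂(Measure.pi fun _ : Fin d => μ) ∂μ + μ (Set.Ioi 0) * (1 - μ (Set.Ioi 0)) ^ d) =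
      1 - (1 - μ (Set.Ioi 0)) ^ (d + 1) := by
  classical
  have hw : ∀ b : Option (Fin d), Measurable fun y : Option (Fin d) → ℝ => ENNReal.ofReal (y b / ∑ b, y b) := fun b => by fun_prop
  have hmJ : Measurable fun z : (Fin d → ℝ) × ℝ => ENNReal.ofReal (hh z.2 (∑ j, z.1 j)) :=
    ENNReal.measurable_ofReal.comp (hh_meas.comp (by fun_prop : Measurable fun z : (Fin d → ℝ) × ℝ => (z.2, ∑ j, z.1 j)))
  have h1 : ∑ b : Option (Fin d), ∫⁻ y, ENNReal.ofReal (y b / ∑ b, y b) ∂(Measure.pi fun _ : Option (Fin d) => μ) = 1 - (1 - μ (Set.Ioi 0)) ^ (d + 1) := by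
    have := pos_sum (B := Option (Fin d)) hμ
    rw [Fintype.card_option, Fintype.card_fin] at this
    rw [← this, ← lintegral_finsetSum _ fun b _ => hw b]
    refine lintegral_congr_ae ?_
    filter_upwards [ae_pi_nonneg (B := Option (Fin d)) hμ] with y hy
    have hS : 0 ≤ ∑ b, y b := sum_nonneg fun b _ => hy b
    rw [← ENNReal.ofReal_sum_of_nonneg (fun b _ => div_nonneg (hy b) hS), ← sum_div]
    simp only [Set.indicator_apply, Set.mem_Ioi]
    split_ifs with h
    · rw [div_self h.ne']; simp
    · rw [le_antisymm (not_lt.1 h) hS]; simp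
  have h2 : ∀ b : Option (Fin d), ∫⁻ y, ENNReal.ofReal (y b / ∑ b, y b) ∂(Measure.pi fun _ : Option (Fin d) => μ) =
      ∫⁻ y, ENNReal.ofReal (y none / ∑ b, y b) ∂(Measure.pi fun _ : Option (Fin d) => μ) := by
    intro b
    rw [lint_equiv (Equiv.swap none b) (fun _ => μ) (hw b)]
    refine lintegral_congr fun y => ?_
    simp only [Equiv.symm_swap, Equiv.swap_apply_right]
    rw [Equiv.sum_comp (Equiv.swap none b) y]
  have h3 : ∫⁻ y, ENNReal.ofReal (y none / ∑ b, y b) ∂(Measure.pi fun _ : Option (Fin d) => μ) =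
      ∫⁻ x, ∫⁻ z, ENNReal.ofReal (hh x (∑ j, z j)) ∂(Measure.pi fun _ : Fin d => μ) ∂μ + μ (Set.Ioi 0) * (1 - μ (Set.Ioi 0)) ^ d := by
    have e0 : (1 - μ (Set.Ioi 0)) ^ d = ∫⁻ z, (Set.Iic (0:ℝ)).indicator 1 (∑ j, z j) ∂(Measure.pi fun _ : Fin d => μ) := by
      have hm : MeasurableSet {z : Fin d → ℝ | 0 < ∑ j, z j} := measurableSet_lt measurable_const (by fun_prop)
      have a1 : ∫⁻ z, (Set.Ioi (0:ℝ)).indicator 1 (∑ j, z j) ∂(Measure.pi fun _ : Fin d => μ) = (Measure.pi fun _ : Fin d => μ) {z : Fin d → ℝ | 0 < ∑ j, z j} := by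
        rw [← lintegral_indicator_one hm]; rfl
      have a2 : ∫⁻ z, (Set.Iic (0:ℝ)).indicator 1 (∑ j, z j) ∂(Measure.pi fun _ : Fin d => μ) = (Measure.pi fun _ : Fin d => μ) {z : Fin d → ℝ | 0 < ∑ j, z j}ᶜ := by
        rw [← lintegral_indicator_one hm.compl]
        refine lintegral_congr fun z => ?_
        simp [Set.indicator_apply]
      rw [a2, prob_compl_eq_one_sub hm, ← a1, pos_sum hμ, Fintype.card_fin]
      have : (1 - μ (Set.Ioi 0)) ^ d ≤ 1 := pow_le_one₀ (zero_le) tsub_le_self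
      rw [ENNReal.sub_sub_cancel ENNReal.one_ne_top this]
    have hmz : Measurable fun z : Fin d → ℝ => (Set.Iic (0:ℝ)).indicator (1 : ℝ → ENNReal) (∑ j, z j) := (measurable_one.indicator measurableSet_Iic).comp (by fun_prop)
    have hmx : Measurable ((Set.Ioi (0:ℝ)).indicator (1 : ℝ → ENNReal)) := measurable_one.indicator measurableSet_Ioi
    rw [lint_option (fun _ => μ) (hw none), e0, ← lintegral_indicator_one measurableSet_Ioi, ← lintegral_const_mul _ hmz,
      ← swap_hh (Measure.pi fun _ : Fin d => μ) μ (a := fun z => ∑ j, z j) (b := fun x => x) (by fun_prop) measurable_id, ← lintegral_add_left hmJ.lintegral_prod_right']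
    refine lintegral_congr_ae ?_
    filter_upwards [ae_pi_nonneg (B := Fin d) hμ] with z hz
    have hS : 0 ≤ ∑ b, z b := sum_nonneg fun b _ => hz b
    have h0 : ∀ᵐ x ∂μ, 0 ≤ x := measure_mono_null (t := (Set.Icc 0 1)ᶜ) (fun x hx hx' => hx hx'.1) hμ
    rw [mul_comm, ← lintegral_const_mul _ hmx, ← lintegral_add_right _ (hmx.const_mul _)]
    refine lintegral_congr_ae ?_
    filter_upwards [h0] with x hx
    simp only [Fintype.sum_option, Option.elim_none, Option.elim_some, hh, Set.indicator_apply, Set.mem_Ioi, Set.mem_Iic]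
    by_cases h : 0 < ∑ b, z b
    · simp [h, not_le.2 h]
    · have : ∑ b, z b = 0 := le_antisymm (not_lt.1 h) hS
      rw [this]
      rcases hx.eq_or_lt with rfl | hx
      · simp
      · simp [hx, hx.ne']
  rw [← h1, sum_congr rfl fun b _ => h2 b, h3]
  simp [mul_add]

lemma m_eq (hc : 0 < c) (hμ : Sup01 μ) (hT : TT d c μ = μ) {t : ℝ} (ht : t = (μ (Set.Ioi 0)).toReal) :
    (∫⁻ x, ENNReal.ofReal x ∂μ).toReal = t + c * t * (1 - t) ^ d - c / (d + 1) * (1 - (1 - t) ^ (d + 1)) := by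
  have h1 := m_eq1 hc hμ hT
  have h2 := sym_eq (d := d) hμ
  set J := ∫⁻ x, ∫⁻ z, ENNReal.ofReal (hh x (∑ j, z j)) ∂(Measure.pi fun _ : Fin d => μ) ∂μ
  set m := ∫⁻ x, ENNReal.ofReal x ∂μ
  have ht1 : μ (Set.Ioi 0) ≤ 1 := prob_le_one
  have htt := measure_ne_top μ (Set.Ioi 0)
  have hm : m ≠ ⊤ := ne_top_of_le_ne_top htt (h1 ▸ le_self_add)
  have hcJ : ENNReal.ofReal c * J ≠ ⊤ := ne_top_of_le_ne_top htt (h1 ▸ le_add_self)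
  have hJ : J ≠ ⊤ := fun h => hcJ (by rw [h]; exact ENNReal.mul_top (by simpa using hc))
  have a1 := congrArg ENNReal.toReal h1
  have a2 := congrArg ENNReal.toReal h2
  have hp : (1 - μ (Set.Ioi 0)) ^ d ≠ ⊤ := ENNReal.pow_ne_top (ne_top_of_le_ne_top ENNReal.one_ne_top tsub_le_self)
  rw [ENNReal.toReal_add hm hcJ, ENNReal.toReal_mul, ENNReal.toReal_ofReal hc.le, ← ht] at a1
  rw [ENNReal.toReal_mul, ENNReal.toReal_add hJ (ENNReal.mul_ne_top htt hp), ENNReal.toReal_mul, ENNReal.toReal_pow, ENNReal.toReal_sub_of_le (pow_le_one₀ (zero_le) tsub_le_self) ENNReal.one_ne_top,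
    ENNReal.toReal_pow, ENNReal.toReal_sub_of_le ht1 ENNReal.one_ne_top, ← ht, ENNReal.toReal_natCast, ENNReal.toReal_one] at a2
  push_cast at a2
  have hd : (0:ℝ) < d + 1 := by positivity
  have : m.toReal = t - c * J.toReal := by linarith
  rw [this]
  have hJ' : J.toReal = (1 - (1 - t) ^ (d + 1)) / (d + 1) - t * (1 - t) ^ d := by
    field_simp; linarith
  rw [hJ']; ring

end
end LP
end

noncomputable section
namespace LP

def ps (D t : ℝ) : ℝ := (D + 1) * (1 - t) + (1 + D * t) * Real.log t
def gs (D t : ℝ) : ℝ := t⁻¹ - 1 + D * Real.log t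

lemma ps_deriv (D : ℝ) {t : ℝ} (ht : 0 < t) : HasDerivAt (ps D) (gs D t) t := by
  have h := (((hasDerivAt_id t).const_sub 1).const_mul (D + 1)).add ((((hasDerivAt_id t).const_mul D).const_add 1).mul (Real.hasDerivAt_log ht.ne'))
  refine (h.congr_deriv ?_).congr_of_eventuallyEq (Eventually.of_forall fun s => ?_)
  · simp [gs]; field_simp; ring
  · simp [ps]

lemma gs_neg {D s t : ℝ} (hD : 0 < D) (ht : 0 < t) (hts : t ≤ s) (hs : s < 1) (h : gs D t < 0) : gs D s < 0 := by
  have hs0 : 0 < s := ht.trans_le hts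
  have ht1 : t < 1 := hts.trans_lt hs
  have hu : 1 < t⁻¹ := (one_lt_inv₀ ht).2 ht1
  have hus : 1 < s⁻¹ := (one_lt_inv₀ hs0).2 hs
  have huts : s⁻¹ ≤ t⁻¹ := inv_anti₀ ht hts
  set l := (s⁻¹ - 1) / (t⁻¹ - 1) with hl
  have hl0 : 0 < l := div_pos (by linarith) (by linarith)
  have hl1 : l ≤ 1 := (div_le_one (by linarith)).2 (by linarith)
  have hle : l * (t⁻¹ - 1) = s⁻¹ - 1 := div_mul_cancel₀ _ (by linarith)
  have hc := strictConcaveOn_log_Ioi.concaveOn.2 (x := t⁻¹) (y := 1) (by simpa using ht) (by simp) hl0.le (sub_nonneg.2 hl1) (by ring)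
  have e : l • t⁻¹ + (1 - l) • (1:ℝ) = s⁻¹ := by simp only [smul_eq_mul]; linarith
  rw [e] at hc
  simp only [smul_eq_mul, Real.log_one, mul_zero, add_zero, Real.log_inv] at hc
  unfold gs at h ⊢
  have : s⁻¹ - 1 + D * Real.log s ≤ l * (t⁻¹ - 1 + D * Real.log t) := by
    rw [mul_add, hle]; nlinarith
  nlinarith [mul_neg_of_pos_of_neg hl0 h]

lemma ps_pos {D s t : ℝ} (hD : 0 < D) (ht : 0 < t) (hts : t ≤ s) (hs : s < 1) (h : gs D t < 0) : 0 < ps D s := by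
  have hA : StrictAntiOn (ps D) (Set.Icc t 1) := by
    refine strictAntiOn_of_deriv_neg (convex_Icc _ _) (fun u hu => (ps_deriv D (ht.trans_le hu.1)).continuousAt.continuousWithinAt) fun u hu => ?_
    rw [interior_Icc] at hu
    rw [(ps_deriv D (ht.trans hu.1)).deriv]
    exact gs_neg hD ht hu.1.le hu.2 h
  have := hA ⟨hts, hs.le⟩ ⟨hts.trans hs.le, le_rfl⟩ hs
  simpa [ps] using this

lemma ps_nonneg {D x t : ℝ} (hD : 0 < D) (hx : 0 < x) (h0 : ps D x = 0) (hxt : x ≤ t) (ht : t ≤ 1) : 0 ≤ ps D t := by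
  rcases ht.eq_or_lt with rfl | ht
  · simp [ps]
  by_cases h : gs D t < 0
  · exact (ps_pos hD (hx.trans_le hxt) le_rfl ht h).le
  have hM : MonotoneOn (ps D) (Set.Icc x t) := by
    refine monotoneOn_of_deriv_nonneg (convex_Icc _ _) (fun u hu => (ps_deriv D (hx.trans_le hu.1)).continuousAt.continuousWithinAt)
      (fun u hu => ?_) fun u hu => ?_
    all_goals rw [interior_Icc] at hu
    · exact (ps_deriv D (hx.trans hu.1)).differentiableAt.differentiableWithinAt
    · rw [(ps_deriv D (hx.trans hu.1)).deriv]
      by_contra h'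
      exact h (gs_neg hD (hx.trans hu.1) hu.2.le ht (not_le.1 h'))
  rw [← h0]
  exact hM ⟨le_rfl, hxt⟩ ⟨hxt, le_rfl⟩ hxt

lemma h_anti {d : ℕ} (hd : 0 < d) {x t : ℝ} (ht : 0 < t) (htx : t ≤ x) (hx : x < 1) (h0 : ps d x = 0) :
    -Real.log x / (1 - x) ^ d ≤ -Real.log t / (1 - t) ^ d := by
  have hD : (0:ℝ) < d := by exact_mod_cast hd
  have key : ∀ u, 0 < u → u < 1 → HasDerivAt (fun u : ℝ => -Real.log u / (1 - u) ^ d)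
      (-(gs d u) / (1 - u) ^ (d + 1)) u := by
    intro u hu hu1
    have h1 : (1 - u) ≠ 0 := by linarith
    have h := (Real.hasDerivAt_log hu.ne').neg.div (((hasDerivAt_id u).const_sub 1).pow d) (pow_ne_zero d h1)
    refine h.congr_deriv ?_
    obtain ⟨e, rfl⟩ := Nat.exists_eq_succ_of_ne_zero hd.ne'
    simp only [gs, id, Nat.succ_eq_add_one, Nat.add_sub_cancel, Pi.pow_apply, Pi.neg_apply]
    field_simp
    push_cast
    ring
  have hA : AntitoneOn (fun u : ℝ => -Real.log u / (1 - u) ^ d) (Set.Icc t x) := by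
    refine antitoneOn_of_deriv_nonpos (convex_Icc _ _) (fun u hu => (key u (ht.trans_le hu.1) (hu.2.trans_lt hx)).continuousAt.continuousWithinAt)
      (fun u hu => ?_) fun u hu => ?_
    all_goals rw [interior_Icc] at hu
    · exact (key u (ht.trans hu.1) (hu.2.trans hx)).differentiableAt.differentiableWithinAt
    · rw [(key u (ht.trans hu.1) (hu.2.trans hx)).deriv, neg_div, neg_nonpos]
      refine div_nonneg ?_ (pow_nonneg (by linarith [hu.2]) _)
      by_contra h'
      exact (ps_pos hD (ht.trans hu.1) hu.2.le hx (not_le.1 h')).ne' h0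
  exact hA ⟨le_rfl, htx⟩ ⟨htx, le_rfl⟩ htx

lemma m_le {d : ℕ} (hd : 2 ≤ d) {x c : ℝ} (hx : x ∈ Set.Ioo (0:ℝ) 1) (h0 : ps d x = 0) (hc0 : 0 < c)
    (hc : c < -Real.log x / (1 - x) ^ d) : (∫⁻ x, ENNReal.ofReal x ∂mui d c).toReal ≤ 1 - c / (d + 1) := by
  haveI := mui_prob d hc0
  have hD : (0:ℝ) < d := by exact_mod_cast (by omega : 0 < d)
  have h1 := t_eq hc0 (Sup01_mui d hc0) (TT_mui d hc0)
  rw [m_eq hc0 (Sup01_mui d hc0) (TT_mui d hc0) rfl]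
  set t := (mui d c (Set.Ioi 0)).toReal
  have ht0 : 0 < t := h1 ▸ Real.exp_pos _
  have ht1 : t ≤ 1 := by
    have := ENNReal.toReal_mono ENNReal.one_ne_top (prob_le_one (μ := mui d c) (s := Set.Ioi 0))
    simpa using this
  have hl : Real.log t = -c * (1 - t) ^ d := by
    conv_lhs => rw [h1]
    rw [Real.log_exp]
  have hxt : x ≤ t := by
    by_contra hh
    rw [not_le] at hh
    have := h_anti (by omega) ht0 hh.le hx.2 h0
    rw [hl, neg_mul, neg_neg, mul_div_cancel_right₀ _ (pow_ne_zero d (by linarith [hx.2]))] at this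
    linarith
  have hp := ps_nonneg hD hx.1 h0 hxt ht1
  unfold ps at hp
  rw [hl] at hp
  rw [← sub_nonneg]
  have e : (1 - c / (d + 1) - (t + c * t * (1 - t) ^ d - c / (d + 1) * (1 - (1 - t) ^ (d + 1)))) * (d + 1) =
      ((d:ℝ) + 1) * (1 - t) + (1 + d * t) * (-c * (1 - t) ^ d) := by
    field_simp; ring
  exact nonneg_of_mul_nonneg_left (e ▸ hp) (by positivity)

end LP
end

noncomputable section
namespace LP

def cl (x : ℝ) : ℝ := max 0 (min x 1)

lemma EQ_le {d : ℕ} {c m : ℝ} (hc : 0 < c) (hm : (∫⁻ x, ENNReal.ofReal x ∂mui d c).toReal ≤ m) {ε : ℝ} (hε : 0 < ε) :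
    ∀ᶠ n : ℕ in atTop, ∀ κ : Finset (Fin n), #κ = d → Ex (UU n d) (c / n) (fun S => QQ S κ κ) ≤ m + ε := by
  haveI := mui_prob d hc
  have hcl : Continuous cl := by unfold cl; fun_prop
  have hlim := mu_lim d hc (f := fun x => ENNReal.ofReal (cl x)) (ENNReal.continuous_ofReal.comp hcl) ENNReal.one_ne_top
    (fun x => by rw [← ENNReal.ofReal_one]; exact ENNReal.ofReal_le_ofReal (max_le zero_le_one (min_le_right _ _)))
  have e1 : ∫⁻ x, ENNReal.ofReal (cl x) ∂mui d c = ∫⁻ x, ENNReal.ofReal x ∂mui d c := by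
    refine lintegral_congr_ae ?_
    have h : ∀ᵐ x ∂mui d c, x ∈ Set.Icc (0:ℝ) 1 := Sup01_mui d hc
    filter_upwards [h] with x hx
    rw [cl, min_eq_left hx.2, max_eq_right hx.1]
  have hfin : ∫⁻ x, ENNReal.ofReal (cl x) ∂mui d c ≠ ⊤ := by
    refine ne_top_of_le_ne_top ENNReal.one_ne_top ((lintegral_mono (g := fun _ => 1) fun x => ?_).trans (by simp))
    rw [← ENNReal.ofReal_one]; exact ENNReal.ofReal_le_ofReal (max_le zero_le_one (min_le_right _ _))
  have hlim' := (ENNReal.tendsto_toReal hfin).comp hlim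
  rw [e1] at hlim'
  obtain ⟨r, hr⟩ := (hlim'.eventually (gt_mem_nhds (show _ < m + ε / 2 by linarith))).exists
  haveI := mu_prob d hc r
  have hG := Good_mu d hc r Unit (fun y => cl (y ())) 1 zero_le_one
    ⟨hcl.measurable.comp (measurable_pi_apply _), fun y => le_max_left _ _, fun y => max_le zero_le_one (min_le_right _ _), fun x y hx hy => by
      have hx := hx (); have hy := hy ()
      simp only [cl, univ_unique, sum_singleton, one_mul]
      rw [max_eq_right (le_min hx zero_le_one), max_eq_right (le_min hy zero_le_one)]
      rcases le_total (x ()) 1 with h | h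
      · rw [min_eq_left h]; have := le_max_left (y () - x ()) 0; have := min_le_left (y ()) 1
        change _ ≤ x () + max (y () - x ()) 0
        linarith
      · rw [min_eq_right h]; have := le_max_right (y () - x ()) 0; have := min_le_right (y ()) 1
        change _ ≤ 1 + max (y () - x ()) 0
        linarith⟩ 0 (ε / 2) (by linarith)
  have hI : II (fun _ : Unit => mu d c r) (fun y => cl (y ())) = ∫⁻ x, ENNReal.ofReal (cl x) ∂mu d c r :=
    (measurePreserving_eval (fun _ : Unit => mu d c r) ()).lintegral_comp (f := fun x => ENNReal.ofReal (cl x))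
      (ENNReal.continuous_ofReal.comp hcl).measurable
  filter_upwards [hG] with n hn κ hκ
  have h := hn (fun _ => κ) ∅ ⟨fun a b _ => rfl, fun _ => hκ, by simp, by simp, by simp⟩
  rw [hI] at h
  have e2 : Vr n d ∅ = UU n d := by simp [Vr]
  rw [e2] at h
  have e3 : (fun S => cl (QQ S κ κ)) = fun S => QQ S κ κ := by
    funext S; rw [cl, min_eq_left (QQ_le_one S κ), max_eq_right (QQ_nonneg S κ)]
  rw [e3] at h
  have : (∫⁻ x, ENNReal.ofReal (cl x) ∂mu d c r).toReal < m + ε / 2 := hr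
  linarith

lemma Ex_card {n : ℕ} (U : Finset (Finset (Fin n))) (p : ℝ) : Ex U p (fun S => (#S : ℝ)) = p * #U := by
  have h : Ex U p (fun S => (#S : ℝ)) = Ex U p (fun S => ∑ σ ∈ U, if {σ} ⊆ S then 1 else 0) := by
    refine Ex_congr p fun S hS => ?_
    simp only [singleton_subset_iff, sum_boole]
    congr 2
    ext σ; simp only [mem_filter]; exact ⟨fun h => ⟨hS h, h⟩, fun h => h.2⟩
  rw [h, Ex_sum, sum_congr rfl fun σ hσ => Ex_superset (Finset.singleton_subset_iff.2 hσ) p]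
  simp [mul_comm]

lemma Ebeta {d : ℕ} (hd : 2 ≤ d) {x c : ℝ} (hx : x ∈ Set.Ioo (0:ℝ) 1) (h0 : ps d x = 0) (hc0 : 0 < c)
    (hc : c < -Real.log x / (1 - x) ^ d) {ε : ℝ} (hε : 0 < ε) :
    ∀ᶠ n : ℕ in atTop, Ex (UU n d) (c / n) beta ≤ ε * (n:ℝ) ^ d := by
  filter_upwards [EQ_le hc0 (m_le hd hx h0 hc0 hc) hε, eventually_ge_atTop (d + 1)] with n hn hnd
  have e1 : Ex (UU n d) (c / n) beta = Ex (UU n d) (c / n)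
      (fun S => ((#S : ℝ) - n.choose d) + ∑ κ ∈ powersetCard d (univ : Finset (Fin n)), QQ S κ κ) :=
    Ex_congr _ fun S hS => by rw [beta, trace_Bs hS]; ring
  rw [e1, Ex_add, Ex_sub, Ex_const, Ex_sum, Ex_card]
  have h2 : ∑ κ ∈ powersetCard d (univ : Finset (Fin n)), Ex (UU n d) (c / n) (fun S => QQ S κ κ) ≤ n.choose d * (1 - c / (d + 1) + ε) := by
    refine (sum_le_sum fun κ hκ => hn κ (Finset.mem_powersetCard.1 hκ).2).trans (le_of_eq ?_)
    simp; ring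
  have h3 : ((n.choose (d+1) : ℕ) : ℝ) * (d + 1) ≤ n.choose d * n := by
    have := Nat.choose_succ_right_eq n d
    exact_mod_cast this.trans_le (Nat.mul_le_mul_left _ (Nat.sub_le _ _))
  have hn0 : (0:ℝ) < n := by exact_mod_cast (by omega : 0 < n)
  have h4 : c / n * ((#(UU n d) : ℕ) : ℝ) ≤ n.choose d * (c / (d + 1)) := by
    rw [card_powersetCard, card_univ, Fintype.card_fin]
    have hd1 : (0:ℝ) < d + 1 := by positivity
    rw [div_mul_eq_mul_div, ← mul_div_assoc, div_le_div_iff₀ hn0 hd1]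
    nlinarith
  have h5 : ((n.choose d : ℕ) : ℝ) ≤ (n:ℝ) ^ d := by exact_mod_cast Nat.choose_le_pow n d
  nlinarith

end LP
end

noncomputable section
namespace LP
section
variable {n : ℕ}

def dg (P : Finset (Finset (Fin n))) (τ : Finset (Fin n)) : ℕ := #(P.filter fun σ => τ ⊆ σ)
def TF (d : ℕ) (P : Finset (Finset (Fin n))) : Finset (Finset (Fin n)) := (powersetCard d univ).filter fun τ => 1 ≤ dg P τ
def Irr (d : ℕ) (H : Finset (Finset (Fin n))) : Finset (Finset (Fin n)) :=
  (powersetCard d univ).filter fun τ => ∃ B ∈ H, ∃ B' ∈ H, B ⊆ τ ∧ B' ⊆ τ ∧ B ∩ B' ∉ H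
def PhS (d : ℕ) (H P : Finset (Finset (Fin n))) : Finset (Finset (Fin n)) :=
  (powersetCard d univ).filter fun τ => dg P τ = 1 ∧ ∀ A ∈ H, ¬ A ⊆ τ
def rhS (d : ℕ) (H P : Finset (Finset (Fin n))) : Finset (Finset (Fin n)) := (Irr d H).filter fun τ => dg P τ ≤ 1
def Sav (d : ℕ) (H P : Finset (Finset (Fin n))) (τ : Finset (Fin n)) : Finset (Fin n) :=
  univ.filter fun v => v ∉ τ ∧ ∃ A ⊆ τ, #A < d ∧ A ∉ H ∧ (insert v A ∈ H ∨ insert v A ∈ TF d P)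

lemma dg_insert {P : Finset (Finset (Fin n))} {σ : Finset (Fin n)} (h : σ ∉ P) (τ : Finset (Fin n)) :
    dg (insert σ P) τ = dg P τ + if τ ⊆ σ then 1 else 0 := by
  unfold dg
  rw [filter_insert]
  split_ifs
  · rw [card_insert_of_notMem (by simp [h])]
  · simp

lemma dg_mono {P P' : Finset (Finset (Fin n))} (h : P ⊆ P') (τ : Finset (Fin n)) : dg P τ ≤ dg P' τ :=
  card_le_card (filter_subset_filter _ h)

lemma TF_mono {d : ℕ} {P P' : Finset (Finset (Fin n))} (h : P ⊆ P') : TF d P ⊆ TF d P' :=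
  monotone_filter_right _ fun _ _ h' => h'.trans (dg_mono h _)

lemma Phi_drop {d : ℕ} (H : Finset (Finset (Fin n))) {P : Finset (Finset (Fin n))} {σ : Finset (Fin n)} (h : σ ∉ P)
    (hσ : #σ = d + 1) : #(PhS d H P) ≤ #(PhS d H (insert σ P)) + (d + 1) := by
  have : PhS d H P ⊆ PhS d H (insert σ P) ∪ powersetCard d σ := by
    intro τ hτ
    simp only [PhS, mem_filter, mem_union, dg_insert h, mem_powersetCard] at hτ ⊢
    by_cases hs : τ ⊆ σ
    · exact Or.inr ⟨hs, hτ.1.2⟩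
    · exact Or.inl ⟨hτ.1, by simp [hs, hτ.2.1], hτ.2.2⟩
  refine (card_le_card this).trans ((card_union_le _ _).trans ?_)
  rw [card_powersetCard, hσ, Nat.choose_succ_self_right]

lemma rho_mono {d : ℕ} (H : Finset (Finset (Fin n))) {P : Finset (Finset (Fin n))} {σ : Finset (Fin n)} :
    #(rhS d H (insert σ P)) ≤ #(rhS d H P) :=
  card_le_card (monotone_filter_right _ fun _ _ h' => (dg_mono (subset_insert _ _) _).trans h')

lemma rho_drop {d : ℕ} {H : Finset (Finset (Fin n))} {P : Finset (Finset (Fin n))} {σ τ : Finset (Fin n)} (h : σ ∉ P)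
    (hτ : τ ∈ Irr d H) (hd : dg P τ = 1) (hs : τ ⊆ σ) : #(rhS d H (insert σ P)) + 1 ≤ #(rhS d H P) := by
  refine Nat.succ_le_of_lt (card_lt_card ⟨monotone_filter_right _ fun _ _ h' => (dg_mono (subset_insert _ _) _).trans h', fun hh => ?_⟩)
  have := hh (Finset.mem_filter.2 ⟨hτ, hd.le⟩)
  simp [rhS, dg_insert h, hs, hd] at this

lemma sub_insert {d : ℕ} {τ τ' : Finset (Fin n)} {v : Fin n} (hv : v ∉ τ) (h : #τ = d) (h' : #τ' = d) (hs : τ' ⊆ insert v τ) (hne : τ' ≠ τ) :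
    ∃ u ∈ τ, τ' = insert v (τ.erase u) := by
  have hv' : v ∈ τ' := by
    by_contra hh
    exact hne (eq_of_subset_of_card_le ((subset_insert_iff_of_notMem hh).1 hs) (by omega))
  have h1 : τ'.erase v ⊆ τ := by rwa [← subset_insert_iff]
  have h2 : #(τ \ τ'.erase v) = 1 := by
    rw [card_sdiff_of_subset h1, card_erase_of_mem hv']
    have := Finset.card_pos.2 ⟨v, hv'⟩
    omega
  obtain ⟨u, hu⟩ := Finset.card_eq_one.1 h2
  have hu' : u ∈ τ \ τ'.erase v := by simp [hu]
  refine ⟨u, (Finset.mem_sdiff.1 hu').1, ?_⟩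
  have : τ.erase u = τ'.erase v := by
    rw [erase_eq, ← hu, Finset.sdiff_sdiff_eq_self h1]
  rw [this, insert_erase hv']

lemma Phi_up {d : ℕ} (hd : 2 ≤ d) {H : Finset (Finset (Fin n))} (hH : ∅ ∉ H) {P : Finset (Finset (Fin n))} {τ : Finset (Fin n)} {v : Fin n}
    (hv : v ∉ τ) (h : insert v τ ∉ P) (hτ : #τ = d) (h1 : dg P τ = 1) (hirr : τ ∉ Irr d H) (hs : v ∉ Sav d H P τ) :
    #(PhS d H P) + 1 ≤ #(PhS d H (insert (insert v τ) P)) := by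
  have hs' : ∀ A ⊆ τ, #A < d → A ∉ H → insert v A ∉ H ∧ insert v A ∉ TF d P := by
    intro A hA hA1 hA2
    simp only [Sav, mem_filter, mem_univ, true_and] at hs
    push Not at hs
    exact hs hv A hA hA1 hA2
  have hcl : ∀ B ∈ H, ∀ B' ∈ H, B ⊆ τ → B' ⊆ τ → B ∩ B' ∈ H := by
    simp only [Irr, mem_filter, mem_powersetCard, subset_univ, hτ, true_and] at hirr
    push Not at hirr
    exact hirr
  have hce : ∀ u ∈ τ, #(τ.erase u) < d := fun u hu => by
    rw [card_erase_of_mem hu]; omega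
  have hcard : ∀ u ∈ τ, #(insert v (τ.erase u)) = d := fun u hu => by
    rw [card_insert_of_notMem fun h => hv (mem_of_mem_erase h), card_erase_of_mem hu]; omega
  have hpres : (PhS d H P).erase τ ⊆ PhS d H (insert (insert v τ) P) := by
    intro τ' hτ'
    rw [mem_erase] at hτ'
    obtain ⟨hne, hτ'⟩ := hτ'
    simp only [PhS, mem_filter, dg_insert h, mem_powersetCard] at hτ' ⊢
    refine ⟨hτ'.1, ?_, hτ'.2.2⟩
    rw [if_neg, hτ'.2.1]
    intro hsub
    obtain ⟨u, hu, rfl⟩ := sub_insert hv hτ hτ'.1.2 hsub hne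
    refine (hs' _ (erase_subset u τ) (hce u hu) fun hh => hτ'.2.2 _ hh (subset_insert _ _)).2 ?_
    simp [TF, mem_powersetCard, hcard u hu, hτ'.2.1]
  have hnew : ∀ u ∈ τ, (∀ A ∈ H, A ⊆ τ → u ∈ A) →
      insert v (τ.erase u) ∈ PhS d H (insert (insert v τ) P) ∧ insert v (τ.erase u) ∉ PhS d H P := by
    intro u hu hM
    have hl : ∀ A ⊆ τ.erase u, A ∉ H := fun A hA hAH => by
      have := hA (hM A hAH (hA.trans (erase_subset _ _)))
      simp at this
    have h0 := (hs' _ (erase_subset u τ) (hce u hu) (hl _ subset_rfl)).2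
    have h00 : dg P (insert v (τ.erase u)) = 0 := by
      by_contra hh
      exact h0 (by simp only [TF, mem_filter, mem_powersetCard, subset_univ, hcard u hu, true_and]; omega)
    constructor
    · simp only [PhS, mem_filter, dg_insert h, mem_powersetCard, subset_univ, hcard u hu, true_and, h00]
      refine ⟨by rw [if_pos (insert_subset_insert _ (erase_subset _ _))], fun A hA hAs => ?_⟩
      by_cases hvA : v ∈ A
      · have hAe : A.erase v ⊆ τ.erase u := by rwa [← subset_insert_iff]
        have := (hs' (A.erase v) (hAe.trans (erase_subset _ _)) ((card_le_card hAe).trans_lt (hce u hu)) (hl _ hAe)).1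
        rw [insert_erase hvA] at this
        exact this hA
      · exact hl A ((subset_insert_iff_of_notMem hvA).1 hAs) hA
    · simp [PhS, h00]
  by_cases hpure : ∀ A ∈ H, ¬ A ⊆ τ
  · obtain ⟨a, b, ha, hb, hab⟩ := Finset.one_lt_card_iff.1 (show 1 < #τ by omega)
    have hna := hnew a ha fun A hA hA' => absurd hA' (hpure A hA)
    have hnb := hnew b hb fun A hA hA' => absurd hA' (hpure A hA)
    have hne : insert v (τ.erase a) ≠ insert v (τ.erase b) := by
      intro hh
      have : a ∈ insert v (τ.erase b) := mem_insert_of_mem (Finset.mem_erase.2 ⟨hab, ha⟩)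
      rw [← hh, mem_insert] at this
      rcases this with rfl | h
      · exact hv ha
      · simp at h
    have hsub : insert (insert v (τ.erase a)) (insert (insert v (τ.erase b)) ((PhS d H P).erase τ)) ⊆ PhS d H (insert (insert v τ) P) :=
      insert_subset hna.1 (insert_subset hnb.1 hpres)
    have := card_le_card hsub
    rw [card_insert_of_notMem, card_insert_of_notMem] at this
    · have := pred_card_le_card_erase (s := PhS d H P) (a := τ)
      omega
    · exact fun hh => hnb.2 (mem_of_mem_erase hh)
    · rw [mem_insert, not_or]
      exact ⟨hne, fun hh => hna.2 (mem_of_mem_erase hh)⟩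
  · push Not at hpure
    obtain ⟨A0, hA0, hA0'⟩ := hpure
    obtain ⟨M, hM, hmin⟩ := exists_min_image (H.filter fun A => A ⊆ τ) Finset.card ⟨A0, Finset.mem_filter.2 ⟨hA0, hA0'⟩⟩
    rw [mem_filter] at hM
    have hMn : M.Nonempty := Finset.nonempty_iff_ne_empty.2 fun h => hH (h ▸ hM.1)
    obtain ⟨u, hu⟩ := hMn
    have hn := hnew u (hM.2 hu) fun A hA hAτ => by
      have h3 := hmin (M ∩ A) (Finset.mem_filter.2 ⟨hcl M hM.1 A hA hM.2 hAτ, Finset.inter_subset_left.trans hM.2⟩)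
      have := eq_of_subset_of_card_le inter_subset_left h3
      rw [← this] at hu
      exact (Finset.mem_inter.1 hu).2
    have hτn : τ ∉ PhS d H P := fun hh => (Finset.mem_filter.1 hh).2.2 A0 hA0 hA0'
    rw [erase_eq_of_notMem hτn] at hpres
    have := card_le_card (insert_subset hn.1 hpres)
    rwa [card_insert_of_notMem hn.2] at this

end
end LP
end

noncomputable section
namespace LP
section
variable {n : ℕ}

def MC (d m : ℕ) (S : Finset (Finset (Fin n))) : Prop :=
  S ⊆ UU n d ∧ #S = m ∧ IsCore S ∧ ∀ P ⊆ S, P.Nonempty → IsCore P → P = S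

lemma not_core {P : Finset (Finset (Fin n))} (h : ¬ IsCore P) : ∃ σ ∈ P, ∃ v ∈ σ, dg P (σ.erase v) = 1 := by
  unfold IsCore at h
  push Not at h
  obtain ⟨σ, hσ, v, hv, h⟩ := h
  refine ⟨σ, hσ, v, hv, Finset.card_eq_one.2 ⟨σ, ?_⟩⟩
  ext σ'
  simp only [mem_filter, mem_singleton]
  constructor
  · rintro ⟨h1, h2⟩
    by_contra hne
    exact h σ' h1 hne h2
  · rintro rfl; exact ⟨hσ, erase_subset _ _⟩

lemma core_dg {d : ℕ} {S : Finset (Finset (Fin n))} (hS : S ⊆ UU n d) (hc : IsCore S) {τ : Finset (Fin n)} (hτ : #τ = d) (h : 1 ≤ dg S τ) :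
    2 ≤ dg S τ := by
  obtain ⟨σ, hσ⟩ := Finset.card_pos.1 (show 0 < #(S.filter fun σ => τ ⊆ σ) from h)
  rw [mem_filter] at hσ
  have h1 := (Finset.mem_powersetCard.1 (hS hσ.1)).2
  obtain ⟨v, hv, hvτ⟩ := exists_mem_notMem_of_card_lt_card (show #τ < #σ by omega)
  have hsub : τ ⊆ σ.erase v := Finset.subset_erase.2 ⟨hσ.2, hvτ⟩
  obtain ⟨σ', h1, h2, h3⟩ := hc σ hσ.1 v hv
  exact Finset.one_lt_card.2 ⟨σ', Finset.mem_filter.2 ⟨h1, hsub.trans h3⟩, σ, Finset.mem_filter.2 hσ, h2⟩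

lemma claim {d m : ℕ} (hd : 2 ≤ d) {κ ε : ℝ} (hκ : 0 < κ) (hκ1 : κ ≤ 1) (hε : ε = κ ^ (d + 2)) {H : Finset (Finset (Fin n))} (hH : ∅ ∉ H)
    {F : Finset (Finset (Finset (Fin n)))} (hF : ∀ S ∈ F, MC d m S)
    (hL : ∀ S ∈ F, ∀ A, #A < d → A ∉ H →
      (#(univ.filter fun v => v ∉ A ∧ (insert v A ∈ H ∨ insert v A ∈ TF d S)) : ℝ) ≤ d * ε * n) (j : ℕ) :
    ∀ P : Finset (Finset (Fin n)), P.Nonempty → #P + j = m →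
      (#(F.filter fun S => P ⊆ S) : ℝ) ≤ ((1 + 2 ^ d * d) * n) ^ j * κ ^ (j + #(PhS d H P)) * (ε⁻¹) ^ #(rhS d H P) := by
  have hε0 : 0 < ε := hε ▸ pow_pos hκ _
  have hε1 : ε ≤ 1 := hε ▸ pow_le_one₀ hκ.le hκ1
  have hE1 : 1 ≤ ε⁻¹ := (one_le_inv₀ hε0).2 hε1
  induction j with
  | zero =>
    intro P hP hj
    rcases (F.filter fun S => P ⊆ S).eq_empty_or_nonempty with h0 | ⟨S, hS⟩
    · rw [h0]; simp; positivity
    · have hall : ∀ S ∈ F.filter (fun S => P ⊆ S), S = P := fun S hS => by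
        rw [mem_filter] at hS
        exact (eq_of_subset_of_card_le hS.2 (by have := (hF S hS.1).2.1; omega)).symm
      have hPS := hall S hS
      rw [mem_filter, hPS] at hS
      have hz : PhS d H P = ∅ := by
        refine Finset.filter_eq_empty_iff.2 fun τ hτ hh => ?_
        have := core_dg (hF P hS.1).1 (hF P hS.1).2.2.1 (Finset.mem_powersetCard.1 hτ).2 (by omega)
        omega
      rw [hz]
      have : #(F.filter fun S => P ⊆ S) ≤ 1 := Finset.card_le_one.2 fun a ha b hb => (hall a ha).trans (hall b hb).symm
      have : (#(F.filter fun S => P ⊆ S) : ℝ) ≤ 1 := by exact_mod_cast this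
      simpa using this.trans (one_le_pow₀ hE1)
  | succ j ih =>
    intro P hP hj
    rcases (F.filter fun S => P ⊆ S).eq_empty_or_nonempty with h0 | ⟨S0, hS0⟩
    · rw [h0]; simp; positivity
    rw [mem_filter] at hS0
    have hPU := hS0.2.trans (hF S0 hS0.1).1
    have hnc : ¬ IsCore P := fun hc => by
      have h1 := (hF S0 hS0.1).2.2.2 P hS0.2 hP hc
      have h2 := (hF S0 hS0.1).2.1
      rw [← h1] at h2; omega
    obtain ⟨σ, hσ, w, hw, hdg⟩ := not_core hnc
    set τ := σ.erase w with hτdef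
    have hτ : #τ = d := by
      have := (Finset.mem_powersetCard.1 (hPU hσ)).2
      rw [hτdef, card_erase_of_mem hw, this]; rfl
    set G := univ.filter (fun v => v ∉ τ ∧ insert v τ ∉ P) with hG
    have hcov : F.filter (fun S => P ⊆ S) ⊆ G.biUnion fun v => F.filter fun S => insert (insert v τ) P ⊆ S := by
      intro S hS
      rw [mem_filter] at hS
      have h2 := core_dg (hF S hS.1).1 (hF S hS.1).2.2.1 hτ (hdg.ge.trans (dg_mono hS.2 τ))
      have h3 : dg P τ < dg S τ := by omega
      obtain ⟨σ', hσ', hσ''⟩ := exists_mem_notMem_of_card_lt_card h3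
      rw [mem_filter] at hσ'
      have hσP : σ' ∉ P := fun hh => hσ'' (Finset.mem_filter.2 ⟨hh, hσ'.2⟩)
      have hc' := (Finset.mem_powersetCard.1 ((hF S hS.1).1 hσ'.1)).2
      obtain ⟨v, hv, hvτ⟩ := exists_mem_notMem_of_card_lt_card (show #τ < #σ' by omega)
      have he : insert v τ = σ' := eq_of_subset_of_card_le (insert_subset hv hσ'.2)
        (by rw [card_insert_of_notMem hvτ]; omega)
      rw [mem_biUnion]
      exact ⟨v, Finset.mem_filter.2 ⟨mem_univ _, hvτ, he ▸ hσP⟩, Finset.mem_filter.2 ⟨hS.1, insert_subset (he ▸ hσ'.1) hS.2⟩⟩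
    set C : ℝ := (1 + 2 ^ d * d) * n with hC
    have hC0 : 0 ≤ C := by positivity
    set X : ℝ := C ^ j * κ ^ (j + 1 + #(PhS d H P)) * (ε⁻¹) ^ #(rhS d H P) with hX
    have hX0 : 0 ≤ X := by positivity
    have hterm : ∀ v ∈ G, (#(F.filter fun S => insert (insert v τ) P ⊆ S) : ℝ) ≤ X + if v ∈ Sav d H P τ then X * ε⁻¹ else 0 := by
      intro v hv
      obtain ⟨-, hvτ, hvP⟩ := Finset.mem_filter.1 hv
      have h1 := ih (insert (insert v τ) P) (insert_nonempty _ _) (by rw [card_insert_of_notMem hvP]; omega)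
      have hdrop := Phi_drop (d := d) H hvP (by rw [card_insert_of_notMem hvτ, hτ])
      set f := #(PhS d H (insert (insert v τ) P))
      set r := #(rhS d H (insert (insert v τ) P))
      have hr : r ≤ #(rhS d H P) := rho_mono H
      have hk : κ ^ (j + f) * ε ≤ κ ^ (j + 1 + #(PhS d H P)) := by
        rw [hε, ← pow_add]
        exact pow_le_pow_of_le_one hκ.le hκ1 (by omega)
      have hk' : κ ^ (j + f) ≤ κ ^ (j + 1 + #(PhS d H P)) * ε⁻¹ := by
        rw [← div_eq_mul_inv, le_div_iff₀ hε0]; exact hk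
      by_cases hsv : v ∈ Sav d H P τ
      · rw [if_pos hsv]
        refine (h1.trans ?_).trans (le_add_of_nonneg_left hX0)
        calc _ ≤ C ^ j * (κ ^ (j + 1 + #(PhS d H P)) * ε⁻¹) * (ε⁻¹) ^ #(rhS d H P) := by gcongr
          _ = X * ε⁻¹ := by rw [hX]; ring
      · rw [if_neg hsv, add_zero]
        refine h1.trans ?_
        by_cases hirr : τ ∈ Irr d H
        · have hr' : r + 1 ≤ #(rhS d H P) := rho_drop hvP hirr hdg (subset_insert _ _)
          calc _ ≤ C ^ j * (κ ^ (j + 1 + #(PhS d H P)) * ε⁻¹) * (ε⁻¹) ^ r := by gcongr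
            _ = C ^ j * κ ^ (j + 1 + #(PhS d H P)) * (ε⁻¹) ^ (r + 1) := by ring
            _ ≤ X := by rw [hX]; gcongr
        · have hup := Phi_up hd hH hvτ hvP hτ hdg hirr hsv
          rw [hX]
          have : κ ^ (j + f) ≤ κ ^ (j + 1 + #(PhS d H P)) := pow_le_pow_of_le_one hκ.le hκ1 (by omega)
          gcongr
    have hSav : (#(Sav d H P τ) : ℝ) ≤ 2 ^ d * (d * ε * n) := by
      have hsub : Sav d H P τ ⊆ (τ.powerset.filter fun A => #A < d ∧ A ∉ H).biUnion fun A =>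
          univ.filter fun v => v ∉ A ∧ (insert v A ∈ H ∨ insert v A ∈ TF d S0) := by
        intro v hv
        obtain ⟨-, hvτ, A, hA, hA1, hA2, hA3⟩ := Finset.mem_filter.1 hv
        rw [mem_biUnion]
        exact ⟨A, Finset.mem_filter.2 ⟨Finset.mem_powerset.2 hA, hA1, hA2⟩, Finset.mem_filter.2 ⟨mem_univ _, fun h => hvτ (hA h),
          hA3.imp_right fun h => TF_mono hS0.2 h⟩⟩
      have h1 : (#(Sav d H P τ) : ℝ) ≤ ∑ A ∈ τ.powerset.filter (fun A => #A < d ∧ A ∉ H), (d * ε * n : ℝ) := by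
        refine le_trans (Nat.cast_le.2 ((card_le_card hsub).trans card_biUnion_le)) ?_
        push_cast
        refine sum_le_sum fun A hA => ?_
        rw [mem_filter] at hA
        exact hL S0 hS0.1 A hA.2.1 hA.2.2
      refine h1.trans ?_
      rw [sum_const, nsmul_eq_mul]
      have : #(τ.powerset.filter fun A => #A < d ∧ A ∉ H) ≤ 2 ^ d := by
        refine (card_filter_le _ _).trans ?_
        rw [card_powerset, hτ]
      have : (#(τ.powerset.filter fun A => #A < d ∧ A ∉ H) : ℝ) ≤ 2 ^ d := by exact_mod_cast this
      gcongr
    have hGn : (#G : ℝ) ≤ n := by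
      have := card_le_univ G
      rw [Fintype.card_fin] at this; exact_mod_cast this
    calc (#(F.filter fun S => P ⊆ S) : ℝ) ≤ ∑ v ∈ G, (#(F.filter fun S => insert (insert v τ) P ⊆ S) : ℝ) := by
          exact_mod_cast (card_le_card hcov).trans card_biUnion_le
      _ ≤ ∑ v ∈ G, (X + if v ∈ Sav d H P τ then X * ε⁻¹ else 0) := sum_le_sum hterm
      _ = #G * X + #(G.filter fun v => v ∈ Sav d H P τ) * (X * ε⁻¹) := by
          rw [sum_add_distrib, sum_const, ← sum_filter, sum_const, nsmul_eq_mul, nsmul_eq_mul]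
      _ ≤ n * X + (2 ^ d * (d * ε * n)) * (X * ε⁻¹) := by
          have : (#(G.filter fun v => v ∈ Sav d H P τ) : ℝ) ≤ #(Sav d H P τ) := by
            exact_mod_cast card_le_card fun v hv => (Finset.mem_filter.1 hv).2
          gcongr
          exact this.trans hSav
      _ = C * X := by rw [hC]; field_simp
      _ = _ := by rw [hX]; ring

end
end LP
end

noncomputable section
namespace LP
section
variable {n : ℕ}

def th (d : ℕ) (ε : ℝ) (k : ℕ) : ℝ := ε ^ (3 ^ (d - k))
open Classical in
def HH (d : ℕ) (ε : ℝ) (S : Finset (Finset (Fin n))) : Finset (Finset (Fin n)) :=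
  univ.filter fun A => #A < d ∧ th d ε #A * (n:ℝ) ^ (d - #A) ≤ dg (TF d S) A

lemma th_pos (d : ℕ) {ε : ℝ} (h : 0 < ε) (k : ℕ) : 0 < th d ε k := pow_pos h _

lemma th_mono (d : ℕ) {ε : ℝ} (h : 0 < ε) (h1 : ε ≤ 1) {i j : ℕ} (hij : i ≤ j) : th d ε i ≤ th d ε j :=
  pow_le_pow_of_le_one h.le h1 (Nat.pow_le_pow_right (by norm_num) (by omega))

lemma th_succ {d : ℕ} (ε : ℝ) {k : ℕ} (hk : k < d) : th d ε k = th d ε (k + 1) ^ 3 := by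
  unfold th
  rw [← pow_mul, ← pow_succ]
  congr 2; omega

lemma th_le (d : ℕ) {ε : ℝ} (h : 0 < ε) (h1 : ε ≤ 1) (k : ℕ) : th d ε k ≤ ε := by
  have := pow_le_pow_of_le_one h.le h1 (Nat.one_le_pow (d - k) 3 (by norm_num))
  rwa [pow_one] at this

lemma TF_card {d : ℕ} {S : Finset (Finset (Fin n))} (hS : S ⊆ UU n d) : #(TF d S) ≤ (d + 1) * #S := by
  have : TF d S ⊆ S.biUnion fun σ => powersetCard d σ := by
    intro τ hτ
    simp only [TF, mem_filter] at hτ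
    obtain ⟨σ, hσ⟩ := Finset.card_pos.1 (show 0 < #(S.filter fun σ => τ ⊆ σ) from hτ.2)
    rw [mem_filter] at hσ
    exact Finset.mem_biUnion.2 ⟨σ, hσ.1, Finset.mem_powersetCard.2 ⟨hσ.2, (Finset.mem_powersetCard.1 hτ.1).2⟩⟩
  refine (card_le_card this).trans (Finset.card_biUnion_le.trans ?_)
  rw [mul_comm, ← smul_eq_mul, ← sum_const]
  refine sum_le_sum fun σ hσ => ?_
  rw [card_powersetCard, (Finset.mem_powersetCard.1 (hS hσ)).2, Nat.choose_succ_self_right]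

lemma dc {d : ℕ} {T : Finset (Finset (Fin n))} (hT : ∀ τ ∈ T, #τ = d) (G : Finset (Finset (Fin n))) :
    ∑ B ∈ G, dg T B ≤ 2 ^ d * #T := by
  have := sum_card_bipartiteAbove_eq_sum_card_bipartiteBelow (s := G) (t := T) (fun B τ => B ⊆ τ)
  unfold dg
  refine (le_of_eq this).trans ?_
  rw [mul_comm, ← smul_eq_mul, ← sum_const]
  refine sum_le_sum fun τ hτ => ?_
  rw [← hT τ hτ, ← card_powerset]
  exact card_le_card fun B hB => Finset.mem_powerset.2 (Finset.mem_filter.1 hB).2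

lemma dc_sup {d : ℕ} {T : Finset (Finset (Fin n))} (hT : ∀ τ ∈ T, #τ = d) (A : Finset (Fin n)) {G : Finset (Finset (Fin n))}
    (hG : ∀ B ∈ G, A ⊆ B) : ∑ B ∈ G, dg T B ≤ 2 ^ d * dg T A := by
  refine le_trans (sum_le_sum fun B hB => ?_) (dc (T := T.filter fun τ => A ⊆ τ) (fun τ hτ => hT τ (Finset.mem_filter.1 hτ).1) G)
  exact card_le_card fun τ hτ => by
    simp only [mem_filter] at hτ ⊢
    exact ⟨⟨hτ.1, (hG B hB).trans hτ.2⟩, hτ.2⟩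

lemma TF_mem_card {d : ℕ} {S : Finset (Finset (Fin n))} : ∀ τ ∈ TF d S, #τ = d := fun τ hτ =>
  (Finset.mem_powersetCard.1 (Finset.mem_filter.1 hτ).1).2

lemma HH_mem {d : ℕ} {ε : ℝ} {S : Finset (Finset (Fin n))} {A : Finset (Fin n)} : A ∈ HH d ε S ↔
    #A < d ∧ th d ε #A * (n:ℝ) ^ (d - #A) ≤ dg (TF d S) A := by simp [HH]

lemma light {d : ℕ} {ε : ℝ} {S : Finset (Finset (Fin n))} {A : Finset (Fin n)} (h : #A < d) (hA : A ∉ HH d ε S) :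
    (dg (TF d S) A : ℝ) ≤ th d ε #A * (n:ℝ) ^ (d - #A) := by
  rw [HH_mem] at hA
  by_contra hh
  exact hA ⟨h, (not_le.1 hh).le⟩

lemma light_bound {d : ℕ} (hn : 0 < n) {ε : ℝ} (hε : 0 < ε) (hε1 : ε ≤ 1) {S : Finset (Finset (Fin n))} {A : Finset (Fin n)} (h : #A < d) (hA : A ∉ HH d ε S) :
    (#(univ.filter fun v => v ∉ A ∧ (insert v A ∈ HH d ε S ∨ insert v A ∈ TF d S)) : ℝ) ≤ d * ε * n := by
  set W := univ.filter fun v => v ∉ A ∧ (insert v A ∈ HH d ε S ∨ insert v A ∈ TF d S) with hW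
  have hn0 : (0:ℝ) < n := by exact_mod_cast hn
  set x := th d ε (#A + 1) * (n:ℝ) ^ (d - (#A + 1)) with hx
  have hx0 : 0 < x := mul_pos (th_pos d hε _) (pow_pos hn0 _)
  have h1 : ∀ v ∈ W, x ≤ dg (TF d S) (insert v A) := by
    intro v hv
    obtain ⟨-, hvA, hv⟩ := Finset.mem_filter.1 hv
    have hc : #(insert v A) = #A + 1 := card_insert_of_notMem hvA
    rcases hv with hv | hv
    · rw [HH_mem, hc] at hv; exact hv.2
    · have hd := TF_mem_card _ hv
      rw [hc] at hd
      have : 1 ≤ dg (TF d S) (insert v A) := Finset.card_pos.2 ⟨insert v A, Finset.mem_filter.2 ⟨hv, subset_rfl⟩⟩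
      have h' : (1:ℝ) ≤ dg (TF d S) (insert v A) := by exact_mod_cast this
      refine le_trans ?_ h'
      rw [hx, hd, Nat.sub_self, pow_zero, mul_one]
      exact (th_le d hε hε1 d).trans hε1
  have h2 : ∑ v ∈ W, dg (TF d S) (insert v A) ≤ d * dg (TF d S) A := by
    have := sum_card_bipartiteAbove_eq_sum_card_bipartiteBelow (s := W) (t := (TF d S).filter fun τ => A ⊆ τ) (fun v τ => insert v A ⊆ τ)
    have e : ∀ v ∈ W, dg (TF d S) (insert v A) = #(bipartiteAbove (fun v τ => insert v A ⊆ τ) ((TF d S).filter fun τ => A ⊆ τ) v) := by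
      intro v hv
      unfold dg bipartiteAbove
      congr 1
      ext τ; simp only [mem_filter]
      exact ⟨fun h => ⟨⟨h.1, (subset_insert _ _).trans h.2⟩, h.2⟩, fun h => ⟨h.1.1, h.2⟩⟩
    rw [sum_congr rfl e, this, mul_comm]
    unfold dg
    rw [← smul_eq_mul, ← sum_const]
    refine sum_le_sum fun τ hτ => ?_
    rw [← TF_mem_card τ (Finset.mem_filter.1 hτ).1]
    exact card_le_card fun v hv => (Finset.mem_filter.1 hv).2 (mem_insert_self _ _)
  have h3 : (#W : ℝ) * x ≤ d * dg (TF d S) A := by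
    rw [← nsmul_eq_mul, ← sum_const]
    exact (sum_le_sum h1).trans (by exact_mod_cast h2)
  have h4 : (dg (TF d S) A : ℝ) ≤ ε * n * x := by
    refine (light h hA).trans ?_
    have e1 : (n:ℝ) ^ (d - #A) = n * (n:ℝ) ^ (d - (#A + 1)) := by rw [← pow_succ']; congr 1; omega
    have e2 : th d ε #A ≤ ε * th d ε (#A + 1) := by
      rw [th_succ ε h, pow_succ]
      refine mul_le_mul_of_nonneg_right ?_ (th_pos d hε _).le
      have a := th_le d hε hε1 (#A + 1)
      have b := th_pos d hε (#A + 1)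
      nlinarith
    rw [e1, hx]
    calc _ ≤ (ε * th d ε (#A + 1)) * (n * (n:ℝ) ^ (d - (#A + 1))) := by gcongr
      _ = _ := by ring
  refine le_of_mul_le_mul_right (h3.trans ?_) hx0
  calc (d:ℝ) * dg (TF d S) A ≤ d * (ε * n * x) := by gcongr
    _ = _ := by ring

lemma HH_card {d : ℕ} (hn : 0 < n) {ε : ℝ} (hε : 0 < ε) (hε1 : ε ≤ 1) (S : Finset (Finset (Fin n))) :
    (#(HH d ε S) : ℝ) * (th d ε 0 * n) ≤ 2 ^ d * #(TF d S) := by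
  have hn1 : (1:ℝ) ≤ n := by exact_mod_cast hn
  rw [← nsmul_eq_mul, ← sum_const]
  refine le_trans (sum_le_sum fun A hA => ?_) (show ∑ A ∈ HH d ε S, (dg (TF d S) A : ℝ) ≤ _ by exact_mod_cast dc TF_mem_card _)
  rw [HH_mem] at hA
  refine le_trans ?_ hA.2
  exact mul_le_mul (th_mono d hε hε1 (Nat.zero_le _)) (le_self_pow₀ hn1 (by omega)) (by positivity) (th_pos d hε _).le

lemma HH_empty {d : ℕ} {ε : ℝ} {S : Finset (Finset (Fin n))} (h : (#(TF d S) : ℝ) < th d ε 0 * (n:ℝ) ^ d) : ∅ ∉ HH d ε S := by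
  rw [HH_mem]
  rintro ⟨-, h'⟩
  simp [dg] at h'
  linarith

lemma sup_card (d : ℕ) (C : Finset (Fin n)) : #((powersetCard d univ).filter fun τ => C ⊆ τ) ≤ n ^ (d - #C) := by
  have : #((powersetCard d univ).filter fun τ => C ⊆ τ) ≤ #(powersetCard (d - #C) (univ : Finset (Fin n))) := by
    refine card_le_card_of_injOn (fun τ => τ \ C) (fun τ hτ => ?_) fun a ha b hb hab => ?_
    · simp only [coe_filter, Set.mem_setOf_eq, mem_powersetCard, subset_univ, true_and] at hτ
      rw [mem_coe, mem_powersetCard, card_sdiff_of_subset hτ.2, hτ.1]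
      exact ⟨subset_univ _, rfl⟩
    · simp only [coe_filter, Set.mem_setOf_eq] at ha hb
      rw [← sdiff_union_of_subset ha.2, ← sdiff_union_of_subset hb.2]
      exact congrArg (· ∪ C) hab
  refine this.trans ?_
  rw [card_powersetCard, card_univ, Fintype.card_fin]
  exact Nat.choose_le_pow n _

lemma Irr_card {d : ℕ} (hn : 0 < n) {ε : ℝ} (hε : 0 < ε) (hε1 : ε ≤ 1) (S : Finset (Finset (Fin n))) :
    (#(Irr d (HH d ε S)) : ℝ) ≤ 8 ^ d * ε * #(TF d S) := by
  set H := HH d ε S with hH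
  set T := TF d S
  have hn0 : (0:ℝ) < n := by exact_mod_cast hn
  set N : Finset (Fin n) → Finset (Finset (Fin n)) := fun B => H.filter fun B' => B ∩ B' ∉ H ∧ #(B ∪ B') ≤ d with hN
  set ψ : Finset (Fin n) → ℝ := fun A => (th d ε (#A + 1) ^ 2 * (n:ℝ) ^ (d - #A))⁻¹ with hψ
  have hψ0 : ∀ A, 0 ≤ ψ A := fun A => by have := th_pos d hε (#A + 1); positivity
  have h1 : (#(Irr d H) : ℝ) ≤ ∑ B ∈ H, ∑ B' ∈ N B, (n:ℝ) ^ (d - #(B ∪ B')) := by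
    have hsub : Irr d H ⊆ H.biUnion fun B => (N B).biUnion fun B' => (powersetCard d univ).filter fun τ => B ∪ B' ⊆ τ := by
      intro τ hτ
      obtain ⟨hτ, B, hB, B', hB', h1, h2, h3⟩ := Finset.mem_filter.1 hτ
      have hu := union_subset h1 h2
      exact Finset.mem_biUnion.2 ⟨B, hB, Finset.mem_biUnion.2 ⟨B', Finset.mem_filter.2 ⟨hB', h3,
        (card_le_card hu).trans (Finset.mem_powersetCard.1 hτ).2.le⟩, Finset.mem_filter.2 ⟨hτ, hu⟩⟩⟩
    have := (card_le_card hsub).trans (Finset.card_biUnion_le.trans (sum_le_sum fun B _ =>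
      Finset.card_biUnion_le.trans (sum_le_sum fun B' _ => sup_card d (B ∪ B'))))
    exact_mod_cast this
  have h2 : ∀ B ∈ H, ∀ B' ∈ N B, (n:ℝ) ^ (d - #(B ∪ B')) ≤ dg T B * (dg T B' * ψ (B ∩ B')) := by
    intro B hB B' hB'
    obtain ⟨hB', hI, hU⟩ := Finset.mem_filter.1 hB'
    have hBB := HH_mem.1 hB
    have hBB' := HH_mem.1 hB'
    have hlt : #(B ∩ B') < #B := card_lt_card ⟨inter_subset_left, fun h => hI (by rwa [Finset.inter_eq_left.2 (h.trans inter_subset_right)])⟩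
    have hlt' : #(B ∩ B') < #B' := card_lt_card ⟨inter_subset_right, fun h => hI (by rwa [Finset.inter_eq_right.2 (h.trans inter_subset_left)])⟩
    have hcu := card_union_add_card_inter B B'
    have hp := th_pos d hε (#(B ∩ B') + 1)
    have e1 : th d ε (#(B ∩ B') + 1) * (n:ℝ) ^ (d - #B) ≤ dg T B :=
      (mul_le_mul_of_nonneg_right (th_mono d hε hε1 hlt) (by positivity)).trans hBB.2
    have e2 : th d ε (#(B ∩ B') + 1) * (n:ℝ) ^ (d - #B') ≤ dg T B' :=
      (mul_le_mul_of_nonneg_right (th_mono d hε hε1 hlt') (by positivity)).trans hBB'.2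
    have e3 : (n:ℝ) ^ (d - #B) * (n:ℝ) ^ (d - #B') = (n:ℝ) ^ (d - #(B ∪ B')) * (n:ℝ) ^ (d - #(B ∩ B')) := by
      rw [← pow_add, ← pow_add]; congr 1; omega
    have e4 := mul_le_mul e1 e2 (by positivity) (by positivity)
    rw [← mul_assoc, hψ, ← div_eq_mul_inv, le_div_iff₀ (by positivity)]
    refine le_trans (le_of_eq ?_) e4
    calc _ = th d ε (#(B ∩ B') + 1) ^ 2 * ((n:ℝ) ^ (d - #(B ∪ B')) * (n:ℝ) ^ (d - #(B ∩ B'))) := by ring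
      _ = _ := by rw [← e3]; ring
  have h3 : ∀ B ∈ H, ∑ B' ∈ N B, (dg T B' * ψ (B ∩ B')) ≤ 4 ^ d * ε := by
    intro B hB
    have hBB := HH_mem.1 hB
    rw [← sum_fiberwise_of_maps_to (t := B.powerset.filter fun A => A ∉ H) (g := fun B' => B ∩ B')
      (fun B' hB' => Finset.mem_filter.2 ⟨Finset.mem_powerset.2 inter_subset_left, (Finset.mem_filter.1 hB').2.1⟩)]
    have h4 : ∀ A ∈ B.powerset.filter (fun A => A ∉ H), ∑ B' ∈ N B with B ∩ B' = A, (dg T B' * ψ (B ∩ B')) ≤ 2 ^ d * ε := by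
      intro A hA
      rw [mem_filter, mem_powerset] at hA
      have hAd : #A < d := (card_le_card hA.1).trans_lt hBB.1
      have e : ∑ B' ∈ N B with B ∩ B' = A, (dg T B' * ψ (B ∩ B')) = (∑ B' ∈ N B with B ∩ B' = A, (dg T B' : ℝ)) * ψ A := by
        rw [sum_mul]
        exact sum_congr rfl fun B' hB' => by rw [(Finset.mem_filter.1 hB').2]
      rw [e]
      have e1 : (∑ B' ∈ N B with B ∩ B' = A, (dg T B' : ℝ)) ≤ 2 ^ d * dg T A := by
        have := dc_sup (T := T) TF_mem_card A (G := (N B).filter fun B' => B ∩ B' = A)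
          (fun B' hB' => (Finset.mem_filter.1 hB').2 ▸ inter_subset_right)
        exact_mod_cast this
      have e2 := light hAd hA.2
      have hp := th_pos d hε (#A + 1)
      calc _ ≤ (2 ^ d * (th d ε #A * (n:ℝ) ^ (d - #A))) * ψ A := by
            refine mul_le_mul_of_nonneg_right (e1.trans ?_) (hψ0 A)
            gcongr
        _ = 2 ^ d * th d ε (#A + 1) := by
            rw [th_succ ε hAd, hψ]; field_simp
        _ ≤ _ := by gcongr; exact th_le d hε hε1 _
    refine (sum_le_sum h4).trans ?_
    rw [sum_const, nsmul_eq_mul]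
    have : #(B.powerset.filter fun A => A ∉ H) ≤ 2 ^ d := by
      refine (card_filter_le _ _).trans ?_
      rw [card_powerset]
      exact Nat.pow_le_pow_right (by norm_num) hBB.1.le
    have : (#(B.powerset.filter fun A => A ∉ H) : ℝ) ≤ 2 ^ d := by exact_mod_cast this
    calc _ ≤ (2:ℝ) ^ d * (2 ^ d * ε) := by gcongr
      _ = _ := by rw [← mul_assoc, ← mul_pow]; norm_num
  calc (#(Irr d H) : ℝ) ≤ ∑ B ∈ H, ∑ B' ∈ N B, (dg T B * (dg T B' * ψ (B ∩ B')) : ℝ) :=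
        h1.trans (sum_le_sum fun B hB => sum_le_sum fun B' hB' => h2 B hB B' hB')
    _ ≤ ∑ B ∈ H, (dg T B : ℝ) * (4 ^ d * ε) := sum_le_sum fun B hB => by
        rw [← mul_sum]
        exact mul_le_mul_of_nonneg_left (h3 B hB) (Nat.cast_nonneg _)
    _ = (∑ B ∈ H, (dg T B : ℝ)) * (4 ^ d * ε) := by rw [sum_mul]
    _ ≤ (2 ^ d * #T) * (4 ^ d * ε) := by
        refine mul_le_mul_of_nonneg_right ?_ (by positivity)
        exact_mod_cast dc TF_mem_card H
    _ = _ := by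
        rw [show (8:ℝ) = 2 * 4 by norm_num, mul_pow]; ring

end
end LP
end

noncomputable section
namespace LP
section
variable {n : ℕ}

lemma sub_count {α : Type*} [DecidableEq α] (A : Finset α) (h : ℕ) : #(A.powerset.filter fun H => #H ≤ h) ≤ (#A + 1) ^ h := by
  have : A.powerset.filter (fun H => #H ≤ h) ⊆ (Finset.range (h + 1)).biUnion fun i => powersetCard i A := by
    intro H hH
    rw [mem_filter, mem_powerset] at hH
    exact Finset.mem_biUnion.2 ⟨#H, Finset.mem_range.2 (by omega), Finset.mem_powersetCard.2 ⟨hH.1, rfl⟩⟩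
  refine (card_le_card this).trans (Finset.card_biUnion_le.trans ?_)
  rw [add_pow]
  refine sum_le_sum fun i hi => ?_
  rw [card_powersetCard, one_pow, mul_one]
  exact (Nat.choose_le_pow _ _).trans (Nat.le_mul_of_pos_right _ (Nat.choose_pos (by simpa [Nat.lt_succ_iff] using hi)))

lemma small_sets (n d : ℕ) : #((univ : Finset (Finset (Fin n))).filter fun A => #A ≤ d) ≤ (n + 1) ^ d := by
  have := sub_count (univ : Finset (Fin n)) d
  rwa [powerset_univ, card_univ, Fintype.card_fin] at this

open Classical in
def FM (n d m : ℕ) : Finset (Finset (Finset (Fin n))) := univ.filter fun S => MC d m S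

lemma count {d m h : ℕ} (hd : 2 ≤ d) (hn : 0 < n) (hm : 1 ≤ m) {k ε : ℝ} (hk : 0 < k) (hk1 : k ≤ 1) (hε : ε = (k ^ 2) ^ (d + 2))
    (h1 : 2 * (d + 2) * (8 ^ d * ε * (d + 1)) ≤ 1) (h2 : ((d:ℝ) + 1) * m < th d ε 0 * (n:ℝ) ^ d)
    (h3 : 2 ^ d * (((d:ℝ) + 1) * m) < (h + 1) * (th d ε 0 * n)) :
    (#(FM n d m) : ℝ) ≤ ((n + 1) ^ d + 1) ^ h * (n ^ (d + 1) * (((1 + 2 ^ d * d) * n) ^ (m - 1) * (k ^ 2) ^ (m - 1) * (k⁻¹) ^ m)) := by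
  classical
  have hκ : 0 < k ^ 2 := by positivity
  have hκ1 : k ^ 2 ≤ 1 := pow_le_one₀ hk.le hk1
  have hε0 : 0 < ε := hε ▸ pow_pos hκ _
  have hε1 : ε ≤ 1 := hε ▸ pow_le_one₀ hκ.le hκ1
  have hn0 : (0:ℝ) < n := by exact_mod_cast hn
  have hTF : ∀ S ∈ FM n d m, (#(TF d S) : ℝ) ≤ (d + 1) * m := fun S hS => by
    have hS := (Finset.mem_filter.1 hS).2
    have := TF_card hS.1
    rw [hS.2.1] at this; exact_mod_cast this
  set X : ℝ := n ^ (d + 1) * (((1 + 2 ^ d * d) * n) ^ (m - 1) * (k ^ 2) ^ (m - 1) * (k⁻¹) ^ m) with hX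
  have hX0 : 0 ≤ X := by positivity
  have hH : ∀ H, (#((FM n d m).filter fun S => HH d ε S = H) : ℝ) ≤ X := by
    intro H
    rcases ((FM n d m).filter fun S => HH d ε S = H).eq_empty_or_nonempty with h0 | ⟨S0, hS0⟩
    · rw [h0]; simpa using hX0
    set F := (FM n d m).filter fun S => HH d ε S = H with hF
    have hFm : ∀ S ∈ F, MC d m S := fun S hS => (Finset.mem_filter.1 (Finset.mem_filter.1 hS).1).2
    obtain ⟨hS0, hSH⟩ := Finset.mem_filter.1 hS0
    have hirr : 2 * (d + 2) * #(Irr d H) ≤ m := by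
      have := Irr_card (d := d) hn hε0 hε1 S0
      rw [hSH] at this
      have h4 : (2 * (d + 2) * #(Irr d H) : ℝ) ≤ m := by
        calc (2 * (d + 2) * #(Irr d H) : ℝ) ≤ 2 * (d + 2) * (8 ^ d * ε * ((d + 1) * m)) := by
              gcongr; exact this.trans (by gcongr; exact hTF S0 hS0)
          _ = (2 * (d + 2) * (8 ^ d * ε * (d + 1))) * m := by ring
          _ ≤ 1 * m := by gcongr
          _ = m := one_mul _
      exact_mod_cast h4
    have hcl := claim hd hκ hκ1 hε (H := H) (hSH ▸ HH_empty ((hTF S0 hS0).trans_lt h2)) hFm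
      (fun S hS A hA hAH => by
        have he := (Finset.mem_filter.1 hS).2
        rw [← he] at hAH ⊢
        exact light_bound hn hε0 hε1 hA hAH) (m - 1)
    have hσ : ∀ σ ∈ UU n d, (#(F.filter fun S => {σ} ⊆ S) : ℝ) ≤ ((1 + 2 ^ d * d) * n) ^ (m - 1) * (k ^ 2) ^ (m - 1) * (k⁻¹) ^ m := by
      intro σ _
      refine (hcl {σ} (singleton_nonempty _) (by simp; omega)).trans ?_
      have e1 : (k ^ 2) ^ (m - 1 + #(PhS d H {σ})) ≤ (k ^ 2) ^ (m - 1) := pow_le_pow_of_le_one hκ.le hκ1 (by omega)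
      have e2 : ε⁻¹ ^ #(rhS d H {σ}) ≤ k⁻¹ ^ m := by
        rw [hε, ← pow_mul, ← inv_pow, ← pow_mul]
        refine pow_le_pow_right₀ ((one_le_inv₀ hk).2 hk1) (le_trans ?_ hirr)
        exact Nat.mul_le_mul_left _ (card_le_card (filter_subset _ _))
      gcongr
    have hsub : F ⊆ (UU n d).biUnion fun σ => F.filter fun S => {σ} ⊆ S := by
      intro S hS
      have hh := hFm S hS
      obtain ⟨σ, hσ⟩ := Finset.card_pos.1 (show 0 < #S by rw [hh.2.1]; omega)
      exact Finset.mem_biUnion.2 ⟨σ, hh.1 hσ, Finset.mem_filter.2 ⟨hS, by simpa using hσ⟩⟩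
    have hU : (#(UU n d) : ℝ) ≤ n ^ (d + 1) := by
      rw [card_powersetCard, card_univ, Fintype.card_fin]
      exact_mod_cast Nat.choose_le_pow n (d + 1)
    calc (#F : ℝ) ≤ ∑ σ ∈ UU n d, (#(F.filter fun S => {σ} ⊆ S) : ℝ) := by
          have := (card_le_card hsub).trans card_biUnion_le
          rw [← Nat.cast_sum]; exact Nat.cast_le.2 this
      _ ≤ #(UU n d) * (((1 + 2 ^ d * d) * n) ^ (m - 1) * (k ^ 2) ^ (m - 1) * (k⁻¹) ^ m) := by
          rw [← nsmul_eq_mul, ← sum_const]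
          exact sum_le_sum hσ
      _ ≤ X := by rw [hX]; gcongr
  set A := (univ : Finset (Finset (Fin n))).filter fun A => #A ≤ d with hA
  have hsub : FM n d m ⊆ (A.powerset.filter fun H => #H ≤ h).biUnion fun H => (FM n d m).filter fun S => HH d ε S = H := by
    intro S hS
    refine Finset.mem_biUnion.2 ⟨HH d ε S, Finset.mem_filter.2 ⟨Finset.mem_powerset.2 fun B hB => ?_, ?_⟩, Finset.mem_filter.2 ⟨hS, rfl⟩⟩
    · exact Finset.mem_filter.2 ⟨mem_univ _, (HH_mem.1 hB).1.le⟩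
    · have h4 := HH_card (d := d) hn hε0 hε1 S
      have h5 : (#(HH d ε S) : ℝ) * (th d ε 0 * n) < (h + 1) * (th d ε 0 * n) := h4.trans_lt (lt_of_le_of_lt (by gcongr; exact hTF S hS) h3)
      have h6 : (#(HH d ε S) : ℝ) < h + 1 := lt_of_mul_lt_mul_right h5 (mul_nonneg (th_pos d hε0 0).le hn0.le)
      exact Nat.lt_succ_iff.1 (by exact_mod_cast h6)
  calc (#(FM n d m) : ℝ) ≤ ∑ H ∈ A.powerset.filter (fun H => #H ≤ h), (#((FM n d m).filter fun S => HH d ε S = H) : ℝ) := by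
        have := (card_le_card hsub).trans card_biUnion_le
        rw [← Nat.cast_sum]; exact Nat.cast_le.2 this
    _ ≤ #(A.powerset.filter fun H => #H ≤ h) * X := by
        rw [← nsmul_eq_mul, ← sum_const]
        exact sum_le_sum fun H _ => hH H
    _ ≤ _ := by
        refine mul_le_mul_of_nonneg_right ?_ hX0
        have := (sub_count A h).trans (Nat.pow_le_pow_left (Nat.succ_le_succ (small_sets n d)) h)
        exact_mod_cast this

lemma count' {d m h : ℕ} (hd : 2 ≤ d) (hn : 0 < n) (hm : 1 ≤ m) {k ε c : ℝ} (hc : 0 < c) (hk : 0 < k) (hk1 : k ≤ 1) (hε : ε = (k ^ 2) ^ (d + 2))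
    (h1 : 2 * (d + 2) * (8 ^ d * ε * (d + 1)) ≤ 1) (h2 : ((d:ℝ) + 1) * m < th d ε 0 * (n:ℝ) ^ d)
    (h3 : 2 ^ d * (((d:ℝ) + 1) * m) < (h + 1) * (th d ε 0 * n)) :
    (#(FM n d m) : ℝ) * (c / n) ^ m ≤ ((n + 1) ^ d + 1) ^ h * n ^ d * ((1 + 2 ^ d * d) * c * k) ^ m / k ^ 2 := by
  have hn0 : (0:ℝ) < n := by exact_mod_cast hn
  have hcnt := count hd hn hm hk hk1 hε h1 h2 h3
  refine (mul_le_mul_of_nonneg_right hcnt (by positivity)).trans ?_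
  obtain ⟨j, rfl⟩ : ∃ j, m = j + 1 := ⟨m - 1, by omega⟩
  simp only [Nat.add_sub_cancel]
  have hC : (1:ℝ) ≤ 1 + 2 ^ d * d := by have : (0:ℝ) ≤ 2 ^ d * d := by positivity
                                        linarith
  set C : ℝ := 1 + 2 ^ d * d
  calc _ = (((n:ℝ) + 1) ^ d + 1) ^ h * n ^ d * (C ^ j * (c * k) ^ (j + 1)) / k ^ 2 := by
        simp only [mul_pow, div_pow, inv_pow, ← pow_mul]
        field_simp
        ring
    _ ≤ (((n:ℝ) + 1) ^ d + 1) ^ h * n ^ d * (C ^ (j + 1) * (c * k) ^ (j + 1)) / k ^ 2 := by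
        gcongr
        omega
    _ = _ := by rw [← mul_pow]; ring

end
end LP
end

noncomputable section
namespace LP
section
variable {n : ℕ}

lemma few_vertices {d : ℕ} (hd : 2 ≤ d) {S : Finset (Finset (Fin n))} (hS : S ⊆ UU n d) (hne : S.Nonempty) (hC : IsCore S)
    (hs : ¬ hasSimp d S) : #(S.biUnion id) < #S := by
  classical
  by_contra hlt
  rw [not_lt] at hlt
  have hcard : ∀ σ ∈ S, #σ = d + 1 := fun σ hσ => (Finset.mem_powersetCard.1 (hS hσ)).2
  choose! f f1 f2 f3 using hC
  have fw : ∀ σ ∈ S, ∀ w ∈ σ, w ∉ f σ w := fun σ hσ w hw h => f2 σ hσ w hw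
    (eq_of_subset_of_card_le (fun y hy => by
      by_cases hyw : y = w
      · exact hyw ▸ h
      · exact f3 σ hσ w hw (Finset.mem_erase.2 ⟨hyw, hy⟩)) (by rw [hcard _ hσ, hcard _ (f1 σ hσ w hw)])).symm
  let g : Fin n → Finset (Fin n) → Fin n → Finset (Fin n) := fun v σ w => if w = v then σ else f σ w
  have ginj : ∀ v, ∀ σ ∈ S, v ∈ σ → Set.InjOn (g v σ) σ := by
    intro v σ hσ hv w hw w' hw' h
    simp only [g] at h
    by_contra hww
    split_ifs at h with h1 h2 h2
    · exact hww (h1.trans h2.symm)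
    · exact f2 σ hσ w' hw' h.symm
    · exact f2 σ hσ w hw h
    · exact fw σ hσ w hw (h ▸ f3 σ hσ w' hw' (Finset.mem_erase.2 ⟨hww, hw⟩))
  have gmem : ∀ v, ∀ σ ∈ S, v ∈ σ → σ.image (g v σ) ⊆ S.filter (v ∈ ·) := by
    intro v σ hσ hv ρ hρ
    obtain ⟨w, hw, rfl⟩ := Finset.mem_image.1 hρ
    simp only [g]
    split_ifs with h
    · exact Finset.mem_filter.2 ⟨hσ, hv⟩
    · exact Finset.mem_filter.2 ⟨f1 σ hσ w hw, f3 σ hσ w hw (Finset.mem_erase.2 ⟨Ne.symm h, hv⟩)⟩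
  have gc : ∀ v, ∀ σ ∈ S, v ∈ σ → #(σ.image (g v σ)) = d + 1 := fun v σ hσ hv => by
    rw [card_image_of_injOn (ginj v σ hσ hv), hcard σ hσ]
  have hge : ∀ v ∈ S.biUnion id, d + 1 ≤ #(S.filter (v ∈ ·)) := by
    intro v hv
    obtain ⟨σ, hσ, hv⟩ := Finset.mem_biUnion.1 hv
    rw [← gc v σ hσ hv]; exact card_le_card (gmem v σ hσ hv)
  have hdc : ∑ v ∈ S.biUnion id, #(S.filter (v ∈ ·)) = (d + 1) * #S := by
    simp only [card_filter]
    rw [sum_comm, mul_comm, ← smul_eq_mul, ← sum_const]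
    refine sum_congr rfl fun σ hσ => ?_
    rw [← hcard σ hσ, ← card_filter]
    congr 1; ext v
    simp only [mem_filter, mem_biUnion, id]
    exact ⟨fun h => h.2, fun h => ⟨⟨σ, hσ, h⟩, h⟩⟩
  have heq : ∀ v ∈ S.biUnion id, d + 1 = #(S.filter (v ∈ ·)) := by
    rw [← sum_eq_sum_iff_of_le hge, hdc, sum_const, smul_eq_mul]
    refine le_antisymm ?_ ?_
    · have := sum_le_sum hge
      rwa [hdc, sum_const, smul_eq_mul] at this
    · rw [mul_comm]; exact Nat.mul_le_mul_right _ hlt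
  have hstar : ∀ v, ∀ σ ∈ S, v ∈ σ → S.filter (v ∈ ·) = σ.image (g v σ) := fun v σ hσ hv =>
    (eq_of_subset_of_card_le (gmem v σ hσ hv) (by
      rw [gc v σ hσ hv, ← heq v (Finset.mem_biUnion.2 ⟨σ, hσ, hv⟩)])).symm
  obtain ⟨σ, hσ⟩ := hne
  have hx : ∀ w ∈ σ, ∃ x, x ∉ σ ∧ f σ w = insert x (σ.erase w) := by
    intro w hw
    have hc : #(f σ w \ σ.erase w) = 1 := by
      rw [card_sdiff_of_subset (f3 σ hσ w hw), card_erase_of_mem hw, hcard σ hσ, hcard _ (f1 σ hσ w hw)]; omega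
    obtain ⟨x, hx⟩ := Finset.card_eq_one.1 hc
    have hx1 : x ∈ f σ w \ σ.erase w := hx ▸ mem_singleton_self x
    rw [Finset.mem_sdiff] at hx1
    refine ⟨x, fun h => hx1.2 (Finset.mem_erase.2 ⟨fun h' => fw σ hσ w hw (h' ▸ hx1.1), h⟩), ?_⟩
    rw [insert_eq, ← hx, sdiff_union_of_subset (f3 σ hσ w hw)]
  choose! x x1 x2 using hx
  have hxx : ∀ w ∈ σ, ∀ w' ∈ σ, w ≠ w' → x w = x w' := by
    intro w hw w' hw' hww
    obtain ⟨v, hv⟩ : ((σ.erase w).erase w').Nonempty := Finset.card_pos.1 (by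
      rw [card_erase_of_mem (Finset.mem_erase.2 ⟨hww.symm, hw'⟩), card_erase_of_mem hw, hcard σ hσ]; omega)
    simp only [mem_erase] at hv
    have hρ := f1 σ hσ w hw
    have hw'ρ : w' ∈ f σ w := f3 σ hσ w hw (Finset.mem_erase.2 ⟨hww.symm, hw'⟩)
    have hsub := f3 _ hρ w' hw'ρ
    have hvρ : v ∈ f (f σ w) w' := hsub (Finset.mem_erase.2 ⟨hv.1, f3 σ hσ w hw (Finset.mem_erase.2 ⟨hv.2.1, hv.2.2⟩)⟩)
    have hin : f (f σ w) w' ∈ S.filter (v ∈ ·) := Finset.mem_filter.2 ⟨f1 _ hρ w' hw'ρ, hvρ⟩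
    rw [hstar v σ hσ hv.2.2] at hin
    obtain ⟨u, hu, hgu⟩ := Finset.mem_image.1 hin
    have hxw : x w ∈ f (f σ w) w' := hsub (Finset.mem_erase.2 ⟨fun h => x1 w hw (h ▸ hw'), by rw [x2 w hw]; exact mem_insert_self _ _⟩)
    simp only [g] at hgu
    split_ifs at hgu with huv
    · exact absurd (hgu ▸ hxw) (x1 w hw)
    rw [← hgu] at hxw hsub
    have h5 : x w = x u := by
      rw [x2 u hu, mem_insert] at hxw
      exact hxw.resolve_right fun h => x1 w hw (mem_of_mem_erase h)
    by_cases huw : u = w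
    · exact absurd (huw ▸ hgu).symm (f2 _ hρ w' hw'ρ)
    · by_cases huw' : u = w'
      · rw [h5, huw']
      · exact absurd (hsub (Finset.mem_erase.2 ⟨huw', f3 σ hσ w hw (Finset.mem_erase.2 ⟨huw, hu⟩)⟩)) (fw σ hσ u hu)
  obtain ⟨w0, hw0⟩ : σ.Nonempty := Finset.card_pos.1 (by rw [hcard σ hσ]; omega)
  have hall : ∀ w ∈ σ, x w = x w0 := fun w hw => by
    by_cases h : w = w0
    · rw [h]
    · exact hxx w hw w0 hw0 h
  have hτ : #(insert (x w0) σ) = d + 2 := by rw [card_insert_of_notMem (x1 w0 hw0), hcard σ hσ]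
  refine hs ⟨insert (x w0) σ, hτ, fun ρ hρ => ?_⟩
  obtain ⟨hρ1, hρ2⟩ := Finset.mem_powersetCard.1 hρ
  obtain ⟨u, hu⟩ := Finset.card_eq_one.1 (show #(insert (x w0) σ \ ρ) = 1 by rw [card_sdiff_of_subset hρ1]; omega)
  have hu1 : ρ = (insert (x w0) σ).erase u := by
    rw [erase_eq, ← hu, Finset.sdiff_sdiff_eq_self hρ1]
  have hu2 : u ∈ insert (x w0) σ := (Finset.mem_sdiff.1 (hu ▸ mem_singleton_self u)).1
  rcases Finset.mem_insert.1 hu2 with h | h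
  · rw [hu1, h, erase_insert (x1 w0 hw0)]; exact hσ
  · rw [hu1, erase_insert_of_ne (show x w0 ≠ u from fun h' => x1 w0 hw0 (h' ▸ h)), ← hall u h, ← x2 u h]; exact f1 σ hσ u h

open Classical in
def FN (n d m : ℕ) : Finset (Finset (Finset (Fin n))) := (FM n d m).filter fun S => ¬ hasSimp d S

lemma small_count {d m : ℕ} (hd : 2 ≤ d) (hm : 1 ≤ m) : #(FN n d m) ≤ (n + 1) ^ (m - 1) * 2 ^ 2 ^ (m - 1) := by
  classical
  have hsub : FN n d m ⊆ ((univ : Finset (Finset (Fin n))).filter fun A => #A ≤ m - 1).biUnion fun W => W.powerset.powerset := by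
    intro S hS
    obtain ⟨hS, hs⟩ := Finset.mem_filter.1 hS
    obtain ⟨h1, h2, h3, _⟩ := (Finset.mem_filter.1 hS).2
    have := few_vertices hd h1 (Finset.card_pos.1 (by omega)) h3 hs
    refine Finset.mem_biUnion.2 ⟨S.biUnion id, Finset.mem_filter.2 ⟨mem_univ _, by omega⟩, ?_⟩
    exact Finset.mem_powerset.2 fun σ hσ => Finset.mem_powerset.2 fun v hv => Finset.mem_biUnion.2 ⟨σ, hσ, hv⟩
  refine (card_le_card hsub).trans (Finset.card_biUnion_le.trans ?_)
  refine (sum_le_card_nsmul _ _ (2 ^ 2 ^ (m - 1)) fun W hW => ?_).trans ?_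
  · rw [card_powerset, card_powerset]
    have := (Finset.mem_filter.1 hW).2
    exact Nat.pow_le_pow_right (by omega) (Nat.pow_le_pow_right (by omega) this)
  · rw [smul_eq_mul]; exact Nat.mul_le_mul_right _ (small_sets n (m - 1))

lemma small_regime {d m : ℕ} (hd : 2 ≤ d) (hm : 1 ≤ m) (hn : 0 < n) {c : ℝ} (hc : 0 < c) :
    (#(FN n d m) : ℝ) * (c / n) ^ m ≤ (2 ^ m * 2 ^ 2 ^ m * c ^ m) / n := by
  have hn0 : (0:ℝ) < n := by exact_mod_cast hn
  have hn1 : (1:ℝ) ≤ n := by exact_mod_cast hn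
  have h1 : (#(FN n d m) : ℝ) ≤ (n + 1) ^ (m - 1) * 2 ^ 2 ^ (m - 1) := by exact_mod_cast small_count hd hm
  obtain ⟨j, rfl⟩ : ∃ j, m = j + 1 := ⟨m - 1, by omega⟩
  simp only [Nat.add_sub_cancel] at h1
  have h2 : (#(FN n d (j + 1)) : ℝ) ≤ (2 * n) ^ j * 2 ^ 2 ^ (j + 1) := by
    refine h1.trans ?_
    gcongr
    · linarith
    · norm_num
    · norm_num
    · omega
  calc _ ≤ ((2 * (n:ℝ)) ^ j * 2 ^ 2 ^ (j + 1)) * (c / n) ^ (j + 1) := by gcongr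
    _ = (2 ^ j * 2 ^ 2 ^ (j + 1) * c ^ (j + 1)) / n := by rw [div_pow, mul_pow]; field_simp; rw [pow_succ]
    _ ≤ _ := by
      gcongr
      · norm_num
      · omega

end
end LP
end

noncomputable section
namespace LP
section

lemma kap_ex (d : ℕ) {c : ℝ} (hc : 0 < c) : ∃ κ : ℝ, 0 < κ ∧ κ ≤ 1 ∧ 8 * ((1 + 2 ^ d * d) * c * κ) ≤ 1 ∧
    ∀ k : ℝ, 0 < k → k ≤ κ → 2 * (d + 2) * (8 ^ d * (k ^ 2) ^ (d + 2) * (d + 1)) ≤ 1 := by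
  set A : ℝ := 2 * (d + 2) * (8 ^ d * (d + 1)) with hA
  set B : ℝ := 8 * ((1 + 2 ^ d * d) * c) with hB
  have hA0 : 0 ≤ A := by positivity
  have hB0 : 0 ≤ B := by positivity
  have hκ1 : 1 / (1 + A + B) ≤ 1 := by rw [div_le_one (by positivity)]; linarith
  refine ⟨1 / (1 + A + B), by positivity, hκ1, ?_, fun k hk hk1 => ?_⟩
  · calc 8 * ((1 + 2 ^ d * d) * c * (1 / (1 + A + B))) = B / (1 + A + B) := by rw [hB]; ring
      _ ≤ 1 := by rw [div_le_one (by positivity)]; linarith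
  · have h1 : (k ^ 2) ^ (d + 2) ≤ k := by
      rw [← pow_mul]
      exact pow_le_of_le_one hk.le (hk1.trans hκ1) (by positivity)
    calc 2 * (d + 2) * (8 ^ d * (k ^ 2) ^ (d + 2) * (d + 1)) = A * (k ^ 2) ^ (d + 2) := by rw [hA]; ring
      _ ≤ A * (1 / (1 + A + B)) := by gcongr; exact h1.trans hk1
      _ = A / (1 + A + B) := by ring
      _ ≤ 1 := by rw [div_le_one (by positivity)]; linarith

lemma FN_le (n d m : ℕ) : FN n d m ⊆ FM n d m := by
  classical
  exact filter_subset _ _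

lemma mid_regime {d : ℕ} (hd : 2 ≤ d) {c : ℝ} (hc : 0 < c) : ∃ (M : ℕ) (K : ℝ), 0 ≤ K ∧ ∀ᶠ n : ℕ in atTop, ∀ m : ℕ, 1 ≤ m → M ≤ m →
    (2 ^ d * (((d:ℝ) + 1) * m)) ^ 2 < n → (#(FN n d m) : ℝ) * (c / n) ^ m ≤ K * (1 / 2) ^ m / n := by
  obtain ⟨κ, hκ, hκ1, hκ2, hκ3⟩ := kap_ex d hc
  set E := (d + 2) * 3 ^ d with hE
  have hE0 : 0 < E := by positivity
  set q := 4 * E with hq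
  have hq0 : 0 < q := by omega
  set C0 : ℝ := 1 + 2 ^ d * d with hC0
  have hC0' : 0 < C0 := by positivity
  refine ⟨q * (d + 1) + 2, (2 * C0 * c) ^ (q * (d + 1) + 2), by positivity, ?_⟩
  have ht : Tendsto (fun n : ℕ => (n:ℝ) ^ (-(1 / (q:ℝ)))) atTop (nhds 0) :=
    (tendsto_rpow_neg_atTop (by positivity)).comp tendsto_natCast_atTop_atTop
  filter_upwards [ht.eventually_le_const hκ, eventually_gt_atTop 0] with n hkn hn m hm hM hmn
  have hn0 : (0:ℝ) < n := by exact_mod_cast hn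
  have hn1 : (1:ℝ) ≤ n := by exact_mod_cast hn
  set k : ℝ := (n:ℝ) ^ (-(1 / (q:ℝ))) with hk
  have hk0 : 0 < k := Real.rpow_pos_of_pos hn0 _
  have hkq : k ^ q = (n:ℝ)⁻¹ := by
    rw [hk, ← Real.rpow_natCast, ← Real.rpow_mul hn0.le, ← Real.rpow_neg_one]
    congr 1
    have : (q:ℝ) ≠ 0 := by positivity
    field_simp
  have hth : th d ((k ^ 2) ^ (d + 2)) 0 = k ^ (2 * E) := by
    rw [th, ← pow_mul, ← pow_mul, Nat.sub_zero, hE]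
  have hsq : (k ^ (2 * E) * n) ^ 2 = n := by
    rw [mul_pow, ← pow_mul, show 2 * E * 2 = q by omega, hkq]; field_simp
  have h3 : 2 ^ d * (((d:ℝ) + 1) * m) < k ^ (2 * E) * n :=
    lt_of_pow_lt_pow_left₀ 2 (by positivity) (by rw [hsq]; exact hmn)
  have h2 : ((d:ℝ) + 1) * m < k ^ (2 * E) * (n:ℝ) ^ d := by
    calc ((d:ℝ) + 1) * m ≤ 2 ^ d * (((d:ℝ) + 1) * m) := le_mul_of_one_le_left (by positivity) (one_le_pow₀ (by norm_num))
      _ < _ := h3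
      _ ≤ _ := by gcongr; exact le_self_pow₀ hn1 (by omega)
  have hb := count' (h := 0) hd hn hm hc hk0 (hkn.trans hκ1) rfl (hκ3 k hk0 hkn) (by rw [hth]; exact h2) (by rw [hth]; simpa using h3)
  rw [pow_zero, one_mul, ← hC0] at hb
  have hy : 2 * C0 * c * k ≤ 1 := by
    have : C0 * c * k ≤ C0 * c * κ := by gcongr
    nlinarith [show 0 < C0 * c * k by positivity]
  calc (#(FN n d m) : ℝ) * (c / n) ^ m ≤ #(FM n d m) * (c / n) ^ m := by gcongr; exact FN_le n d m
    _ ≤ _ := hb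
    _ = n ^ d * ((1 / 2) ^ m * (2 * C0 * c * k) ^ m) / k ^ 2 := by rw [← mul_pow]; ring_nf
    _ ≤ n ^ d * ((1 / 2) ^ m * (2 * C0 * c * k) ^ (q * (d + 1) + 2)) / k ^ 2 := by
        gcongr ?_ * (?_ * ?_) / ?_
        exact pow_le_pow_of_le_one (by positivity) hy hM
    _ = n ^ d * ((1 / 2) ^ m * ((2 * C0 * c) ^ (q * (d + 1) + 2) * (((n:ℝ)⁻¹) ^ (d + 1) * k ^ 2))) / k ^ 2 := by
        rw [mul_pow (2 * C0 * c) k, ← hkq, ← pow_mul, ← pow_add]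
    _ = _ := by rw [inv_pow, pow_succ (n:ℝ) d]; field_simp

lemma pow_bdd (k : ℕ) : ∃ K : ℝ, 0 ≤ K ∧ ∀ m : ℕ, (m:ℝ) ^ k ≤ K * 2 ^ m := by
  obtain ⟨K, hK⟩ := (tendsto_pow_const_div_const_pow_of_one_lt k (one_lt_two : (1:ℝ) < 2)).bddAbove_range
  refine ⟨max K 0, le_max_right _ _, fun m => ?_⟩
  rw [← div_le_iff₀ (by positivity)]
  exact (hK ⟨m, rfl⟩).trans (le_max_left _ _)

lemma large_regime {d : ℕ} (hd : 2 ≤ d) {c : ℝ} (hc : 0 < c) : ∃ (δ : ℝ) (K : ℝ), 0 < δ ∧ 0 ≤ K ∧ ∀ᶠ n : ℕ in atTop, ∀ m : ℕ, 1 ≤ m → (m:ℝ) ≤ δ * n ^ d →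
    (n:ℝ) ≤ (2 ^ d * (((d:ℝ) + 1) * m)) ^ 2 → (#(FN n d m) : ℝ) * (c / n) ^ m ≤ K * (1 / 2) ^ m / n := by
  obtain ⟨κ, hκ, hκ1, hκ2, hκ3⟩ := kap_ex d hc
  set C0 : ℝ := 1 + 2 ^ d * d with hC0
  have hC0' : 0 < C0 := by positivity
  set ε : ℝ := (κ ^ 2) ^ (d + 2) with hε
  set t := th d ε 0 with ht
  have ht0 : 0 < t := th_pos d (by positivity) 0
  obtain ⟨K0, hK0, hK⟩ := pow_bdd (2 * (d + 1))
  set B : ℝ := 2 ^ d * ((d:ℝ) + 1) with hB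
  have hB0 : 0 < B := by positivity
  set L : ℕ := ⌈B / t⌉₊ with hL
  refine ⟨t / (2 * (d + 1)), (B ^ 2) ^ (d + 1) * K0 / κ ^ 2, by positivity, by positivity, ?_⟩
  have hlim := (tendsto_pow_const_div_const_pow_of_one_lt (d * L) (one_lt_two : (1:ℝ) < 2)).const_mul ((3:ℝ) ^ (d * L))
  rw [mul_zero] at hlim
  filter_upwards [hlim.eventually_le_const one_pos, eventually_gt_atTop 0] with n hbn hn m hm hmd hmn
  have hn0 : (0:ℝ) < n := by exact_mod_cast hn
  have hn1 : (1:ℝ) ≤ n := by exact_mod_cast hn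
  have hm0 : (0:ℝ) < m := by exact_mod_cast hm
  have h2 : ((d:ℝ) + 1) * m < t * (n:ℝ) ^ d := by
    have h5 : ((d:ℝ) + 1) * m ≤ (d + 1) * (t / (2 * (d + 1)) * n ^ d) := by gcongr
    have h6 : ((d:ℝ) + 1) * (t / (2 * (d + 1)) * n ^ d) = t * n ^ d / 2 := by field_simp
    have : 0 < t * (n:ℝ) ^ d := by positivity
    linarith
  set h : ℕ := ⌊B * m / (t * n)⌋₊ with hh
  have h3 : 2 ^ d * (((d:ℝ) + 1) * m) < (h + 1) * (t * n) := by
    have := Nat.lt_floor_add_one (B * m / (t * n))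
    rw [div_lt_iff₀ (by positivity)] at this
    rw [← mul_assoc]; exact this
  have hb := count' (h := h) hd hn hm hc hκ hκ1 hε (hκ3 κ hκ le_rfl) h2 h3
  have hhn : h * n ≤ L * m := by
    have h4 : (h:ℝ) ≤ B * m / (t * n) := Nat.floor_le (by positivity)
    have h5 : B / t ≤ L := Nat.le_ceil _
    have : (h:ℝ) * n ≤ L * m := by
      calc (h:ℝ) * n ≤ B * m / (t * n) * n := by gcongr
        _ = B / t * m := by field_simp
        _ ≤ _ := by gcongr
    exact_mod_cast this
  have hbase : ((n:ℝ) + 1) ^ d + 1 ≤ (3 * n) ^ d := by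
    have h7 : ((n:ℝ) + 1) ^ d + 1 ^ d ≤ (n + 1 + 1) ^ d := pow_add_pow_le (by positivity) (by norm_num) (by omega)
    rw [one_pow] at h7
    refine h7.trans (pow_le_pow_left₀ (by positivity) (by linarith) _)
  have hbL : (((n:ℝ) + 1) ^ d + 1) ^ L ≤ 2 ^ n := by
    calc (((n:ℝ) + 1) ^ d + 1) ^ L ≤ ((3 * n) ^ d) ^ L := by gcongr
      _ = (3:ℝ) ^ (d * L) * (n:ℝ) ^ (d * L) := by rw [← pow_mul, mul_pow]
      _ ≤ 2 ^ n := by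
        rw [mul_div_assoc', div_le_one (by positivity)] at hbn; exact hbn
  have hbh : (((n:ℝ) + 1) ^ d + 1) ^ h ≤ 2 ^ m := by
    refine le_of_pow_le_pow_left₀ hn.ne' (by positivity) ?_
    calc ((((n:ℝ) + 1) ^ d + 1) ^ h) ^ n = (((n:ℝ) + 1) ^ d + 1) ^ (h * n) := by rw [pow_mul]
      _ ≤ (((n:ℝ) + 1) ^ d + 1) ^ (L * m) := pow_le_pow_right₀ (by
          have : (0:ℝ) ≤ ((n:ℝ) + 1) ^ d := by positivity
          linarith) hhn
      _ = ((((n:ℝ) + 1) ^ d + 1) ^ L) ^ m := by rw [pow_mul]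
      _ ≤ (2 ^ n) ^ m := by gcongr
      _ = _ := by rw [← pow_mul, ← pow_mul, mul_comm]
  have hnd : (n:ℝ) ^ d ≤ (B ^ 2) ^ (d + 1) * K0 * 2 ^ m / n := by
    rw [le_div_iff₀ hn0, ← pow_succ]
    calc (n:ℝ) ^ (d + 1) ≤ ((2 ^ d * (((d:ℝ) + 1) * m)) ^ 2) ^ (d + 1) := by gcongr
      _ = (B ^ 2) ^ (d + 1) * (m:ℝ) ^ (2 * (d + 1)) := by rw [← mul_assoc, ← hB, mul_pow, mul_pow, ← pow_mul (m:ℝ)]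
      _ ≤ (B ^ 2) ^ (d + 1) * (K0 * 2 ^ m) := by gcongr; exact hK m
      _ = _ := by ring
  calc (#(FN n d m) : ℝ) * (c / n) ^ m ≤ #(FM n d m) * (c / n) ^ m := by gcongr; exact FN_le n d m
    _ ≤ _ := hb
    _ ≤ 2 ^ m * ((B ^ 2) ^ (d + 1) * K0 * 2 ^ m / n) * (1 / 8) ^ m / κ ^ 2 := by
        rw [← hC0]
        gcongr
        linarith
    _ = _ := by
        have e : (1 / 2 : ℝ) ^ m = 2 ^ m * 2 ^ m * (1 / 8) ^ m := by rw [← mul_pow, ← mul_pow]; norm_num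
        rw [e]; generalize (B ^ 2) ^ (d + 1) = X; ring

lemma per_m {d : ℕ} (hd : 2 ≤ d) {c : ℝ} (hc : 0 < c) : ∃ (δ : ℝ) (K : ℝ), 0 < δ ∧ 0 ≤ K ∧ ∀ᶠ n : ℕ in atTop, ∀ m : ℕ, 1 ≤ m → (m:ℝ) ≤ δ * n ^ d →
    (#(FN n d m) : ℝ) * (c / n) ^ m ≤ K * (1 / 2) ^ m / n := by
  obtain ⟨M, K1, hK1, e1⟩ := mid_regime hd hc
  obtain ⟨δ, K2, hδ, hK2, e2⟩ := large_regime hd hc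
  set K3 : ℝ := ∑ m ∈ Finset.range M, 2 ^ m * 2 ^ 2 ^ m * c ^ m * 2 ^ m with hK3
  have hK30 : 0 ≤ K3 := sum_nonneg fun m _ => by positivity
  refine ⟨δ, K1 + K2 + K3, hδ, by positivity, ?_⟩
  filter_upwards [e1, e2, eventually_gt_atTop 0] with n e1 e2 hn m hm hmd
  have key : ∀ K, K ≤ K1 + K2 + K3 → (#(FN n d m) : ℝ) * (c / n) ^ m ≤ K * (1 / 2) ^ m / n →
      (#(FN n d m) : ℝ) * (c / n) ^ m ≤ (K1 + K2 + K3) * (1 / 2) ^ m / n := fun K hK h => h.trans (by gcongr)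
  rcases lt_or_ge m M with h | h
  · refine key K3 (by linarith) ((small_regime hd hm hn hc).trans ?_)
    refine div_le_div_of_nonneg_right ?_ (Nat.cast_nonneg n)
    have : (2:ℝ) ^ m * 2 ^ 2 ^ m * c ^ m * 2 ^ m ≤ K3 :=
      single_le_sum (f := fun m => (2:ℝ) ^ m * 2 ^ 2 ^ m * c ^ m * 2 ^ m) (fun m _ => by positivity) (Finset.mem_range.2 h)
    rw [one_div, inv_pow, ← div_eq_mul_inv, le_div_iff₀ (by positivity)]
    exact this
  · rcases lt_or_ge ((2 ^ d * (((d:ℝ) + 1) * m)) ^ 2) (n:ℝ) with h' | h'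
    · exact key K1 (by linarith) (e1 m hm h h')
    · exact key K2 (by linarith) (e2 m hm hmd h')

end
end LP
end

noncomputable section
namespace LP
section

open Classical in
def Pr (n d : ℕ) (p : ℝ) (P : Finset (Finset (Fin n)) → Prop) : ℝ := Ex (UU n d) p (fun S => if P S then 1 else 0)

lemma YM_Pr {n d : ℕ} {p : ℝ} (h0 : 0 ≤ p) (h1 : p ≤ 1) (P : Finset (Finset (Fin n)) → Prop) :
    YMeasure n d p {ω | P (faces ω)} = ENNReal.ofReal (Pr n d p P) := by
  classical
  exact YMeasure_eq h0 h1 P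

def bad (d : ℕ) (δ : ℝ) {n : ℕ} (S : Finset (Finset (Fin n))) : Prop :=
  ∃ C ⊆ S, C.Nonempty ∧ IsCore C ∧ (#C : ℝ) ≤ δ * n ^ d ∧ ¬ hasSimp d C

lemma exists_min_core {n d : ℕ} {C : Finset (Finset (Fin n))} (hC : C ⊆ UU n d) (hne : C.Nonempty) (hc : IsCore C)
    (hs : ¬ hasSimp d C) : ∃ D ⊆ C, 1 ≤ #D ∧ D ∈ FN n d #D := by
  classical
  obtain ⟨D, hD, hmin⟩ := exists_min_image (C.powerset.filter fun P => P.Nonempty ∧ IsCore P) Finset.card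
    ⟨C, Finset.mem_filter.2 ⟨mem_powerset_self C, hne, hc⟩⟩
  obtain ⟨h1, h2, h3⟩ := Finset.mem_filter.1 hD
  rw [mem_powerset] at h1
  refine ⟨D, h1, Finset.card_pos.2 h2, Finset.mem_filter.2 ⟨Finset.mem_filter.2 ⟨mem_univ _, h1.trans hC, rfl, h3, fun P hP hPn hPc => ?_⟩, fun ⟨τ, hτ, hτs⟩ => hs ⟨τ, hτ, hτs.trans h1⟩⟩⟩
  exact eq_of_subset_of_card_le hP (hmin P (Finset.mem_filter.2 ⟨Finset.mem_powerset.2 (hP.trans h1), hPn, hPc⟩))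

lemma bad_bound {d : ℕ} (hd : 2 ≤ d) {c : ℝ} (hc : 0 < c) : ∃ (δ : ℝ), 0 < δ ∧ Tendsto (fun n : ℕ => Pr n d (c / n) (bad d δ)) atTop (nhds 0) := by
  classical
  obtain ⟨δ, K, hδ, hK, hev⟩ := per_m hd hc
  refine ⟨δ, hδ, ?_⟩
  have hp0 : Tendsto (fun n : ℕ => c / (n:ℝ)) atTop (nhds 0) := tendsto_const_div_atTop_nhds_zero_nat c
  refine squeeze_zero' (g := fun n : ℕ => K * 2 / (n:ℝ)) ?_ ?_ (tendsto_const_div_atTop_nhds_zero_nat _)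
  · filter_upwards [hp0.eventually_le_const one_pos] with n hn
    exact Ex_nonneg (by positivity) hn fun S _ => by split_ifs <;> norm_num
  filter_upwards [hev, hp0.eventually_le_const one_pos] with n h hn
  set N := ⌊δ * (n:ℝ) ^ d⌋₊ with hN
  have h1 : Pr n d (c / n) (bad d δ) ≤ Ex (UU n d) (c / n) (fun S => ∑ m ∈ Finset.Icc 1 N, ∑ C ∈ FN n d m, if C ⊆ S then 1 else 0) := by
    refine Ex_mono (by positivity) hn fun S hS => ?_
    split_ifs with hb
    · obtain ⟨C, hCS, hne, hcore, hcard, hs⟩ := hb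
      obtain ⟨D, hDC, hD1, hD⟩ := exists_min_core (hCS.trans hS) hne hcore hs
      have hDN : #D ∈ Finset.Icc 1 N := Finset.mem_Icc.2 ⟨hD1, Nat.le_floor (le_trans (by exact_mod_cast card_le_card hDC) hcard)⟩
      have hnn : ∀ m, ∀ C ∈ FN n d m, (0:ℝ) ≤ if C ⊆ S then 1 else 0 := fun m C _ => by split_ifs <;> norm_num
      refine le_trans ?_ (single_le_sum (fun m _ => sum_nonneg (hnn m)) hDN)
      refine le_trans ?_ (single_le_sum (hnn _) hD)
      rw [if_pos (hDC.trans hCS)]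
    · exact sum_nonneg fun m _ => sum_nonneg fun C _ => by split_ifs <;> norm_num
  refine h1.trans ?_
  rw [Ex_sum]
  have h2 : ∀ m ∈ Finset.Icc 1 N, Ex (UU n d) (c / n) (fun S => ∑ C ∈ FN n d m, if C ⊆ S then (1:ℝ) else 0) ≤ K / n * (1 / 2) ^ m := by
    intro m hm
    obtain ⟨hm1, hm2⟩ := Finset.mem_Icc.1 hm
    rw [Ex_sum]
    have h3 : ∀ C ∈ FN n d m, Ex (UU n d) (c / n) (fun S => if C ⊆ S then (1:ℝ) else 0) = (c / n) ^ m := by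
      intro C hC
      have hC := (Finset.mem_filter.1 (FN_le n d m hC)).2
      rw [← hC.2.1]
      convert Ex_superset hC.1 (c / (n:ℝ)) using 3
    rw [sum_congr rfl h3, sum_const, nsmul_eq_mul]
    refine (h m hm1 ((Nat.le_floor_iff (by positivity)).1 hm2)).trans (le_of_eq (by ring))
  refine (sum_le_sum h2).trans ?_
  rw [← mul_sum, mul_comm K 2, mul_div_assoc, mul_comm (2:ℝ)]
  gcongr
  refine le_trans ?_ tsum_geometric_two.le
  exact summable_geometric_two.sum_le_tsum _ fun _ _ => by positivity

lemma good_tendsto {d : ℕ} (hd : 2 ≤ d) {x c : ℝ} (hx : x ∈ Set.Ioo (0:ℝ) 1) (h0 : ps d x = 0) (hc0 : 0 < c)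
    (hc : c < -Real.log x / (1 - x) ^ d) : Tendsto (fun n : ℕ => Pr n d (c / n) (fun S => ¬ goodS d S)) atTop (nhds 0) := by
  classical
  obtain ⟨δ, hδ, hbad⟩ := bad_bound hd hc0
  obtain ⟨c', hc1, hc2⟩ := exists_between hc
  have hp0 : Tendsto (fun n : ℕ => c / (n:ℝ)) atTop (nhds 0) := tendsto_const_div_atTop_nhds_zero_nat c
  have hp0' : Tendsto (fun n : ℕ => c' / (n:ℝ)) atTop (nhds 0) := tendsto_const_div_atTop_nhds_zero_nat c'
  rw [Metric.tendsto_atTop']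
  suffices H : ∀ ε > 0, ∀ᶠ n : ℕ in atTop, dist (Pr n d (c / n) (fun S => ¬ goodS d S)) 0 < ε by
    intro ε hε
    obtain ⟨N, hN⟩ := eventually_atTop.1 (H ε hε)
    exact ⟨N, fun n hn => hN n (le_of_lt hn)⟩
  intro ε hε
  have hcc : 0 < c' - c := by linarith
  set η := (c' - c) / c * (δ * (ε / 4)) with hη
  have hη0 : 0 < η := by positivity
  filter_upwards [Ebeta hd hx h0 (hc0.trans hc1) hc2 hη0, hbad.eventually_lt_const (half_pos hε), hp0.eventually_le_const one_pos,
    hp0'.eventually_le_const one_pos, eventually_gt_atTop 0] with n e1 e2 e3 e4 hn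
  have hn0 : (0:ℝ) < n := by exact_mod_cast hn
  have hp : 0 ≤ c / (n:ℝ) := by positivity
  have hcy := cyc_bound (U := UU n d) hp (show c / (n:ℝ) < c' / n by gcongr) e4
  have hcy2 : Ex (UU n d) (c / n) (fun S => (#(cyc S) : ℝ)) ≤ δ * (ε / 4) * n ^ d := by
    have h5 : (c' / (n:ℝ) - c / n) * Ex (UU n d) (c / n) (fun S => (#(cyc S) : ℝ)) ≤ (c' / (n:ℝ) - c / n) * (δ * (ε / 4) * n ^ d) := by
      refine (hcy.trans (mul_le_mul_of_nonneg_left e1 hp)).trans (le_of_eq ?_)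
      rw [hη]; field_simp
    refine le_of_mul_le_mul_left h5 ?_
    rw [← sub_div]; positivity
  have hmk := Ex_markov (U := UU n d) hp e3 (show 0 < δ * (n:ℝ) ^ d by positivity) (g := fun S => (#(cyc S) : ℝ))
    (fun S _ => Nat.cast_nonneg _) (fun S => δ * (n:ℝ) ^ d ≤ #(cyc S)) (fun S _ h => h)
  have hmk2 : Ex (UU n d) (c / n) (fun S => (#(cyc S) : ℝ)) / (δ * (n:ℝ) ^ d) ≤ ε / 4 := by
    rw [div_le_iff₀ (by positivity)]; linarith
  have hle : Pr n d (c / n) (fun S => ¬ goodS d S) ≤ Ex (UU n d) (c / n) (fun S => if δ * (n:ℝ) ^ d ≤ #(cyc S) then 1 else 0) + Pr n d (c / n) (bad d δ) := by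
    unfold Pr
    rw [← Ex_add]
    refine Ex_mono hp e3 fun S _ => ?_
    by_cases hA : δ * (n:ℝ) ^ d ≤ #(cyc S)
    · rw [if_pos hA]; split_ifs <;> norm_num
    · by_cases hg : goodS d S
      · rw [if_neg (not_not.2 hg), if_neg hA]; split_ifs <;> norm_num
      · have hB : bad d δ S := by
          unfold goodS at hg
          push Not at hg
          obtain ⟨C, h1, h2, h3, h4⟩ := hg
          refine ⟨C, h1.trans (filter_subset _ _), h2, h3, ?_, h4⟩
          exact le_trans (by exact_mod_cast card_le_card h1) (le_of_not_ge hA)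
        rw [if_pos hg, if_neg hA, if_pos hB]; norm_num
  have hnn : 0 ≤ Pr n d (c / n) (fun S => ¬ goodS d S) := Ex_nonneg hp e3 fun S _ => by split_ifs <;> norm_num
  rw [Real.dist_eq, sub_zero, abs_of_nonneg hnn]
  linarith

lemma final {d : ℕ} (hd : 2 ≤ d) {x c : ℝ} (hx : x ∈ Set.Ioo (0:ℝ) 1) (h0 : ps d x = 0) (hc0 : 0 < c)
    (hc : c < -Real.log x / (1 - x) ^ d) :
    Tendsto (fun n : ℕ => YMeasure n d (c / n) {ω | spanProp ω}) atTop (nhds (1 : ENNReal)) ∧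
    Tendsto (fun n : ℕ => YMeasure n d (c / n) {ω | TopHomologyZero (Ycomplex n d ω) d ℝ})
      atTop (nhds (ENNReal.ofReal (Real.exp (-(c ^ (d + 2)) / (Nat.factorial (d + 2)))))) := by
  classical
  have hg := good_tendsto hd hx h0 hc0 hc
  have hp0 : Tendsto (fun n : ℕ => c / (n:ℝ)) atTop (nhds 0) := tendsto_const_div_atTop_nhds_zero_nat c
  have hp1 := hp0.eventually_le_const one_pos
  have hpl : Tendsto (fun n : ℕ => Pr n d (c / n) (fun S => ¬ hasSimp d S)) atTop (nhds (Real.exp (-(c ^ (d + 2)) / (Nat.factorial (d + 2))))) := by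
    refine (poisson_limit (by omega) hc0).congr fun n => ?_
    exact Ex_congr _ fun S _ => by congr
  constructor
  · have hlow : Tendsto (fun n : ℕ => ENNReal.ofReal (1 - Pr n d (c / n) (fun S => ¬ goodS d S))) atTop (nhds 1) := by
      have := ENNReal.tendsto_ofReal (hg.const_sub 1)
      simpa using this
    refine tendsto_of_tendsto_of_tendsto_of_le_of_le' hlow tendsto_const_nhds ?_ ?_
    · filter_upwards [hp1] with n hn
      have hp : 0 ≤ c / (n:ℝ) := by positivity
      have e : 1 - Pr n d (c / n) (fun S => ¬ goodS d S) = Pr n d (c / n) (goodS d) := by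
        rw [← Ex_const (UU n d) (c / n) 1]
        unfold Pr
        rw [← Ex_sub]
        exact Ex_congr _ fun S _ => by by_cases h : goodS d S <;> simp [h]
      rw [e, ← YM_Pr hp hn]
      exact measure_mono fun ω h => span_of_good h
    · filter_upwards [hp1] with n hn
      have hp : 0 ≤ c / (n:ℝ) := by positivity
      have e := YM_Pr (n := n) (d := d) hp hn (fun _ => True)
      have e' : Pr n d (c / n) (fun _ => True) = 1 := by
        unfold Pr; simp only [if_true]; exact Ex_const _ _ _
      rw [e', ENNReal.ofReal_one] at e
      rw [← e]
      exact measure_mono fun _ _ => trivial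
  · have hlow := ENNReal.tendsto_ofReal (hpl.sub hg)
    rw [sub_zero] at hlow
    refine tendsto_of_tendsto_of_tendsto_of_le_of_le' hlow (ENNReal.tendsto_ofReal hpl) ?_ ?_
    · filter_upwards [hp1] with n hn
      have hp : 0 ≤ c / (n:ℝ) := by positivity
      have e : Pr n d (c / n) (fun S => ¬ hasSimp d S) - Pr n d (c / n) (fun S => ¬ goodS d S) ≤ Pr n d (c / n) (fun S => ¬ hasSimp d S ∧ goodS d S) := by
        unfold Pr
        rw [← Ex_sub]
        exact Ex_mono hp hn fun S _ => by by_cases h : goodS d S <;> by_cases h' : hasSimp d S <;> simp [h, h']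
      refine (ENNReal.ofReal_le_ofReal e).trans ?_
      rw [← YM_Pr hp hn]
      exact measure_mono fun ω h => thz_of (span_of_good h.2) h.1
    · filter_upwards [hp1] with n hn
      have hp : 0 ≤ c / (n:ℝ) := by positivity
      rw [← YM_Pr hp hn]
      exact measure_mono fun ω h h' => not_thz h' h

end
end LP
end


noncomputable section
/-- **Below `c_d*`, top homology is generated by simplex boundaries**
(Linial–Peled). Fix `d ≥ 2`, let `x ∈ (0,1)` be the root of
`(d+1)(1−x) + (1+dx)log x = 0`, `c_d* = −log x/(1−x)^d`, and `p = c/n` with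
`0 < c < c_d*`. Then w.h.p. every element of the kernel of the `d`-th boundary
map of `Y_d(n,p)` over `ℝ` lies in the span of the boundaries of
`(d+1)`-simplices, and consequently
`P[H_d(Y_d(n,p), ℝ) = 0] → exp(−c^{d+2}/(d+2)!)`. -/
theorem linial_peled (d : ℕ) (hd : 2 ≤ d)
    (x : ℝ) (hx : x ∈ Set.Ioo (0 : ℝ) 1)
    (hroot : ((d : ℝ) + 1) * (1 - x) + (1 + (d : ℝ) * x) * Real.log x = 0)
    (c : ℝ) (hc0 : 0 < c) (hc : c < (-Real.log x) / (1 - x) ^ d) :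
    Tendsto (fun n : ℕ => YMeasure n d (c / n)
        {ω | ∀ f : Chains (Ycomplex n d ω) (d + 1) ℝ,
          chainBoundary (Ycomplex n d ω) d f = 0 →
          f ∈ Submodule.span ℝ
            {g : Chains (Ycomplex n d ω) (d + 1) ℝ | ∃ τ : Finset (Fin n),
              τ.card = d + 2 ∧ (∀ σ ⊆ τ, σ.card = d + 1 → σ ∈ Ycomplex n d ω) ∧
              g = simplexBoundaryChain (Ycomplex n d ω) (d + 1) τ}})
      atTop (nhds (1 : ENNReal)) ∧
    Tendsto (fun n : ℕ => YMeasure n d (c / n)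
        {ω | TopHomologyZero (Ycomplex n d ω) d ℝ})
      atTop (nhds (ENNReal.ofReal
        (Real.exp (-(c ^ (d + 2)) / (Nat.factorial (d + 2)))))) := by
  exact LP.final hd hx hroot hc0 hc
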